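/- arXiv:0710.2347 — 5 statements merged into one kernel-verified Lean document; each statement's English description precedes it below -/
import Mathlib

section
/- For every set S of positive reals, the class of finite convexly ordered ultrametric spaces with distances in S has the Ramsey property: for all finite ultrametric spaces X and Y with all nonzero distances in S, equipped with convex linear orderings <^X and <^Y respectively, and every integer k ≥ 1, there exists a finite ultrametric space Z with nonzero distances in S and a convex linear ordering <^Z on Z such that for every coloring of the copies of (X,<^X) in (Z,<^Z) with k colors, there is a copy Ỹ of (Y,<^Y) in (Z,<^Z) such that all copies of (X,<^X) contained in Ỹ receive the same color. -/
/-- A finite ultrametric space with all nonzero distances in `S`. -/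
structure FinUltra (S : Set ℝ) where
  n : ℕ
  d : Fin n → Fin n → ℝ
  d_self : ∀ x, d x x = 0
  d_symm : ∀ x y, d x y = d y x
  d_mem : ∀ x y, x ≠ y → d x y ∈ S
  ultra : ∀ x y z, d x z ≤ max (d x y) (d y z)

/-- `r` is a strict total order (irreflexive, transitive, trichotomous). -/
def IsSTO {X : Type*} (r : X → X → Prop) : Prop :=
  (∀ x, ¬ r x x) ∧ (∀ x y z, r x y → r y z → r x z) ∧ (∀ x y, r x y ∨ x = y ∨ r y x)

/-- `r` is a convex linear ordering with respect to the distance `d` : a strict total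
order for which every closed metric ball is an interval (equivalently,
`r x y → r y z → d x y ≤ d x z ∧ d y z ≤ d x z`). -/
def IsConvexSTO {X : Type*} (d : X → X → ℝ) (r : X → X → Prop) : Prop :=
  IsSTO r ∧ ∀ x y z, r x y → r y z → d x y ≤ d x z ∧ d y z ≤ d x z

/-- `A` is a copy of the ordered space `(X, rX)` inside `(Z, rZ)` : the image of an
isometric, order-preserving embedding. -/
def IsOrdCopy {S : Set ℝ} (X Z : FinUltra S) (rX : Fin X.n → Fin X.n → Prop)
    (rZ : Fin Z.n → Fin Z.n → Prop) (A : Set (Fin Z.n)) : Prop :=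
  ∃ f : Fin X.n → Fin Z.n, Set.range f = A ∧
    (∀ a b, Z.d (f a) (f b) = X.d a b) ∧ (∀ a b, rX a b → rZ (f a) (f b))

/-- `A` is an isometric copy of `X` inside `Z`. -/
def IsCopy {S : Set ℝ} (X Z : FinUltra S) (A : Set (Fin Z.n)) : Prop :=
  ∃ f : Fin X.n → Fin Z.n, Set.range f = A ∧ ∀ a b, Z.d (f a) (f b) = X.d a b

/-- The number τ(X) = |cLO(X)| / |iso(X)|. -/
noncomputable def tau (S : Set ℝ) (X : FinUltra S) : ℕ :=
  Nat.card {r : Fin X.n → Fin X.n → Prop // IsConvexSTO X.d r} /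
    Nat.card {g : Fin X.n ≃ Fin X.n // ∀ a b, X.d (g a) (g b) = X.d a b}

/-- Finite Ramsey theorem for the `r`-element subsets of a finite set. -/
theorem finite_ramsey_finset (k r q : ℕ) :
    ∃ N : ℕ, ∀ (α : Type) [LinearOrder α] (V : Finset α), N ≤ V.card → ∀ c : Finset α → Fin k,
      ∃ H ⊆ V, H.card = q ∧
        ∀ A ⊆ H, ∀ B ⊆ H, A.card = r → B.card = r → c A = c B := by
  induction r generalizing q with
  | zero =>
    refine ⟨q, fun α _ V hV c => ?_⟩
    obtain ⟨H, hHV, hH⟩ := Finset.exists_subset_card_eq hV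
    refine ⟨H, hHV, hH, fun A _ B _ hA hB => ?_⟩
    rw [Finset.card_eq_zero.1 hA, Finset.card_eq_zero.1 hB]
  | succ r ih =>
    have prehomogeneous : ∀ l : ℕ, ∃ M : ℕ, ∀ (α : Type) [LinearOrder α] (V : Finset α), M ≤ V.card →
        ∀ c : Finset α → Fin k, ∃ H ⊆ V, H.card = l ∧
          ∀ a ∈ H, ∀ A ⊆ H, ∀ B ⊆ H, A.card = r → B.card = r →
            (∀ x ∈ A, a < x) → (∀ x ∈ B, a < x) → c (insert a A) = c (insert a B) := by
      intro l
      induction l with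
      | zero =>
        refine ⟨0, fun α _ V _ c => ⟨∅, by simp, rfl, by simp⟩⟩
      | succ l ihl =>
        obtain ⟨M, hM⟩ := ihl
        obtain ⟨N, hN⟩ := ih M
        refine ⟨N + 1, fun α _ V hV c => ?_⟩
        have hne : V.Nonempty := Finset.card_pos.1 (by omega)
        have hv : V.min' hne ∈ V := V.min'_mem hne
        obtain ⟨V', hV'V, hV'card, hV'⟩ := hN α (V.erase (V.min' hne))
          (by rw [Finset.card_erase_of_mem hv]; omega) (fun A => c (insert (V.min' hne) A))
        obtain ⟨H, hHV', hHcard, hH⟩ := hM α V' hV'card.ge c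
        have hlt : ∀ x ∈ H, V.min' hne < x := fun x hx =>
          V.min'_lt_of_mem_erase_min' hne (hV'V (hHV' hx))
        have hvH : V.min' hne ∉ H := fun h => lt_irrefl _ (hlt _ h)
        have hsub : ∀ a ∈ insert (V.min' hne) H, ∀ A ⊆ insert (V.min' hne) H,
            (∀ x ∈ A, a < x) → A ⊆ H := by
          intro a ha A hA haA x hx
          rcases Finset.mem_insert.1 (hA hx) with rfl | h
          · rcases Finset.mem_insert.1 ha with rfl | h'
            · exact absurd (haA _ hx) (lt_irrefl _)
            · exact absurd (hlt _ h') (haA _ hx).asymm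
          · exact h
        refine ⟨insert (V.min' hne) H, ?_, ?_, ?_⟩
        · intro x hx
          rcases Finset.mem_insert.1 hx with rfl | h
          · exact hv
          · exact Finset.mem_of_mem_erase (hV'V (hHV' h))
        · rw [Finset.card_insert_of_notMem hvH, hHcard]
        · intro a ha A hA B hB hAr hBr haA haB
          have hAH := hsub a ha A hA haA
          have hBH := hsub a ha B hB haB
          rcases Finset.mem_insert.1 ha with rfl | h
          · exact hV' A (hAH.trans hHV') B (hBH.trans hHV') hAr hBr
          · exact hH a h A hAH B hBH hAr hBr haA haB
    obtain ⟨M, hM⟩ := prehomogeneous (k * q)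
    refine ⟨M, fun α _ V hV c => ?_⟩
    obtain ⟨H, hHV, hHcard, hH⟩ := hM α V hV c
    have hcol : ∀ a ∈ H, ∃ i : Fin k, ∀ A ⊆ H, A.card = r → (∀ x ∈ A, a < x) →
        c (insert a A) = i := by
      intro a ha
      by_cases hex : ∃ A ⊆ H, A.card = r ∧ ∀ x ∈ A, a < x
      · obtain ⟨A, hA, hAr, haA⟩ := hex
        exact ⟨c (insert a A), fun B hB hBr haB => hH a ha B hB A hA hBr hAr haB haA⟩
      · exact ⟨c ∅, fun B hB hBr haB => absurd ⟨B, hB, hBr, haB⟩ hex⟩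
    have hk : 0 < k := (c ∅).pos
    have : Nonempty (Fin k) := ⟨⟨0, hk⟩⟩
    choose! γ hγ using hcol
    obtain ⟨i, H', hH'H, hH'card, hH'⟩ : ∃ i : Fin k, ∃ H' ⊆ H, H'.card = q ∧
        ∀ a ∈ H', γ a = i := by
      obtain ⟨i, -, hi⟩ := Finset.exists_le_card_fiber_of_mul_le_card_of_maps_to
        (s := H) (t := (Finset.univ : Finset (Fin k))) (f := γ) (n := q)
        (fun a _ => Finset.mem_univ _) ⟨⟨0, hk⟩, Finset.mem_univ _⟩
        (by rw [Finset.card_univ, Fintype.card_fin, hHcard])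
      obtain ⟨H', hH', hcard⟩ := Finset.exists_subset_card_eq hi
      exact ⟨i, H', hH'.trans (Finset.filter_subset _ _), hcard,
        fun a ha => (Finset.mem_filter.1 (hH' ha)).2⟩
    have hcolor : ∀ A ⊆ H', A.card = r + 1 → c A = i := by
      intro A hA hAr
      have hne : A.Nonempty := Finset.card_pos.1 (by omega)
      have hm := A.min'_mem hne
      have hc := hγ _ (hH'H (hA hm)) (A.erase (A.min' hne))
        ((Finset.erase_subset _ _).trans (hA.trans hH'H))
        (by rw [Finset.card_erase_of_mem hm]; omega)
        (fun x hx => A.min'_lt_of_mem_erase_min' hne hx)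
      rw [Finset.insert_erase hm] at hc
      rw [hc, hH' _ (hA hm)]
    exact ⟨H', hH'H.trans hHV, hH'card, fun A hA B hB hAr hBr => by
      rw [hcolor A hA hAr, hcolor B hB hBr]⟩

/-- Finite Ramsey theorem for strictly monotone maps between finite linear orders. -/
theorem finite_ramsey_strictMono (P Q : Type*) [LinearOrder P] [Finite P]
    [LinearOrder Q] [Finite Q] (k : ℕ) [NeZero k] :
    ∃ N : ℕ, ∀ c : (P → Fin N) → Fin k, ∃ h : Q → Fin N, StrictMono h ∧
      ∀ f₁ f₂ : P → Q, StrictMono f₁ → StrictMono f₂ → c (h ∘ f₁) = c (h ∘ f₂) := by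
  classical
  have := Fintype.ofFinite P
  have := Fintype.ofFinite Q
  obtain ⟨M, hM⟩ := finite_ramsey_finset k (Fintype.card P) (Fintype.card Q)
  refine ⟨M, fun c => ?_⟩
  let c' : Finset (Fin M) → Fin k := fun A =>
    if hA : ∃ g : P → Fin M, StrictMono g ∧ Set.range g = A then c hA.choose else 0
  have hc' : ∀ g : P → Fin M, StrictMono g → c' (Finset.univ.image g) = c g := by
    intro g hg
    have hA : ∃ g' : P → Fin M, StrictMono g' ∧ Set.range g' = (Finset.univ.image g : Finset _) :=
      ⟨g, hg, by simp⟩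
    have hr : Set.range hA.choose = Set.range g := by rw [hA.choose_spec.2]; simp
    simp only [c', dif_pos hA]
    rw [(hA.choose_spec.1.range_inj hg).1 hr]
  obtain ⟨H, -, hHcard, hH⟩ := hM (Fin M) Finset.univ (by simp) c'
  let h : Q → Fin M := fun x =>
    H.orderEmbOfFin hHcard ((Fintype.orderIsoFinOfCardEq Q rfl).symm x)
  have hh : StrictMono h := fun x y hxy => by simpa [h] using hxy
  have himage : ∀ f : P → Q, Finset.univ.image (h ∘ f) ⊆ H := by
    intro f x hx
    obtain ⟨p, -, rfl⟩ := Finset.mem_image.1 hx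
    exact H.orderEmbOfFin_mem hHcard _
  have hcard : ∀ f : P → Q, StrictMono f →
      (Finset.univ.image (h ∘ f)).card = Fintype.card P := fun f hf => by
    rw [Finset.card_image_of_injective _ (hh.comp hf).injective, Finset.card_univ]
  refine ⟨h, hh, fun f₁ f₂ hf₁ hf₂ => ?_⟩
  rw [← hc' _ (hh.comp hf₁), ← hc' _ (hh.comp hf₂)]
  exact hH _ (himage f₁) _ (himage f₂) (hcard f₁ hf₁) (hcard f₂ hf₂)

/-- `d` is an ultrametric on the linear order `X`, the order is convex for `d`, and all nonzero
distances lie in the finite set `F` of positive reals. -/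
structure IsConvexUltrametric {X : Type*} [LinearOrder X] (F : Finset ℝ) (d : X → X → ℝ) :
    Prop where
  pos : ∀ s ∈ F, 0 < s
  self : ∀ x, d x x = 0
  symm : ∀ x y, d x y = d y x
  mem : ∀ x y, x ≠ y → d x y ∈ F
  ultra : ∀ x y z, d x z ≤ max (d x y) (d y z)
  convex : ∀ x y z, x < y → y < z → d x y ≤ d x z ∧ d y z ≤ d x z

namespace IsConvexUltrametric

variable {X Y : Type*} [LinearOrder X] [Finite X] [LinearOrder Y] [Finite Y] {F : Finset ℝ}
  {d : X → X → ℝ} {e : Y → Y → ℝ}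

theorem exists_first (hd : IsConvexUltrametric F d) (x : X) (s : F) :
    ∃ m, d x m < s ∧ ∀ y, d x y < s → m ≤ y := by
  obtain ⟨m, hm, hmin⟩ := WellFounded.has_min (wellFounded_lt (α := X)) {y | d x y < s}
    ⟨x, by simpa [hd.self] using hd.pos s s.2⟩
  exact ⟨m, hm, fun y hy => not_lt.1 (hmin y hy)⟩

/-- The least point at distance less than `s` from `x`. -/
noncomputable def first (hd : IsConvexUltrametric F d) (x : X) (s : F) : X :=
  (hd.exists_first x s).choose

theorem dist_first_lt (hd : IsConvexUltrametric F d) (x : X) (s : F) : d x (hd.first x s) < s :=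
  (hd.exists_first x s).choose_spec.1

theorem first_le_of_dist_lt (hd : IsConvexUltrametric F d) {x y : X} {s : F} (h : d x y < s) :
    hd.first x s ≤ y :=
  (hd.exists_first x s).choose_spec.2 y h

theorem first_le (hd : IsConvexUltrametric F d) (x : X) (s : F) : hd.first x s ≤ x :=
  hd.first_le_of_dist_lt (by simpa [hd.self] using hd.pos s s.2)

theorem first_anti (hd : IsConvexUltrametric F d) (x : X) {s t : F} (h : s ≤ t) :
    hd.first x t ≤ hd.first x s :=
  hd.first_le_of_dist_lt ((hd.dist_first_lt x s).trans_le h)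

theorem first_eq_first_iff (hd : IsConvexUltrametric F d) {x y : X} {s : F} :
    hd.first x s = hd.first y s ↔ d x y < s := by
  constructor
  · intro h
    refine (hd.ultra x (hd.first x s) y).trans_lt (max_lt (hd.dist_first_lt x s) ?_)
    rw [h, hd.symm]
    exact hd.dist_first_lt y s
  · intro h
    refine le_antisymm (hd.first_le_of_dist_lt ?_) (hd.first_le_of_dist_lt ?_)
    · exact (hd.ultra x y _).trans_lt (max_lt h (hd.dist_first_lt y s))
    · exact (hd.ultra y x _).trans_lt (max_lt (hd.symm x y ▸ h) (hd.dist_first_lt x s))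

theorem first_first (hd : IsConvexUltrametric F d) (x : X) (s : F) :
    hd.first (hd.first x s) s = hd.first x s :=
  hd.first_eq_first_iff.2 (hd.symm x _ ▸ hd.dist_first_lt x s)

theorem lt_first (hd : IsConvexUltrametric F d) {x y : X} {s : F} (hxy : x < y)
    (h : s ≤ d x y) : x < hd.first y s := by
  by_contra! hle
  have hlt : d (hd.first y s) y < s := hd.symm y _ ▸ hd.dist_first_lt y s
  rcases hle.eq_or_lt with heq | hlt'
  · rw [heq] at hlt
    exact hlt.not_ge h
  · exact ((hd.convex _ _ _ hlt' hxy).2.trans_lt hlt).not_ge h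

/-- The open balls of radius in `F`, each given by its least point and its radius, ordered by
least point and then by decreasing radius. -/
abbrev Node (hd : IsConvexUltrametric F d) : Type _ :=
  {p : X ×ₗ (F : Type)ᵒᵈ //
    hd.first (ofLex p).1 (OrderDual.ofDual (ofLex p).2) = (ofLex p).1}

/-- The ball of radius `s` containing `x`. -/
noncomputable def node (hd : IsConvexUltrametric F d) (x : X) (s : F) : hd.Node :=
  ⟨toLex (hd.first x s, OrderDual.toDual s), hd.first_first x s⟩

/-- The map on balls induced by a map of the underlying spaces. -/
noncomputable def mapNode (hd : IsConvexUltrametric F d) (he : IsConvexUltrametric F e)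
    (f : X → Y) (p : hd.Node) : he.Node :=
  he.node (f (ofLex p.1).1) (OrderDual.ofDual (ofLex p.1).2)

theorem mapNode_node (hd : IsConvexUltrametric F d) (he : IsConvexUltrametric F e) {f : X → Y}
    (hf : ∀ x y, e (f x) (f y) = d x y) (x : X) (s : F) :
    hd.mapNode he f (hd.node x s) = he.node (f x) s := by
  have h : he.first (f (hd.first x s)) s = he.first (f x) s := by
    rw [he.first_eq_first_iff, hf, hd.symm]
    exact hd.dist_first_lt x s
  exact Subtype.ext (congrArg (fun y => toLex (y, OrderDual.toDual s)) h)

theorem strictMono_mapNode (hd : IsConvexUltrametric F d) (he : IsConvexUltrametric F e)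
    {f : X → Y} (hf : ∀ x y, e (f x) (f y) = d x y) (hmono : StrictMono f) :
    StrictMono (hd.mapNode he f) := by
  rintro ⟨p, hp⟩ ⟨q, hq⟩ hpq
  have hlt : p < q := hpq
  refine Prod.Lex.toLex_lt_toLex.2 ?_
  simp only
  rcases Prod.Lex.lt_iff.1 hlt with h | ⟨h, h'⟩
  · refine Or.inl ((he.first_le _ _).trans_lt (he.lt_first (hmono h) ?_))
    rw [hf]
    by_contra! hs
    rw [hd.symm] at hs
    exact (hq.symm.trans_le (hd.first_le_of_dist_lt hs)).not_gt h
  · rw [h]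
    rcases (he.first_anti (f (ofLex q).1) (le_of_lt h')).lt_or_eq with h'' | h''
    · exact Or.inl h''
    · exact Or.inr ⟨h'', h'⟩

end IsConvexUltrametric

/-- The distance on labelings `F → α`: the largest `s ∈ F` at which two labelings differ. -/
noncomputable def labelDist {α : Type*} {F : Finset ℝ} (z w : F → α) : ℝ :=
  open Classical in
  if h : (Finset.univ.filter fun s => z s ≠ w s).Nonempty
  then (Finset.univ.filter fun s => z s ≠ w s).max' h else 0

/-- The lexicographic order on labelings `F → α`, larger elements of `F` coming first. -/
def LabelLT {α : Type*} [LinearOrder α] {F : Finset ℝ} (z w : F → α) : Prop :=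
  ∃ s, z s < w s ∧ ∀ t, s < t → z t = w t

section Labelings

variable {α : Type*} {F : Finset ℝ}

theorem exists_last_ne {z w : F → α} (h : z ≠ w) :
    ∃ s, z s ≠ w s ∧ ∀ t, s < t → z t = w t := by
  obtain ⟨s, hs, hmax⟩ := WellFounded.has_min (wellFounded_gt (α := F)) {s | z s ≠ w s}
    (Function.ne_iff.1 h)
  exact ⟨s, hs, fun t ht => not_not.1 fun h' => hmax t h' ht⟩

theorem labelDist_eq {z w : F → α} {s : F} (hs : z s ≠ w s) (h : ∀ t, s < t → z t = w t) :
    labelDist z w = s := by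
  classical
  have hne : (Finset.univ.filter fun s => z s ≠ w s).Nonempty := ⟨s, by simpa using hs⟩
  rw [labelDist, dif_pos hne]
  congr 1
  refine le_antisymm (Finset.max'_le _ _ _ fun t ht => ?_) (Finset.le_max' _ _ (by simpa using hs))
  by_contra! hlt
  exact (Finset.mem_filter.1 ht).2 (h t hlt)

theorem labelDist_self (z : F → α) : labelDist z z = 0 := by simp [labelDist]

theorem labelDist_comm (z w : F → α) : labelDist z w = labelDist w z := by
  rcases eq_or_ne z w with rfl | h
  · rfl
  · obtain ⟨s, hs, ht⟩ := exists_last_ne h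
    rw [labelDist_eq hs ht, labelDist_eq hs.symm fun t hst => (ht t hst).symm]

theorem labelDist_mem {z w : F → α} (h : z ≠ w) : labelDist z w ∈ F := by
  obtain ⟨s, hs, ht⟩ := exists_last_ne h
  rw [labelDist_eq hs ht]
  exact s.2

theorem labelDist_le_iff {z w : F → α} {r : ℝ} (hr : 0 ≤ r) :
    labelDist z w ≤ r ↔ ∀ s : F, r < s → z s = w s := by
  rcases eq_or_ne z w with rfl | h
  · simpa [labelDist_self] using hr
  · obtain ⟨s, hs, ht⟩ := exists_last_ne h
    rw [labelDist_eq hs ht]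
    refine ⟨fun hsr t hrt => ht t (hsr.trans_lt hrt), fun h' => ?_⟩
    by_contra! hlt
    exact hs (h' s hlt)

theorem labelDist_nonneg (hF : ∀ s ∈ F, 0 < s) (z w : F → α) : 0 ≤ labelDist z w := by
  rcases eq_or_ne z w with rfl | h
  · exact (labelDist_self z).ge
  · exact (hF _ (labelDist_mem h)).le

theorem eq_of_labelDist_lt (hF : ∀ s ∈ F, 0 < s) {z w : F → α} {s : F}
    (h : labelDist z w < s) : z s = w s :=
  (labelDist_le_iff (labelDist_nonneg hF z w)).1 le_rfl s h

theorem labelDist_ultra (hF : ∀ s ∈ F, 0 < s) (x y z : F → α) :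
    labelDist x z ≤ max (labelDist x y) (labelDist y z) := by
  refine (labelDist_le_iff (le_max_of_le_left (labelDist_nonneg hF x y))).2 fun s hs => ?_
  rw [max_lt_iff] at hs
  exact (eq_of_labelDist_lt hF hs.1).trans (eq_of_labelDist_lt hF hs.2)

variable [LinearOrder α]

theorem isSTO_labelLT : IsSTO (LabelLT (α := α) (F := F)) := by
  refine ⟨fun x ⟨s, hs, _⟩ => lt_irrefl _ hs, ?_, fun x y => ?_⟩
  · rintro x y z ⟨s, hs, hs'⟩ ⟨t, ht, ht'⟩
    rcases lt_trichotomy s t with h | rfl | h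
    · exact ⟨t, by rwa [hs' t h], fun u hu => (hs' u (h.trans hu)).trans (ht' u hu)⟩
    · exact ⟨s, hs.trans ht, fun u hu => (hs' u hu).trans (ht' u hu)⟩
    · exact ⟨s, by rwa [← ht' s h], fun u hu => (hs' u hu).trans (ht' u (h.trans hu))⟩
  · rcases eq_or_ne x y with rfl | h
    · exact Or.inr (Or.inl rfl)
    · obtain ⟨s, hs, hs'⟩ := exists_last_ne h
      rcases hs.lt_or_gt with h' | h'
      · exact Or.inl ⟨s, h', hs'⟩
      · exact Or.inr (Or.inr ⟨s, h', fun t ht => (hs' t ht).symm⟩)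

theorem isConvexSTO_labelLT (hF : ∀ s ∈ F, 0 < s) :
    IsConvexSTO (labelDist (α := α) (F := F)) LabelLT := by
  refine ⟨isSTO_labelLT, ?_⟩
  rintro x y z ⟨s, hs, hs'⟩ ⟨t, ht, ht'⟩
  rw [labelDist_eq hs.ne hs', labelDist_eq ht.ne ht']
  constructor
  · by_contra! hlt
    have hxz := eq_of_labelDist_lt hF hlt
    rcases lt_trichotomy s t with h | rfl | h
    · have hxz' := eq_of_labelDist_lt hF (hlt.trans (show (s : ℝ) < t from h))
      rw [← hxz', hs' t h] at ht
      exact lt_irrefl _ ht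
    · exact (hs.trans ht).ne hxz
    · rw [ht' s h, hxz] at hs
      exact lt_irrefl _ hs
  · by_contra! hlt
    have hxz := eq_of_labelDist_lt hF hlt
    rcases lt_trichotomy s t with h | rfl | h
    · rw [← hxz, hs' t h] at ht
      exact lt_irrefl _ ht
    · exact (hs.trans ht).ne hxz
    · have hxz' := eq_of_labelDist_lt hF (hlt.trans (show (t : ℝ) < s from h))
      rw [ht' s h, hxz'] at hs
      exact lt_irrefl _ hs

end Labelings

namespace IsConvexUltrametric

variable {X Y : Type*} [LinearOrder X] [Finite X] [LinearOrder Y] [Finite Y] {F : Finset ℝ}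
  {d : X → X → ℝ} {e : Y → Y → ℝ} {α : Type*}

/-- The labeling of the points of `X` induced by a labeling of its balls. -/
noncomputable def label (hd : IsConvexUltrametric F d) (g : hd.Node → α) (x : X) : F → α :=
  fun s => g (hd.node x s)

theorem node_eq_node_iff (hd : IsConvexUltrametric F d) {x y : X} {s : F} :
    hd.node x s = hd.node y s ↔ d x y < s := by
  rw [← hd.first_eq_first_iff]
  refine ⟨fun h => congrArg (fun p : hd.Node => (ofLex p.1).1) h, fun h => Subtype.ext ?_⟩
  exact congrArg (fun y => toLex (y, OrderDual.toDual s)) h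

theorem labelDist_label (hd : IsConvexUltrametric F d) {g : hd.Node → α}
    (hg : Function.Injective g) (x y : X) : labelDist (hd.label g x) (hd.label g y) = d x y := by
  rcases eq_or_ne x y with rfl | h
  · rw [labelDist_self, hd.self]
  · refine labelDist_eq (s := ⟨d x y, hd.mem x y h⟩) (fun h' => ?_) fun t ht => ?_
    · exact lt_irrefl _ (hd.node_eq_node_iff.1 (hg h'))
    · exact congrArg g (hd.node_eq_node_iff.2 ht)

theorem labelLT_label [LinearOrder α] (hd : IsConvexUltrametric F d) {g : hd.Node → α}
    (hg : StrictMono g) {x y : X} (hxy : x < y) : LabelLT (hd.label g x) (hd.label g y) := by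
  refine ⟨⟨d x y, hd.mem x y hxy.ne⟩, hg ?_, fun t ht => ?_⟩
  · exact Prod.Lex.toLex_lt_toLex.2 <| Or.inl ((hd.first_le _ _).trans_lt (hd.lt_first hxy le_rfl))
  · exact congrArg g (hd.node_eq_node_iff.2 ht)

/-- Ramsey property of convexly ordered ultrametric spaces, for colorings of embeddings into
spaces of labelings. -/
theorem exists_ramsey_label (hd : IsConvexUltrametric F d) (he : IsConvexUltrametric F e)
    (k : ℕ) [NeZero k] :
    ∃ N : ℕ, ∀ c : (X → F → Fin N) → Fin k, ∃ G : Y → F → Fin N,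
      (∀ x y, labelDist (G x) (G y) = e x y) ∧ (∀ x y, x < y → LabelLT (G x) (G y)) ∧
      ∀ f₁ f₂ : X → Y, (∀ x y, e (f₁ x) (f₁ y) = d x y) → StrictMono f₁ →
        (∀ x y, e (f₂ x) (f₂ y) = d x y) → StrictMono f₂ → c (G ∘ f₁) = c (G ∘ f₂) := by
  have : Finite (X ×ₗ (F : Type)ᵒᵈ) := inferInstanceAs (Finite (X × F))
  have : Finite (Y ×ₗ (F : Type)ᵒᵈ) := inferInstanceAs (Finite (Y × F))
  obtain ⟨N, hN⟩ := finite_ramsey_strictMono hd.Node he.Node k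
  refine ⟨N, fun c => ?_⟩
  obtain ⟨h, hh, hc⟩ := hN fun g => c (hd.label g)
  refine ⟨he.label h, he.labelDist_label hh.injective, fun x y hxy => he.labelLT_label hh hxy,
    fun f₁ f₂ hf₁ hm₁ hf₂ hm₂ => ?_⟩
  have hcomp : ∀ f : X → Y, (∀ x y, e (f x) (f y) = d x y) →
      he.label h ∘ f = hd.label (h ∘ hd.mapNode he f) := by
    intro f hf
    funext x s
    exact congrArg h (hd.mapNode_node he hf x s).symm
  rw [hcomp f₁ hf₁, hcomp f₂ hf₂]
  exact hc _ _ (hd.strictMono_mapNode he hf₁ hm₁) (hd.strictMono_mapNode he hf₂ hm₂)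

end IsConvexUltrametric

theorem IsSTO.exists_linearOrder {X : Type*} {r : X → X → Prop} (hr : IsSTO r) :
    ∃ L : LinearOrder X, ∀ x y, r x y ↔ L.lt x y := by
  classical
  have : IsStrictTotalOrder X r :=
    { irrefl := hr.1
      trans := hr.2.1
      trichotomous := fun x y h h' => ((hr.2.2 x y).resolve_left h).resolve_right h' }
  exact ⟨linearOrderOfSTO r, fun x y => Iff.rfl⟩

theorem FinUltra.isConvexUltrametric {S : Set ℝ} {X : FinUltra S} {r : Fin X.n → Fin X.n → Prop}
    (hr : IsConvexSTO X.d r) {F : Finset ℝ} (hF : ∀ s ∈ F, 0 < s)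
    (hmem : ∀ x y, x ≠ y → X.d x y ∈ F) (L : LinearOrder (Fin X.n))
    (hL : ∀ x y, r x y ↔ L.lt x y) : @IsConvexUltrametric (Fin X.n) L F X.d :=
  @IsConvexUltrametric.mk (Fin X.n) L F X.d hF X.d_self X.d_symm hmem X.ultra
    fun x y z hxy hyz => hr.2 x y z ((hL x y).2 hxy) ((hL y z).2 hyz)

/-- The space of labelings `F → Fin N` as a finite ultrametric space. -/
noncomputable def labelSpace {S : Set ℝ} {F : Finset ℝ} (hF : ∀ s ∈ F, 0 < s)
    (hFS : ∀ s ∈ F, s ∈ S) (N : ℕ) : FinUltra S where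
  n := Fintype.card (F → Fin N)
  d x y := labelDist ((Fintype.equivFin (F → Fin N)).symm x) ((Fintype.equivFin _).symm y)
  d_self _ := labelDist_self _
  d_symm _ _ := labelDist_comm _ _
  d_mem _ _ h := hFS _ (labelDist_mem ((Equiv.injective _).ne h))
  ultra _ _ _ := labelDist_ultra hF _ _ _

/-- Ramsey property for the class of finite convexly ordered ultrametric spaces with
distances in `S`. -/
theorem ramsey_property_convexly_ordered_ultrametric
    (S : Set ℝ) (hSpos : ∀ s ∈ S, 0 < s)
    (X Y : FinUltra S)
    (rX : Fin X.n → Fin X.n → Prop) (rY : Fin Y.n → Fin Y.n → Prop)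
    (hrX : IsConvexSTO X.d rX) (hrY : IsConvexSTO Y.d rY)
    (k : ℕ) (hk : 1 ≤ k) :
    ∃ (Z : FinUltra S) (rZ : Fin Z.n → Fin Z.n → Prop), IsConvexSTO Z.d rZ ∧
      ∀ χ : Set (Fin Z.n) → Fin k,
        ∃ B : Set (Fin Z.n), IsOrdCopy Y Z rY rZ B ∧
          ∀ A₁ A₂ : Set (Fin Z.n),
            IsOrdCopy X Z rX rZ A₁ → A₁ ⊆ B →
            IsOrdCopy X Z rX rZ A₂ → A₂ ⊆ B → χ A₁ = χ A₂ := by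
  classical
  have : NeZero k := ⟨by omega⟩
  let D : FinUltra S → Finset ℝ := fun W =>
    (Finset.univ.filter fun p : Fin W.n × Fin W.n => p.1 ≠ p.2).image fun p => W.d p.1 p.2
  have hD : ∀ W x y, x ≠ y → W.d x y ∈ D W := fun W x y h =>
    Finset.mem_image.2 ⟨(x, y), by simpa using h, rfl⟩
  have hDS : ∀ W, ∀ s ∈ D W, s ∈ S := by
    intro W s hs
    obtain ⟨p, hp, rfl⟩ := Finset.mem_image.1 hs
    exact W.d_mem _ _ (Finset.mem_filter.1 hp).2
  obtain ⟨F, hFX, hFY, hFS⟩ : ∃ F : Finset ℝ, D X ⊆ F ∧ D Y ⊆ F ∧ ∀ s ∈ F, s ∈ S :=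
    ⟨D X ∪ D Y, Finset.subset_union_left, Finset.subset_union_right, fun s hs =>
      (Finset.mem_union.1 hs).elim (hDS X s) (hDS Y s)⟩
  have hF : ∀ s ∈ F, 0 < s := fun s hs => hSpos s (hFS s hs)
  obtain ⟨LX, hLX⟩ := hrX.1.exists_linearOrder
  obtain ⟨LY, hLY⟩ := hrY.1.exists_linearOrder
  have hX := FinUltra.isConvexUltrametric hrX hF (fun x y h => hFX (hD X x y h)) LX hLX
  have hY := FinUltra.isConvexUltrametric hrY hF (fun x y h => hFY (hD Y x y h)) LY hLY
  obtain ⟨N, hN⟩ := @IsConvexUltrametric.exists_ramsey_label (Fin X.n) (Fin Y.n) LX _ LY _ F X.d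
    Y.d hX hY k _
  let φ := Fintype.equivFin (F → Fin N)
  have hlabel := isConvexSTO_labelLT (α := Fin N) hF
  refine ⟨labelSpace hF hFS N, fun x y => LabelLT (φ.symm x) (φ.symm y),
    ⟨⟨fun x => hlabel.1.1 _, fun x y z => hlabel.1.2.1 _ _ _, fun x y => ?_⟩,
      fun x y z => hlabel.2 _ _ _⟩, fun χ => ?_⟩
  · exact (hlabel.1.2.2 (φ.symm x) (φ.symm y)).imp_right (Or.imp_left fun h => φ.symm.injective h)
  obtain ⟨G, hGd, hGlt, hG⟩ := hN fun g => χ (Set.range fun x => φ (g x))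
  have hcopy : ∀ A : Set (Fin (labelSpace hF hFS N).n),
      IsOrdCopy X (labelSpace hF hFS N) rX (fun x y => LabelLT (φ.symm x) (φ.symm y)) A →
      A ⊆ Set.range (fun y => φ (G y)) → ∃ f : Fin X.n → Fin Y.n,
        (∀ x y, Y.d (f x) (f y) = X.d x y) ∧ (∀ x y, LX.lt x y → LY.lt (f x) (f y)) ∧
        A = Set.range fun x => φ ((G ∘ f) x) := by
    rintro A ⟨g, rfl, hgd, hglt⟩ hA
    choose f hf using fun x => hA (Set.mem_range_self x)
    have hg : ∀ x, φ.symm (g x) = G (f x) := fun x => φ.symm_apply_eq.2 (hf x).symm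
    refine ⟨f, fun x y => ?_, fun x y hxy => ?_, ?_⟩
    · rw [← hGd, ← hg, ← hg]
      exact hgd x y
    · have h : LabelLT (φ.symm (g x)) (φ.symm (g y)) := hglt x y ((hLX x y).2 hxy)
      rw [hg, hg] at h
      rcases hrY.1.2.2 (f x) (f y) with h' | h' | h'
      · exact (hLY _ _).1 h'
      · rw [h'] at h
        exact absurd h (hlabel.1.1 _)
      · exact absurd (hlabel.1.2.1 _ _ _ h (hGlt _ _ ((hLY _ _).1 h'))) (hlabel.1.1 _)
    · exact congrArg Set.range (funext fun x => (hf x).symm)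
  refine ⟨Set.range fun y => φ (G y), ⟨fun y => φ (G y), rfl, fun x y => ?_, fun x y hxy => ?_⟩, ?_⟩
  · rw [← hGd x y]
    exact congrArg₂ labelDist (φ.symm_apply_apply _) (φ.symm_apply_apply _)
  · simpa using hGlt x y ((hLY x y).1 hxy)
  · intro A₁ A₂ h₁ hA₁ h₂ hA₂
    obtain ⟨f₁, hd₁, hm₁, rfl⟩ := hcopy A₁ h₁ hA₁
    obtain ⟨f₂, hd₂, hm₂, rfl⟩ := hcopy A₂ h₂ hA₂
    exact hG f₁ f₂ hd₁ (fun x y => hm₁ x y) hd₂ (fun x y => hm₂ x y)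
end

section
/- Let S ⊆ (0,∞) and let X be a finite ultrametric space with nonzero distances in S. Set τ(X) = |cLO(X)|/|iso(X)|. Then for every finite ultrametric space Y with nonzero distances in S and every integer k ≥ 1, there exists a finite ultrametric space Z with nonzero distances in S such that for every coloring of the isometric copies of X in Z with k colors, there is an isometric copy Ỹ of Y in Z such that the copies of X contained in Ỹ receive at most τ(X) distinct colors. -/
/-- Hypergraph Ramsey theorem: inside every large enough finite set of naturals there is a subset
of size `n` all of whose `t`-element subsets get the same color. -/
theorem exists_homogeneous_subset (K : Type*) [Finite K] [Nonempty K] (t : ℕ) :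
    ∀ n : ℕ, ∃ N : ℕ, ∀ c : Finset ℕ → K, ∀ V : Finset ℕ, N ≤ V.card →
      ∃ H ⊆ V, H.card = n ∧ ∃ κ : K, ∀ D ⊆ H, D.card = t → c D = κ := by
  classical
  have := Fintype.ofFinite K
  induction t with
  | zero =>
    intro n
    refine ⟨n, fun c V hV => ?_⟩
    obtain ⟨H, hHV, hH⟩ := Finset.exists_subset_card_eq hV
    refine ⟨H, hHV, hH, c ∅, fun D _ hD => ?_⟩
    rw [Finset.card_eq_zero.1 hD]
  | succ t ih =>
    have key : ∀ M : ℕ, ∃ N : ℕ, ∀ c : Finset ℕ → K, ∀ V : Finset ℕ, N ≤ V.card →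
        ∃ W ⊆ V, W.card = M ∧ ∃ g : ℕ → K, ∀ D ⊆ W, D.card = t + 1 →
          ∀ v ∈ D, (∀ u ∈ D, v ≤ u) → c D = g v := by
      intro M
      induction M with
      | zero =>
        refine ⟨0, fun c V _ => ⟨∅, by simp, rfl, fun _ => Classical.arbitrary K, ?_⟩⟩
        intro D hD hc
        rw [Finset.subset_empty.1 hD] at hc
        simp at hc
      | succ M ihM =>
        obtain ⟨N₁, hN₁⟩ := ihM
        obtain ⟨N₂, hN₂⟩ := ih N₁
        refine ⟨N₂ + 1, fun c V hV => ?_⟩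
        have hne : V.Nonempty := Finset.card_pos.1 (by omega)
        set v := V.min' hne
        have hvV : v ∈ V := V.min'_mem hne
        obtain ⟨V₂, hV₂, hcard, κ, hκ⟩ := hN₂ (fun D => c (insert v D)) (V.erase v)
          (by rw [Finset.card_erase_of_mem hvV]; omega)
        obtain ⟨W, hW, hWc, g, hg⟩ := hN₁ c V₂ hcard.ge
        have hvW : v ∉ W := fun h => by simpa using hV₂ (hW h)
        have hWV : W ⊆ V := (hW.trans hV₂).trans (Finset.erase_subset _ _)
        refine ⟨insert v W, ?_, by rw [Finset.card_insert_of_notMem hvW, hWc],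
          Function.update g v κ, ?_⟩
        · exact Finset.insert_subset hvV hWV
        · intro D hD hDc u hu hmin
          by_cases hvD : v ∈ D
          · have huV : u ∈ V := (Finset.insert_subset hvV hWV) (hD hu)
            have : u = v := le_antisymm (hmin v hvD) (V.min'_le u huV)
            rw [this, Function.update_self, ← hκ (D.erase v), Finset.insert_erase hvD]
            · exact (Finset.subset_insert_iff.1 hD).trans hW
            · rw [Finset.card_erase_of_mem hvD]; omega
          · have hDW : D ⊆ W := (Finset.subset_insert_iff_of_notMem hvD).1 hD
            have : u ≠ v := fun h => hvD (h ▸ hu)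
            rw [Function.update_of_ne this]
            exact hg D hDW hDc u hu hmin
    intro n
    obtain ⟨N, hN⟩ := key (Fintype.card K * n)
    refine ⟨N, fun c V hV => ?_⟩
    obtain ⟨W, hWV, hWc, g, hg⟩ := hN c V hV
    obtain ⟨κ, -, hκ⟩ := Finset.exists_le_card_fiber_of_mul_le_card_of_maps_to
      (s := W) (t := (Finset.univ : Finset K)) (f := g) (n := n) (by simp)
      Finset.univ_nonempty (by rw [hWc, Finset.card_univ])
    obtain ⟨H, hHW, hH⟩ := Finset.exists_subset_card_eq hκ
    refine ⟨H, hHW.trans ((Finset.filter_subset _ _).trans hWV), hH, κ, fun D hD hDc => ?_⟩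
    have hne : D.Nonempty := Finset.card_pos.1 (by omega)
    rw [hg D (hD.trans (hHW.trans (Finset.filter_subset _ _))) hDc _ (D.min'_mem hne)
      (fun u hu => D.min'_le u hu)]
    exact (Finset.mem_filter.1 (hHW (hD (D.min'_mem hne)))).2

/-- Ramsey theorem for all subsets of size at most `T` simultaneously. -/
theorem exists_homogeneous_subset_card_le (K : Type*) [Finite K] [Nonempty K] (T : ℕ) :
    ∀ n : ℕ, ∃ N : ℕ, ∀ c : Finset ℕ → K, ∀ V : Finset ℕ, N ≤ V.card →
      ∃ H ⊆ V, H.card = n ∧ ∀ D ⊆ H, ∀ D' ⊆ H, D.card = D'.card → D.card ≤ T → c D = c D' := by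
  induction T with
  | zero =>
    intro n
    refine ⟨n, fun c V hV => ?_⟩
    obtain ⟨H, hHV, hH⟩ := Finset.exists_subset_card_eq hV
    refine ⟨H, hHV, hH, fun D _ D' _ h h0 => ?_⟩
    rw [Finset.card_eq_zero.1 (Nat.le_zero.1 h0), Finset.card_eq_zero.1 (by omega : D'.card = 0)]
  | succ T ih =>
    intro n
    obtain ⟨N₁, hN₁⟩ := ih n
    obtain ⟨N₂, hN₂⟩ := exists_homogeneous_subset K (T + 1) N₁
    refine ⟨N₂, fun c V hV => ?_⟩
    obtain ⟨W, hWV, hWc, κ, hκ⟩ := hN₂ c V hV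
    obtain ⟨H, hHW, hH, hc⟩ := hN₁ c W hWc.ge
    refine ⟨H, hHW.trans hWV, hH, fun D hD D' hD' h hT => ?_⟩
    rcases hT.lt_or_eq with hlt | heq
    · exact hc D hD D' hD' h (by omega)
    · rw [hκ D (hD.trans hHW) heq, hκ D' (hD'.trans hHW) (by omega)]

/-- Ramsey theorem for tuples: the color of a tuple with entries in a suitable large set depends
only on the relative order of its entries. -/
theorem exists_strictMonoOn_color_eq_of_pattern (P K : Type*) [Finite P] [Finite K] [Nonempty K]
    (n : ℕ) : ∃ N : ℕ, ∀ c : (P → ℕ) → K, ∃ h : ℕ → ℕ, StrictMonoOn h (Set.Iio n) ∧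
      (∀ j < n, h j < N) ∧ ∀ a a' : P → ℕ, (∀ p, a p < n) → (∀ p, a' p < n) →
        (∀ p q, a p ≤ a q ↔ a' p ≤ a' q) → c (h ∘ a) = c (h ∘ a') := by
  classical
  have := Fintype.ofFinite P
  obtain ⟨N, hN⟩ := exists_homogeneous_subset_card_le ((P → Fin (Fintype.card P + 1)) → K)
    (Fintype.card P) n
  refine ⟨N, fun c => ?_⟩
  obtain ⟨H, hHN, hHc, hH⟩ := hN (fun D q => c (fun p => Nat.nth (· ∈ D) (q p)))
    (Finset.range N) (by simp)
  have hfin : {x | x ∈ H}.Finite := H.finite_toSet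
  have hfc : hfin.toFinset.card = n := by
    rw [← hHc]; congr 1; ext; simp
  have hmono : StrictMonoOn (Nat.nth (· ∈ H)) (Set.Iio n) := by
    have := Nat.nth_strictMonoOn hfin
    rwa [hfc] at this
  have hmem : ∀ j < n, Nat.nth (· ∈ H) j ∈ H := fun j hj =>
    Nat.nth_mem_of_lt_card hfin (by rwa [hfc])
  refine ⟨Nat.nth (· ∈ H), hmono, fun j hj => Finset.mem_range.1 (hHN (hmem j hj)), ?_⟩
  intro a a' ha ha' hpat
  set h := Nat.nth (· ∈ H)
  have hle : ∀ b : P → ℕ, (∀ p, b p < n) → ∀ p q, h (b p) ≤ h (b q) ↔ b p ≤ b q :=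
    fun b hb p q => hmono.le_iff_le (hb p) (hb q)
  have hpat' : ∀ p q, h (a p) ≤ h (a q) ↔ h (a' p) ≤ h (a' q) := fun p q => by
    rw [hle a ha, hle a' ha', hpat]
  have hlt : ∀ p q, h (a p) < h (a q) ↔ h (a' p) < h (a' q) := fun p q => by
    rw [← not_le, ← not_le, hpat']
  have heq : ∀ p q, h (a p) = h (a q) ↔ h (a' p) = h (a' q) := fun p q => by
    rw [le_antisymm_iff, le_antisymm_iff, hpat', hpat']
  let rep : P → P := fun p => Classical.choose (⟨p, rfl⟩ : ∃ q, h (a q) = h (a p))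
  have hrep : ∀ p, h (a (rep p)) = h (a p) := fun p =>
    Classical.choose_spec (⟨p, rfl⟩ : ∃ q, h (a q) = h (a p))
  have hrep_eq : ∀ p q, rep p = rep q ↔ h (a p) = h (a q) := fun p q => by
    constructor
    · intro e; rw [← hrep p, ← hrep q, e]
    · intro e; simp only [rep, e]
  let R : Finset P := Finset.univ.image rep
  have hrr : ∀ r ∈ R, rep r = r := by
    intro r hr
    obtain ⟨p, -, rfl⟩ := Finset.mem_image.1 hr
    exact (hrep_eq _ _).2 (hrep p)
  have himg : ∀ b : P → ℕ, (∀ p q, h (a p) = h (a q) ↔ h (b p) = h (b q)) →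
      (∀ (s : ℕ → Prop) [DecidablePred s], ((Finset.univ.image (h ∘ b)).filter s).card =
        (R.filter (fun p => s (h (b p)))).card) := by
    intro b hb s _
    symm
    refine Finset.card_bij (fun p _ => h (b p)) ?_ ?_ ?_
    · intro p hp
      simp only [Finset.mem_filter] at hp ⊢
      exact ⟨Finset.mem_image.2 ⟨p, Finset.mem_univ _, rfl⟩, hp.2⟩
    · intro p hp q hq e
      rw [← hrr p (Finset.mem_filter.1 hp).1, ← hrr q (Finset.mem_filter.1 hq).1, hrep_eq, hb]
      exact e
    · intro x hx
      obtain ⟨hx1, hx2⟩ := Finset.mem_filter.1 hx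
      obtain ⟨p, -, rfl⟩ := Finset.mem_image.1 hx1
      have e : h (b (rep p)) = h (b p) := (hb _ _).1 (hrep p)
      refine ⟨rep p, Finset.mem_filter.2 ⟨Finset.mem_image.2 ⟨p, Finset.mem_univ _, rfl⟩, ?_⟩, e⟩
      rw [e]; exact hx2
  set D := Finset.univ.image (h ∘ a) with hD
  set D' := Finset.univ.image (h ∘ a') with hD'
  have hDH : D ⊆ H := by
    intro x hx
    obtain ⟨p, -, rfl⟩ := Finset.mem_image.1 hx
    exact hmem _ (ha p)
  have hDH' : D' ⊆ H := by
    intro x hx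
    obtain ⟨p, -, rfl⟩ := Finset.mem_image.1 hx
    exact hmem _ (ha' p)
  have hcardle : D.card ≤ Fintype.card P := Finset.card_image_le
  have hcard : D.card = D'.card := by
    have e1 := himg a (fun _ _ => Iff.rfl) (fun _ => True)
    have e2 := himg a' heq (fun _ => True)
    simp only [Finset.filter_true] at e1 e2
    rw [hD, hD', e1, e2]
  have hcount : ∀ p, Nat.count (· ∈ D) (h (a p)) = Nat.count (· ∈ D') (h (a' p)) := by
    intro p
    have e1 := himg a (fun _ _ => Iff.rfl) (· < h (a p))
    have e2 := himg a' heq (· < h (a' p))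
    have e3 : ∀ (E : Finset ℕ) (x : ℕ), Nat.count (· ∈ E) x = (E.filter (· < x)).card := by
      intro E x
      rw [Nat.count_eq_card_filter_range]
      congr 1
      ext y
      simp [and_comm]
    rw [e3, e3]
    refine (e1.trans ?_).trans e2.symm
    simp only [hlt]
  have hcb : ∀ p, Nat.count (· ∈ D) (h (a p)) < Fintype.card P + 1 := by
    intro p
    rw [Nat.count_eq_card_filter_range]
    refine Nat.lt_succ_of_le (le_trans (Finset.card_le_card ?_) hcardle)
    intro y hy
    exact (Finset.mem_filter.1 hy).2
  have hfun := congrFun (hH D hDH D' hDH' hcard hcardle)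
    (fun p => ⟨Nat.count (· ∈ D) (h (a p)), hcb p⟩)
  convert hfun using 2
  · funext p
    exact (Nat.nth_count (p := (· ∈ D))
      (Finset.mem_image.2 ⟨p, Finset.mem_univ _, rfl⟩ : h (a p) ∈ D)).symm
  · funext p
    simp only [hcount]
    exact (Nat.nth_count (p := (· ∈ D'))
      (Finset.mem_image.2 ⟨p, Finset.mem_univ _, rfl⟩ : h (a' p) ∈ D')).symm

/-- The finite ultrametric space carried by a finite type. -/
noncomputable def FinUltra.ofFintype {S : Set ℝ} (α : Type*) [Fintype α] (d : α → α → ℝ)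
    (d_self : ∀ x, d x x = 0) (d_symm : ∀ x y, d x y = d y x)
    (d_mem : ∀ x y, x ≠ y → d x y ∈ S) (ultra : ∀ x y z, d x z ≤ max (d x y) (d y z)) :
    FinUltra S where
  n := Fintype.card α
  d x y := d ((Fintype.equivFin α).symm x) ((Fintype.equivFin α).symm y)
  d_self _ := d_self _
  d_symm _ _ := d_symm _ _
  d_mem _ _ h := d_mem _ _ fun e => h ((Fintype.equivFin α).symm.injective e)
  ultra _ _ _ := ultra _ _ _

/-- The weighted ultrametric on functions: the largest weight of a coordinate where the
functions differ. -/
noncomputable def piDist {β : Type*} (L : Finset ℝ) (u v : L → β) : ℝ :=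
  open Classical in ⨆ s : L, if u s = v s then 0 else (s : ℝ)

section piDist

variable {β : Type*} {L : Finset ℝ}

theorem le_piDist {u v : L → β} (s : L) (h : u s ≠ v s) :
    (s : ℝ) ≤ piDist L u v := by
  classical
  refine le_trans ?_ (le_ciSup (Set.finite_range _).bddAbove s)
  simp [h]

theorem piDist_le {u v : L → β} {r : ℝ} (hr : 0 ≤ r) (h : ∀ s : L, u s ≠ v s → (s : ℝ) ≤ r) :
    piDist L u v ≤ r := by
  classical
  refine Real.iSup_le (fun s => ?_) hr
  split_ifs with e
  · exact hr
  · exact h s e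

theorem piDist_nonneg (hL : ∀ s ∈ L, 0 < s) (u v : L → β) : 0 ≤ piDist L u v := by
  classical
  refine Real.iSup_nonneg fun s => ?_
  split_ifs
  · exact le_rfl
  · exact (hL s s.2).le

theorem piDist_self (u : L → β) : piDist L u u = 0 := by simp [piDist]

theorem piDist_symm (u v : L → β) : piDist L u v = piDist L v u := by
  classical
  refine iSup_congr fun s => ?_
  by_cases h : u s = v s
  · simp [h]
  · simp [h, Ne.symm h]

theorem piDist_mem (hL : ∀ s ∈ L, 0 < s) {u v : L → β} (h : u ≠ v) : piDist L u v ∈ L := by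
  classical
  obtain ⟨s₀, hs₀⟩ := Function.ne_iff.1 h
  have : Nonempty L := ⟨s₀⟩
  obtain ⟨s, hs⟩ := exists_eq_ciSup_of_finite
    (f := fun s : L => if u s = v s then 0 else (s : ℝ))
  have hpos : 0 < piDist L u v := (hL s₀ s₀.2).trans_le (le_piDist s₀ hs₀)
  have hs' : (if u s = v s then 0 else (s : ℝ)) = piDist L u v := by
    rw [piDist]; convert hs
  split_ifs at hs' with e
  · exact absurd hs' hpos.ne
  · rw [← hs']; exact s.2

theorem piDist_ultra (hL : ∀ s ∈ L, 0 < s) (u v w : L → β) :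
    piDist L u w ≤ max (piDist L u v) (piDist L v w) := by
  refine piDist_le (le_max_of_le_left (piDist_nonneg hL _ _)) fun s hs => ?_
  by_cases h : u s = v s
  · exact le_max_of_le_right (le_piDist s (h ▸ hs))
  · exact le_max_of_le_left (le_piDist s h)

end piDist

/-- The least value of `ρ` on the open ball of radius `s` around `y`. -/
noncomputable def ballMin {α : Type*} (d : α → α → ℝ) (ρ : α → ℕ) (s : ℝ) (y : α) : ℕ :=
  sInf (ρ '' {z | d z y < s})

theorem FinUltra.ballMin_le_of_dist_lt {S : Set ℝ} (Y : FinUltra S) (ρ : Fin Y.n → ℕ) {s s' : ℝ}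
    (hs' : 0 < s') (hs : s' ≤ s) {y y' : Fin Y.n} (h : Y.d y y' < s) :
    ballMin Y.d ρ s y ≤ ballMin Y.d ρ s' y' := by
  obtain ⟨z, hz, hz'⟩ := Nat.sInf_mem
    (⟨_, y', by simpa [Y.d_self] using hs', rfl⟩ : (ρ '' {z | Y.d z y' < s'}).Nonempty)
  have hzy : Y.d z y < s :=
    (Y.ultra z y' y).trans_lt (max_lt (hz.trans_le hs) (by rwa [Y.d_symm]))
  have hmem : ρ z ∈ ρ '' {z | Y.d z y < s} := ⟨z, hzy, rfl⟩
  exact (Nat.sInf_le hmem).trans hz'.le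

theorem FinUltra.ballMin_ne {S : Set ℝ} (Y : FinUltra S) {ρ : Fin Y.n → ℕ}
    (hρ : Function.Injective ρ) {s : ℝ} (hs : 0 < s) {y y' : Fin Y.n} (h : s ≤ Y.d y y') :
    ballMin Y.d ρ s y ≠ ballMin Y.d ρ s y' := by
  intro e
  obtain ⟨z, hz, hz'⟩ := Nat.sInf_mem
    (⟨_, y, by simpa [Y.d_self] using hs, rfl⟩ : (ρ '' {z | Y.d z y < s}).Nonempty)
  obtain ⟨w, hw, hw'⟩ := Nat.sInf_mem
    (⟨_, y', by simpa [Y.d_self] using hs, rfl⟩ : (ρ '' {z | Y.d z y' < s}).Nonempty)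
  have : z = w := hρ (by rw [hz', hw']; exact e)
  subst this
  refine absurd ((Y.ultra y z y').trans_lt (max_lt ?_ hw)) h.not_gt
  rw [Y.d_symm]; exact hz

/-- `ρ` is injective and induces a convex linear ordering. -/
def IsConvexRank {α : Type*} (d : α → α → ℝ) (ρ : α → ℕ) : Prop :=
  Function.Injective ρ ∧
    ∀ x y z, ρ x < ρ y → ρ y < ρ z → d x y ≤ d x z ∧ d y z ≤ d x z

theorem FinUltra.ballMin_lt {S : Set ℝ} (Y : FinUltra S) {ρ : Fin Y.n → ℕ}
    (hρ : IsConvexRank Y.d ρ) {s t : ℝ} (hs : 0 < s) (ht : 0 < t) {y y' : Fin Y.n}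
    (h : t ≤ Y.d y y') (hlt : ρ y < ρ y') : ballMin Y.d ρ s y < ballMin Y.d ρ t y' := by
  obtain ⟨z, hz, hz'⟩ := Nat.sInf_mem
    (⟨_, y', by simpa [Y.d_self] using ht, rfl⟩ : (ρ '' {z | Y.d z y' < t}).Nonempty)
  have h1 : ballMin Y.d ρ s y ≤ ρ y := Nat.sInf_le ⟨y, by simpa [Y.d_self] using hs, rfl⟩
  refine h1.trans_lt (lt_of_lt_of_eq ?_ hz')
  by_contra! hle
  rcases hle.lt_or_eq with hl | he
  · exact absurd hz (not_lt.2 (h.trans (hρ.2 z y y' hl hlt).2))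
  · rw [hρ.1 he] at hz
    exact absurd hz (not_lt.2 h)

theorem exists_rank {α : Type*} [Finite α] {r : α → α → Prop} (hr : IsSTO r) :
    ∃ ρ : α → ℕ, Function.Injective ρ ∧ ∀ x y, ρ x < ρ y ↔ r x y := by
  classical
  have := Fintype.ofFinite α
  obtain ⟨hirr, htr, htri⟩ := hr
  let ρ : α → ℕ := fun y => (Finset.univ.filter (fun x => r x y)).card
  have hlt : ∀ x y, r x y → ρ x < ρ y := by
    intro x y h
    refine Finset.card_lt_card ?_
    rw [Finset.ssubset_iff_of_subset]
    · exact ⟨x, by simpa using h, by simpa using hirr x⟩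
    · intro z hz
      simp only [Finset.mem_filter, Finset.mem_univ, true_and] at hz ⊢
      exact htr _ _ _ hz h
  refine ⟨ρ, ?_, ?_⟩
  · intro x y e
    rcases htri x y with h | h | h
    · exact absurd e (hlt _ _ h).ne
    · exact h
    · exact absurd e (hlt _ _ h).ne'
  · intro x y
    refine ⟨fun h => ?_, hlt x y⟩
    rcases htri x y with h' | h' | h'
    · exact h'
    · exact absurd h (h' ▸ lt_irrefl _)
    · exact absurd h (hlt _ _ h').asymm

theorem FinUltra.dist_nonneg {S : Set ℝ} (hSpos : ∀ s ∈ S, 0 < s) (Y : FinUltra S)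
    (x y : Fin Y.n) : 0 ≤ Y.d x y := by
  by_cases h : x = y
  · rw [h, Y.d_self]
  · exact (hSpos _ (Y.d_mem x y h)).le

/-- Every finite ultrametric space has a convex linear ordering. -/
theorem FinUltra.exists_isConvexRank {S : Set ℝ} (hSpos : ∀ s ∈ S, 0 < s) (Y : FinUltra S) :
    ∃ ρ : Fin Y.n → ℕ, IsConvexRank Y.d ρ := by
  let m : ℝ → Fin Y.n → ℕ := ballMin Y.d Fin.val
  let r : Fin Y.n → Fin Y.n → Prop := fun x y => x ≠ y ∧ m (Y.d x y) x < m (Y.d x y) y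
  have hpos : ∀ {x y}, x ≠ y → 0 < Y.d x y := fun h => hSpos _ (Y.d_mem _ _ h)
  have hm : ∀ {s x y}, 0 < s → Y.d x y < s → m s x = m s y := fun {s x y} hs h =>
    le_antisymm (Y.ballMin_le_of_dist_lt _ hs le_rfl h)
      (Y.ballMin_le_of_dist_lt _ hs le_rfl (by rwa [Y.d_symm]))
  have hasym : ∀ x y, r x y → ¬ r y x := fun x y h h' =>
    absurd h.2 (by have := h'.2; rw [Y.d_symm] at this; exact this.asymm)
  have hmain : ∀ x y z, r x y → r y z → r x z ∧ Y.d x y ≤ Y.d x z ∧ Y.d y z ≤ Y.d x z := by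
    rintro x y z hxy hyz
    have hxz : x ≠ z := by
      rintro rfl
      exact hasym _ _ hxy hyz
    obtain ⟨h1, h2⟩ := hxy
    obtain ⟨h3, h4⟩ := hyz
    have u1 := Y.ultra x y z
    have u2 := Y.ultra x z y
    have u3 := Y.ultra y x z
    rw [Y.d_symm z y] at u2
    rw [Y.d_symm y x] at u3
    rcases lt_trichotomy (Y.d x y) (Y.d y z) with hlt | heq | hgt
    · rw [max_eq_right hlt.le] at u1
      have e : Y.d x z = Y.d y z := by
        refine le_antisymm u1 ?_
        rcases le_max_iff.1 u3 with h | h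
        · exact absurd h (not_le.2 hlt)
        · exact h
      refine ⟨⟨hxz, ?_⟩, by rw [e]; exact hlt.le, e.ge⟩
      rw [e, hm (hpos h3) hlt]; exact h4
    · rw [heq, max_self] at u1
      have e : Y.d x z = Y.d y z := by
        refine le_antisymm u1 ?_
        by_contra! hl
        have := hm (hpos h3) hl
        rw [heq] at h2
        exact absurd this (h2.trans h4).ne
      refine ⟨⟨hxz, ?_⟩, (heq.trans e.symm).le, e.ge⟩
      rw [e]; rw [heq] at h2; exact h2.trans h4
    · rw [max_eq_left hgt.le] at u1
      have e : Y.d x z = Y.d x y := by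
        refine le_antisymm u1 ?_
        rcases le_max_iff.1 u2 with h | h
        · exact h
        · exact absurd h (not_le.2 hgt)
      refine ⟨⟨hxz, ?_⟩, e.ge, by rw [e]; exact hgt.le⟩
      rw [e, ← hm (hpos h1) hgt]; exact h2
  have hsto : IsSTO r := by
    refine ⟨fun x h => h.1 rfl, fun x y z h h' => (hmain x y z h h').1, fun x y => ?_⟩
    by_cases h : x = y
    · exact Or.inr (Or.inl h)
    · rcases (Y.ballMin_ne Fin.val_injective (hpos h) le_rfl).lt_or_gt with hl | hl
      · exact Or.inl ⟨h, hl⟩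
      · exact Or.inr (Or.inr ⟨Ne.symm h, by rw [Y.d_symm]; exact hl⟩)
  obtain ⟨ρ, hinj, hρ⟩ := exists_rank hsto
  refine ⟨ρ, hinj, fun x y z h h' => ?_⟩
  exact (hmain x y z ((hρ _ _).1 h) ((hρ _ _).1 h')).2

/-- The position of the open ball of radius `s` around `y` in the depth-first enumeration of
the tree of balls with radii in `L`. -/
noncomputable def ballCode {α : Type*} (d : α → α → ℝ) (ρ : α → ℕ) (L : Finset ℝ) (y : α)
    (s : ℝ) : ℕ :=
  ballMin d ρ s y * (L.card + 1) + (L.filter (s < ·)).card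

theorem ballCode_lt_of_ballMin_lt {α : Type*} {d : α → α → ℝ} {ρ : α → ℕ} {L : Finset ℝ}
    {y y' : α} {s s' : ℝ} (h : ballMin d ρ s y < ballMin d ρ s' y') :
    ballCode d ρ L y s < ballCode d ρ L y' s' := by
  have h1 : (L.filter (s < ·)).card ≤ L.card := Finset.card_filter_le _ _
  have h2 : (ballMin d ρ s y + 1) * (L.card + 1) ≤ ballMin d ρ s' y' * (L.card + 1) :=
    Nat.mul_le_mul_right _ h
  unfold ballCode
  linarith

theorem FinUltra.ballCode_le_iff {S : Set ℝ} (Y : FinUltra S) {ρ : Fin Y.n → ℕ}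
    (hρ : IsConvexRank Y.d ρ) {L : Finset ℝ} (hL : ∀ s ∈ L, 0 < s) {s s' : ℝ} (hs : s ∈ L)
    (hs' : s' ∈ L) (y y' : Fin Y.n) :
    ballCode Y.d ρ L y s ≤ ballCode Y.d ρ L y' s' ↔
      (s' ≤ s ∧ (Y.d y y' < s ∨ ρ y < ρ y')) ∨ (s < s' ∧ s' ≤ Y.d y y' ∧ ρ y < ρ y') := by
  have far : ∀ {t}, 0 < t → t ≤ Y.d y y' → ρ y < ρ y' ∨ ρ y' < ρ y := by
    intro t ht h
    refine Ne.lt_or_gt fun e => ?_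
    rw [hρ.1 e, Y.d_self] at h
    exact absurd ht (not_lt.2 h)
  rcases le_or_gt s' s with hle | hlt
  · simp only [hle, true_and, not_lt.2 hle, false_and, or_false]
    constructor
    · intro h
      by_contra! hcon
      rcases far (hL s hs) hcon.1 with h' | h'
      · exact absurd h' (not_lt.2 hcon.2)
      · refine absurd (ballCode_lt_of_ballMin_lt ?_) (not_lt.2 h)
        exact Y.ballMin_lt hρ (hL s' hs') (hL s hs) (by rw [Y.d_symm]; exact hcon.1) h'
    · intro h
      by_cases hd : Y.d y y' < s
      · have h1 := Y.ballMin_le_of_dist_lt ρ (hL s' hs') hle hd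
        have h2 : (L.filter (s < ·)).card ≤ (L.filter (s' < ·)).card :=
          Finset.card_le_card (Finset.monotone_filter_right _ fun t _ ht => hle.trans_lt ht)
        exact Nat.add_le_add (Nat.mul_le_mul_right _ h1) h2
      · exact (ballCode_lt_of_ballMin_lt (Y.ballMin_lt hρ (hL s hs) (hL s' hs')
          (hle.trans (not_lt.1 hd)) (h.resolve_left hd))).le
  · simp only [not_le.2 hlt, false_and, hlt, true_and, false_or]
    constructor
    · intro h
      have hd : s' ≤ Y.d y y' := by
        by_contra! hd
        have h1 := Y.ballMin_le_of_dist_lt ρ (hL s hs) hlt.le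
          (y := y') (y' := y) (by rwa [Y.d_symm])
        have h2 : (L.filter (s' < ·)).card < (L.filter (s < ·)).card := by
          refine Finset.card_lt_card ?_
          rw [Finset.ssubset_iff_of_subset
            (Finset.monotone_filter_right _ fun t _ ht => hlt.trans ht)]
          exact ⟨s', Finset.mem_filter.2 ⟨hs', hlt⟩, by simp⟩
        exact absurd (Nat.add_lt_add_of_le_of_lt (Nat.mul_le_mul_right (L.card + 1) h1) h2)
          (not_lt.2 h)
      refine ⟨hd, (far (hL s' hs') hd).resolve_right fun h' => ?_⟩
      refine absurd (ballCode_lt_of_ballMin_lt ?_) (not_lt.2 h)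
      exact Y.ballMin_lt hρ (hL s' hs') (hL s hs) (by rw [Y.d_symm]; exact hlt.le.trans hd) h'
    · rintro ⟨hd, h⟩
      exact (ballCode_lt_of_ballMin_lt (Y.ballMin_lt hρ (hL s hs) (hL s' hs') hd h)).le

/-- Ramsey property of convexly ordered ultrametric spaces: for some copy of `Y` in a suitable
`Z`, the color of a copy of `X` only depends on the ordering it inherits from `Y`. -/
theorem FinUltra.exists_color_eq_of_order {S : Set ℝ} (hSpos : ∀ s ∈ S, 0 < s)
    (X Y : FinUltra S) {ρ : Fin Y.n → ℕ} (hρ : IsConvexRank Y.d ρ) (K : Type*) [Finite K]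
    [Nonempty K] :
    ∃ Z : FinUltra S, ∀ χ : Set (Fin Z.n) → K, ∃ e : Fin Y.n → Fin Z.n,
      (∀ a b, Z.d (e a) (e b) = Y.d a b) ∧
      ∀ f f' : Fin X.n → Fin Y.n, (∀ a b, Y.d (f a) (f b) = X.d a b) →
        (∀ a b, Y.d (f' a) (f' b) = X.d a b) →
        (∀ a b, ρ (f a) < ρ (f b) ↔ ρ (f' a) < ρ (f' b)) →
        χ (Set.range (e ∘ f)) = χ (Set.range (e ∘ f')) := by
  classical
  let L : Finset ℝ :=
    (Finset.univ.filter (fun p : Fin Y.n × Fin Y.n => p.1 ≠ p.2)).image (fun p => Y.d p.1 p.2)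
  have hLS : ∀ s ∈ L, s ∈ S := by
    intro s hs
    obtain ⟨p, hp, rfl⟩ := Finset.mem_image.1 hs
    exact Y.d_mem _ _ (Finset.mem_filter.1 hp).2
  have hL : ∀ s ∈ L, 0 < s := fun s hs => hSpos s (hLS s hs)
  have hmemL : ∀ x y, x ≠ y → Y.d x y ∈ L := fun x y h =>
    Finset.mem_image.2 ⟨(x, y), by simpa using h, rfl⟩
  let code : Fin Y.n → L → ℕ := fun y s => ballCode Y.d ρ L y s
  obtain ⟨n, hn⟩ : ∃ n, ∀ y s, code y s < n := by
    obtain ⟨b, hb⟩ := (Set.finite_range (fun p : Fin Y.n × L => code p.1 p.2)).bddAbove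
    exact ⟨b + 1, fun y s => Nat.lt_succ_of_le (hb ⟨(y, s), rfl⟩)⟩
  obtain ⟨N, hN⟩ := exists_strictMonoOn_color_eq_of_pattern (Fin X.n × L) K n
  let A := L → Fin (N + 1)
  let Z : FinUltra S := FinUltra.ofFintype A (piDist L) piDist_self piDist_symm
    (fun _ _ h => hLS _ (piDist_mem hL h)) (piDist_ultra hL)
  let φ : A ≃ Fin Z.n := Fintype.equivFin A
  refine ⟨Z, fun χ => ?_⟩
  obtain ⟨h, hmono, hlt, hcol⟩ := hN fun b =>
    χ (Set.range fun x => φ fun s => Fin.ofNat (N + 1) (b (x, s)))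
  let e : Fin Y.n → Fin Z.n := fun y => φ fun s => Fin.ofNat (N + 1) (h (code y s))
  refine ⟨e, ?_, ?_⟩
  · intro a b
    have hne : ∀ s : L, (Fin.ofNat (N + 1) (h (code a s)) ≠ Fin.ofNat (N + 1) (h (code b s))) ↔
        (s : ℝ) ≤ Y.d a b := by
      intro s
      have e1 : (Fin.ofNat (N + 1) (h (code a s)) = Fin.ofNat (N + 1) (h (code b s))) ↔
          code a s = code b s := by
        rw [← hmono.injOn.eq_iff (hn a s) (hn b s), Fin.ext_iff, Fin.val_ofNat, Fin.val_ofNat,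
          Nat.mod_eq_of_lt ((hlt _ (hn a s)).trans (Nat.lt_succ_self _)),
          Nat.mod_eq_of_lt ((hlt _ (hn b s)).trans (Nat.lt_succ_self _))]
      rw [Ne, e1, ← not_lt, not_iff_not, le_antisymm_iff, Y.ballCode_le_iff hρ hL s.2 s.2,
        Y.ballCode_le_iff hρ hL s.2 s.2, Y.d_symm b a]
      simp only [le_refl, true_and, lt_irrefl, false_and, or_false]
      constructor
      · rintro ⟨h1 | h1, h2 | h2⟩
        · exact h1
        · exact h1
        · exact h2
        · exact absurd h1 h2.asymm
      · exact fun h => ⟨Or.inl h, Or.inl h⟩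
    have hZ : Z.d (e a) (e b) = piDist L (fun s => Fin.ofNat (N + 1) (h (code a s)))
        (fun s => Fin.ofNat (N + 1) (h (code b s))) := by
      change piDist L (φ.symm (φ _)) (φ.symm (φ _)) = _
      rw [φ.symm_apply_apply, φ.symm_apply_apply]
    rw [hZ]
    refine le_antisymm (piDist_le (Y.dist_nonneg hSpos a b) fun s hs => (hne s).1 hs) ?_
    by_cases hab : a = b
    · rw [hab, Y.d_self]
      exact piDist_nonneg hL _ _
    · exact le_piDist ⟨_, hmemL a b hab⟩ ((hne _).2 le_rfl)
  · intro f f' hf hf' hff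
    refine hcol (fun p => code (f p.1) p.2) (fun p => code (f' p.1) p.2) (fun p => hn _ _)
      (fun p => hn _ _) fun p q => ?_
    change ballCode Y.d ρ L _ _ ≤ ballCode Y.d ρ L _ _ ↔
      ballCode Y.d ρ L _ _ ≤ ballCode Y.d ρ L _ _
    rw [Y.ballCode_le_iff hρ hL p.2.2 q.2.2, Y.ballCode_le_iff hρ hL p.2.2 q.2.2, hf, hf', hff]

theorem perm_eq_of_order_iff {α : Type*} [Finite α] {u : α → ℕ} (hu : Function.Injective u)
    {g g' : Equiv.Perm α} (h : ∀ a b, u (g a) < u (g b) ↔ u (g' a) < u (g' b)) : g = g' := by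
  have key : ∀ m : ℕ, ∀ a, u (g a) = m → u (g a) = u (g' a) := by
    intro m
    induction m using Nat.strong_induction_on with
    | _ m ih =>
      rintro a rfl
      rcases lt_trichotomy (u (g a)) (u (g' a)) with hlt | heq | hgt
      · obtain ⟨b, hb⟩ := g'.surjective (g a)
        have hba : u (g b) < u (g a) := (h b a).2 (by rw [hb]; exact hlt)
        have := ih _ hba b rfl
        rw [hb] at this
        exact absurd this hba.ne
      · exact heq
      · obtain ⟨b, hb⟩ := g.surjective (g' a)
        have := ih _ hgt b (by rw [hb])
        have hab : a = b := g'.injective (hu (by rw [← this, hb]))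
        rw [← hab] at hb
        exact absurd hgt (by rw [hb]; exact lt_irrefl _)
  exact Equiv.ext fun a => hu (key _ a rfl)

theorem FinUltra.injective_of_isometry {S : Set ℝ} (hSpos : ∀ s ∈ S, 0 < s) {X Y : FinUltra S}
    {f : Fin X.n → Fin Y.n} (hf : ∀ a b, Y.d (f a) (f b) = X.d a b) : Function.Injective f := by
  intro a b h
  by_contra hab
  have h1 := hSpos _ (X.d_mem a b hab)
  rw [← hf, h, Y.d_self] at h1
  exact lt_irrefl _ h1

theorem IsConvexRank.isConvexSTO_comp {S : Set ℝ} (hSpos : ∀ s ∈ S, 0 < s) {X Y : FinUltra S}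
    {ρ : Fin Y.n → ℕ} (hρ : IsConvexRank Y.d ρ) {f : Fin X.n → Fin Y.n}
    (hf : ∀ a b, Y.d (f a) (f b) = X.d a b) :
    IsConvexSTO X.d (fun a b => ρ (f a) < ρ (f b)) := by
  refine ⟨⟨fun _ => lt_irrefl _, fun _ _ _ => lt_trans, fun a b => ?_⟩, fun a b c h h' => ?_⟩
  · rcases lt_trichotomy (ρ (f a)) (ρ (f b)) with h | h | h
    · exact Or.inl h
    · exact Or.inr (Or.inl (FinUltra.injective_of_isometry hSpos hf (hρ.1 h)))
    · exact Or.inr (Or.inr h)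
  · simpa only [hf] using hρ.2 _ _ _ h h'

/-- τ(X) = |cLO(X)|/|iso(X)| is an upper bound for the Ramsey degree of `X` in `U_S`. -/
theorem ramsey_degree_upper_bound
    (S : Set ℝ) (hSpos : ∀ s ∈ S, 0 < s) (X : FinUltra S) :
    ∀ Y : FinUltra S, ∀ k : ℕ, 1 ≤ k →
      ∃ Z : FinUltra S, ∀ χ : Set (Fin Z.n) → Fin k,
        ∃ B : Set (Fin Z.n), IsCopy Y Z B ∧
          {c : Fin k | ∃ A : Set (Fin Z.n), IsCopy X Z A ∧ A ⊆ B ∧ χ A = c}.ncard ≤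
            tau S X := by
  intro Y k hk
  have : Nonempty (Fin k) := ⟨⟨0, hk⟩⟩
  obtain ⟨ρ, hρ⟩ := Y.exists_isConvexRank hSpos
  obtain ⟨Z, hZ⟩ := FinUltra.exists_color_eq_of_order hSpos X Y hρ (Fin k)
  refine ⟨Z, fun χ => ?_⟩
  obtain ⟨e, he, hcol⟩ := hZ χ
  refine ⟨Set.range e, ⟨e, rfl, he⟩, ?_⟩
  set C := {c : Fin k | ∃ A : Set (Fin Z.n), IsCopy X Z A ∧ A ⊆ Set.range e ∧ χ A = c}
  have hC : ∀ c : C, ∃ f : Fin X.n → Fin Y.n, (∀ a b, Y.d (f a) (f b) = X.d a b) ∧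
      χ (Set.range (e ∘ f)) = c := by
    rintro ⟨c, A, ⟨F, rfl, hF⟩, hA, rfl⟩
    choose f hf using fun x => hA ⟨x, rfl⟩
    refine ⟨f, fun a b => by rw [← he, hf, hf, hF], ?_⟩
    rw [show e ∘ f = F from funext hf]
  choose f hf hχ using hC
  let G := {g : Fin X.n ≃ Fin X.n // ∀ a b, X.d (g a) (g b) = X.d a b}
  let O := {r : Fin X.n → Fin X.n → Prop // IsConvexSTO X.d r}
  have hfg : ∀ (c : C) (g : G) (a b : Fin X.n),
      Y.d ((f c ∘ g.1) a) ((f c ∘ g.1) b) = X.d a b := fun c g a b => by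
    simp only [Function.comp_apply, hf, g.2]
  let Φ : C × G → O := fun p => ⟨_, hρ.isConvexSTO_comp hSpos (hfg p.1 p.2)⟩
  have hΦ : Function.Injective Φ := by
    rintro ⟨c, g⟩ ⟨c', g'⟩ h
    have hpat : ∀ a b, ρ (f c (g.1 a)) < ρ (f c (g.1 b)) ↔
        ρ (f c' (g'.1 a)) < ρ (f c' (g'.1 b)) := fun a b =>
      iff_of_eq (congrFun (congrFun (congrArg Subtype.val h) a) b)
    have hrange : ∀ (c : C) (g : G), χ (Set.range (e ∘ f c ∘ g.1)) = c := fun c g => by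
      rw [← hχ c, ← Function.comp_assoc, g.1.surjective.range_comp]
    obtain rfl : c = c' := Subtype.ext <| by
      rw [← hrange c g, ← hrange c' g']
      exact hcol _ _ (hfg c g) (hfg c' g') hpat
    have hinj : Function.Injective (ρ ∘ f c) :=
      hρ.1.comp (FinUltra.injective_of_isometry hSpos (hf c))
    rw [Subtype.ext (perm_eq_of_order_iff hinj hpat : g.1 = g'.1)]
  have : Nonempty G := ⟨⟨Equiv.refl _, fun _ _ => rfl⟩⟩
  have hcard := Nat.card_le_card_of_injective Φ hΦ
  rw [Nat.card_prod, Nat.card_coe_set_eq] at hcard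
  exact (Nat.le_div_iff_mul_le Nat.card_pos).2 hcard
end

section
/- Let S ⊆ (0,∞). Every finite ultrametric space X with nonzero distances in S has a Ramsey degree in U_S, and this Ramsey degree equals τ(X) = |cLO(X)|/|iso(X)|. That is, τ(X) is the least integer l ≥ 1 such that for every finite ultrametric space Y with nonzero distances in S and every integer k ≥ 1, there exists a finite ultrametric space Z with nonzero distances in S such that every coloring of the isometric copies of X in Z with k colors admits an isometric copy Ỹ of Y in Z on whose copies of X the coloring takes at most l values. -/
/-- `l` is a Ramsey bound for `X` in `U_S`: for every `Y ∈ U_S` and every `k ≥ 1`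
there is `Z ∈ U_S` such that every `k`-coloring of the copies of `X` in `Z` takes at
most `l` values on the copies of `X` inside some copy of `Y` in `Z`. -/
def IsRamseyBound (S : Set ℝ) (X : FinUltra S) (l : ℕ) : Prop :=
  ∀ Y : FinUltra S, ∀ k : ℕ, 1 ≤ k →
    ∃ Z : FinUltra S, ∀ χ : Set (Fin Z.n) → Fin k,
      ∃ B : Set (Fin Z.n), IsCopy Y Z B ∧
        {c : Fin k | ∃ A : Set (Fin Z.n), IsCopy X Z A ∧ A ⊆ B ∧ χ A = c}.ncard ≤ l

/-- The finite Ramsey theorem for subsets of size `r + 1`, weakened so that the color of a set may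
depend on its least element. -/
theorem exists_minHomogeneous {r k : ℕ}
    (hr : ∀ M : ℕ, ∃ N : ℕ, ∀ {α : Type} [LinearOrder α] (V : Finset α), N ≤ V.card →
      ∀ χ : Finset α → Fin k, ∃ H ⊆ V, H.card = M ∧
        ∃ c, ∀ P ⊆ H, P.card = r → χ P = c) (M : ℕ) :
    ∃ N : ℕ, ∀ {α : Type} [LinearOrder α] (V : Finset α), N ≤ V.card →
      ∀ χ : Finset α → Fin k, ∃ H ⊆ V, H.card = M ∧
        ∃ c : α → Fin k, ∀ v ∈ H, ∀ P ⊆ H, (∀ u ∈ P, v < u) → P.card = r →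
          χ (insert v P) = c v := by
  induction M with
  | zero =>
    refine ⟨0, fun V _ χ => ⟨∅, by simp, by simp, fun _ => χ ∅, by simp⟩⟩
  | succ M ih =>
    obtain ⟨N₁, h₁⟩ := ih
    obtain ⟨N₂, h₂⟩ := hr N₁
    refine ⟨N₂ + 1, fun {α} _ V hV χ => ?_⟩
    have hne : V.Nonempty := by
      rw [← Finset.card_pos]; omega
    set v := V.min' hne with hv
    have hvV : v ∈ V := V.min'_mem hne
    obtain ⟨H₂, hH₂, hc₂, c₂, hχ₂⟩ := h₂ (V.erase v)
      (by rw [Finset.card_erase_of_mem hvV]; omega) (fun P => χ (insert v P))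
    obtain ⟨H₁, hH₁, hc₁, c₁, hχ₁⟩ := h₁ H₂ hc₂.ge χ
    have hlt : ∀ u ∈ H₁, v < u := fun u hu => by
      have := Finset.mem_erase.1 (hH₂ (hH₁ hu))
      exact lt_of_le_of_ne (V.min'_le u this.2) this.1.symm
    have hvH : v ∉ H₁ := fun h => (hlt v h).false
    refine ⟨insert v H₁, ?_, by rw [Finset.card_insert_of_notMem hvH, hc₁],
      Function.update c₁ v c₂, ?_⟩
    · intro u hu
      rcases Finset.mem_insert.1 hu with rfl | hu
      · exact hvV
      · exact Finset.mem_of_mem_erase (hH₂ (hH₁ hu))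
    · intro w hw P hP hPw hPr
      have hPsub : P ⊆ H₁ := fun u hu => by
        rcases Finset.mem_insert.1 (hP hu) with rfl | h
        · rcases Finset.mem_insert.1 hw with rfl | hw
          · exact absurd (hPw _ hu) (lt_irrefl _)
          · exact absurd (hPw _ hu) (hlt w hw).not_gt
        · exact h
      rcases Finset.mem_insert.1 hw with rfl | hw
      · rw [Function.update_self]
        exact hχ₂ P (hPsub.trans hH₁) hPr
      · rw [Function.update_of_ne (hlt w hw).ne']
        exact hχ₁ w hw P hPsub hPw hPr

/-- The finite Ramsey theorem for hypergraphs. -/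
theorem exists_homogeneous (r k M : ℕ) :
    ∃ N : ℕ, ∀ {α : Type} [LinearOrder α] (V : Finset α), N ≤ V.card →
      ∀ χ : Finset α → Fin k, ∃ H ⊆ V, H.card = M ∧
        ∃ c, ∀ P ⊆ H, P.card = r → χ P = c := by
  induction r generalizing M with
  | zero =>
    refine ⟨M, fun V hV χ => ?_⟩
    obtain ⟨H, hH, hc⟩ := Finset.exists_subset_card_eq hV
    exact ⟨H, hH, hc, χ ∅, fun P _ hP => by rw [Finset.card_eq_zero.1 hP]⟩
  | succ r ih =>
    obtain ⟨N, hN⟩ := exists_minHomogeneous ih (k * M + 1)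
    refine ⟨N, fun V hV χ => ?_⟩
    obtain ⟨H, hH, hc, c, hχ⟩ := hN V hV χ
    obtain ⟨a, -, ha⟩ := Finset.exists_lt_card_fiber_of_mul_lt_card_of_maps_to
      (s := H) (t := Finset.univ) (f := c) (n := M) (fun _ _ => Finset.mem_univ _)
      (by rw [Finset.card_univ, Fintype.card_fin, hc]; omega)
    obtain ⟨H', hH', hc'⟩ := Finset.exists_subset_card_eq ha.le
    have hH'H : H' ⊆ H := hH'.trans (Finset.filter_subset _ _)
    refine ⟨H', hH'H.trans hH, hc', a, fun P hP hPr => ?_⟩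
    have hne : P.Nonempty := by rw [← Finset.card_pos]; omega
    have hmem := P.min'_mem hne
    have := hχ (P.min' hne) (hH'H (hP hmem)) (P.erase (P.min' hne))
      ((Finset.erase_subset _ _).trans (hP.trans hH'H))
      (fun u hu => lt_of_le_of_ne (P.min'_le u (Finset.mem_of_mem_erase hu))
        (Finset.ne_of_mem_erase hu).symm)
      (by rw [Finset.card_erase_of_mem hmem]; omega)
    rw [Finset.insert_erase hmem] at this
    rw [this]
    exact (Finset.mem_filter.1 (hH' (hP hmem))).2

/-- The Ramsey property of finite linear orders, phrased with strictly monotone maps. -/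
theorem exists_strictMono_homogeneous (A : Type) [LinearOrder A] [Finite A]
    (B : Type) [LinearOrder B] [Finite B] (k : ℕ) :
    ∃ N : ℕ, ∀ χ : (A → Fin N) → Fin k, ∃ h : B → Fin N, StrictMono h ∧
      ∃ c, ∀ g : A → B, StrictMono g → χ (h ∘ g) = c := by
  classical
  have := Fintype.ofFinite A
  have := Fintype.ofFinite B
  obtain ⟨N, hN⟩ := exists_homogeneous (Fintype.card A) k (Fintype.card B)
  refine ⟨N + 1, fun χ => ?_⟩
  obtain ⟨H, -, hc, c, hχ⟩ := hN (Finset.univ : Finset (Fin (N + 1))) (by simp)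
    (fun P => if h : ∃ p : A → Fin (N + 1), StrictMono p ∧ Set.range p = P
      then χ h.choose else χ fun _ => 0)
  let h : B → Fin (N + 1) := fun b =>
    H.orderEmbOfFin hc ((Fintype.orderIsoFinOfCardEq B rfl).symm b)
  have hmono : StrictMono h := fun a b hab => by simpa [h] using hab
  refine ⟨h, hmono, c, fun g hg => ?_⟩
  have hmg := hmono.comp hg
  have hex : ∃ p : A → Fin (N + 1), StrictMono p ∧
      Set.range p = (Finset.univ.image (h ∘ g) : Finset (Fin (N + 1))) :=
    ⟨h ∘ g, hmg, by rw [Finset.coe_image, Finset.coe_univ, Set.image_univ]⟩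
  have key := hχ (Finset.univ.image (h ∘ g)) (by
      intro u hu
      obtain ⟨a, -, rfl⟩ := Finset.mem_image.1 hu
      exact H.orderEmbOfFin_mem hc _)
    (by rw [Finset.card_image_of_injective _ hmg.injective, Finset.card_univ])
  rw [dif_pos hex] at key
  rw [← key]
  congr 1
  refine (StrictMono.range_inj hmg hex.choose_spec.1).1 ?_
  rw [hex.choose_spec.2, Finset.coe_image, Finset.coe_univ, Set.image_univ]

/-- The Ramsey property of finite linear orders, for finitely many colorings at once. -/
theorem exists_strictMono_homogeneous_family {ι : Type} [Finite ι] (A : ι → Type)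
    [∀ i, LinearOrder (A i)] [∀ i, Finite (A i)] (B : Type) [LinearOrder B] [Finite B] (k : ℕ) :
    ∃ N : ℕ, ∀ χ : ∀ i, (A i → Fin N) → Fin k, ∃ h : B → Fin N, StrictMono h ∧
      ∀ i, ∃ c, ∀ g : A i → B, StrictMono g → χ i (h ∘ g) = c := by
  classical
  have := Fintype.ofFinite ι
  have := Fintype.ofFinite B
  suffices H : ∀ T : Finset ι, ∃ N : ℕ, ∀ χ : ∀ i, (A i → Fin N) → Fin k,
      ∃ h : B → Fin N, StrictMono h ∧
        ∀ i ∈ T, ∃ c, ∀ g : A i → B, StrictMono g → χ i (h ∘ g) = c by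
    simpa using H Finset.univ
  intro T
  induction T using Finset.induction_on with
  | empty =>
    exact ⟨Fintype.card B, fun _ => ⟨(Fintype.orderIsoFinOfCardEq B rfl).symm,
      OrderIso.strictMono _, by simp⟩⟩
  | insert i T _ ih =>
    obtain ⟨N₀, h₀⟩ := ih
    obtain ⟨N₁, h₁⟩ := exists_strictMono_homogeneous (A i) (Fin N₀) k
    refine ⟨N₁, fun χ => ?_⟩
    obtain ⟨f₁, hf₁, c₁, hc₁⟩ := h₁ (χ i)
    obtain ⟨f₀, hf₀, hc₀⟩ := h₀ fun j p => χ j (f₁ ∘ p)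
    refine ⟨f₁ ∘ f₀, hf₁.comp hf₀, fun j hj => ?_⟩
    rcases Finset.mem_insert.1 hj with rfl | hj
    · exact ⟨c₁, fun g hg => hc₁ (f₀ ∘ g) (hf₀.comp hg)⟩
    · exact hc₀ j hj

/-- `d` is an ultrametric distance. -/
structure IsUltra {V : Type*} (d : V → V → ℝ) : Prop where
  self : ∀ x, d x x = 0
  symm : ∀ x y, d x y = d y x
  pos : ∀ x y, x ≠ y → 0 < d x y
  ultra : ∀ x y z, d x z ≤ max (d x y) (d y z)

theorem FinUltra.isUltra {S : Set ℝ} (hSpos : ∀ s ∈ S, 0 < s) (X : FinUltra S) :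
    IsUltra X.d :=
  ⟨X.d_self, X.d_symm, fun x y h => hSpos _ (X.d_mem x y h), X.ultra⟩

namespace IsUltra

variable {V W : Type*} {d : V → V → ℝ} {d' : W → W → ℝ} {r : V → V → Prop} {r' : W → W → Prop}

theorem lt_trans (hd : IsUltra d) {x y z : V} {s : ℝ} (h₁ : d x y < s) (h₂ : d y z < s) :
    d x z < s :=
  (hd.ultra x y z).trans_lt (max_lt h₁ h₂)

theorem lt_congr (hd : IsUltra d) {x y : V} {s : ℝ} (h : d x y < s) (z : V) :
    d x z < s ↔ d y z < s :=
  ⟨fun h' => hd.lt_trans (by rwa [hd.symm]) h', fun h' => hd.lt_trans h h'⟩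

theorem rel_right (hd : IsUltra d) (hr : IsConvexSTO d r) {x y y' : V} (h : r x y)
    (hy : d y y' < d x y) : r x y' := by
  rcases hr.1.2.2 x y' with h' | rfl | h'
  · exact h'
  · exact absurd hy (by rw [hd.symm]; exact lt_irrefl _)
  · have := (hr.2 _ _ _ h' h).2
    rw [hd.symm y' y] at this
    exact absurd hy this.not_gt

theorem rel_left (hr : IsConvexSTO d r) {x x' y : V} (h : r x y)
    (hx : d x x' < d x y) : r x' y := by
  rcases hr.1.2.2 x' y with h' | rfl | h'
  · exact h'
  · exact absurd hx (lt_irrefl _)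
  · exact absurd hx (hr.2 _ _ _ h h').1.not_gt

theorem pullback_convex (hr : IsConvexSTO d r) {f : W → V}
    (hf : Function.Injective f) (h : ∀ a b, d (f a) (f b) = d' a b) :
    IsConvexSTO d' fun a b => r (f a) (f b) := by
  refine ⟨⟨fun x => hr.1.1 _, fun x y z => hr.1.2.1 _ _ _, fun x y => ?_⟩, fun x y z h₁ h₂ => ?_⟩
  · rcases hr.1.2.2 (f x) (f y) with h | h | h
    exacts [Or.inl h, Or.inr (Or.inl (hf h)), Or.inr (Or.inr h)]
  · rw [← h, ← h, ← h]
    exact hr.2 _ _ _ h₁ h₂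

theorem injective_of_isometry (hd : IsUltra d) (hd' : IsUltra d') {f : W → V}
    (h : ∀ a b, d (f a) (f b) = d' a b) : Function.Injective f := by
  intro a b hab
  by_contra hne
  have := hd'.pos a b hne
  rw [← h, hab, hd.self] at this
  exact this.false

end IsUltra

section BallRank

variable {V W : Type*} {d : V → V → ℝ} {d' : W → W → ℝ} {r : V → V → Prop} {r' : W → W → Prop}

/-- The number of points preceding the whole open ball of radius `s` around `x`. -/
noncomputable def ballRank (d : V → V → ℝ) (r : V → V → Prop) (x : V) (s : ℝ) : ℕ :=
  {y | ∀ z, d x z < s → r y z}.ncard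

theorem ballRank_congr (hd : IsUltra d) (r : V → V → Prop) {x x' : V} {s : ℝ}
    (h : d x x' < s) : ballRank d r x s = ballRank d r x' s := by
  unfold ballRank
  simp only [hd.lt_congr h]

theorem ballRank_anti [Finite V] (d : V → V → ℝ) (r : V → V → Prop) (x : V) {s t : ℝ}
    (h : t ≤ s) : ballRank d r x s ≤ ballRank d r x t :=
  Set.ncard_le_ncard (fun _ hy z hz => hy z (hz.trans_le h)) (Set.toFinite _)

theorem ballRank_lt [Finite V] (hd : IsUltra d) (hr : IsConvexSTO d r) {x x' : V} {s t : ℝ}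
    (hs : 0 < s) (hx : r x x') (ht : t ≤ d x x') : ballRank d r x s < ballRank d r x' t := by
  refine Set.ncard_lt_ncard ?_ (Set.toFinite _)
  have hxz : ∀ z, d x' z < t → r x z := fun z hz => hd.rel_right hr hx (hz.trans_le ht)
  have hxx : d x x < s := by rwa [hd.self]
  refine (Set.ssubset_iff_of_subset ?_).2 ⟨x, hxz, fun h => hr.1.1 x (h x hxx)⟩
  exact fun y hy z hz => hr.1.2.1 _ _ _ (hy x hxx) (hxz z hz)

theorem ballRank_lt_card [Finite V] (hd : IsUltra d) (hr : IsConvexSTO d r) (x : V) {s : ℝ}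
    (hs : 0 < s) : ballRank d r x s < Nat.card V := by
  rw [← Set.ncard_univ]
  refine Set.ncard_lt_ncard ?_ (Set.toFinite _)
  rw [Set.ssubset_univ_iff, Set.ne_univ_iff_exists_notMem]
  exact ⟨x, fun h => hr.1.1 x (h x (by rwa [hd.self]))⟩

/-- The position of the open ball of radius `s` around `x` in the depth-first enumeration of the
tree of balls: balls are compared by their least elements, then larger balls come first. -/
noncomputable def ballLabel (d : V → V → ℝ) (r : V → V → Prop) (p : V × ℝ) : ℕ ×ₗ ℝᵒᵈ :=
  toLex (ballRank d r p.1 p.2, OrderDual.toDual p.2)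

theorem ballLabel_congr (hd : IsUltra d) (r : V → V → Prop) {x x' : V} {s : ℝ}
    (h : d x x' < s) : ballLabel d r (x, s) = ballLabel d r (x', s) := by
  simp only [ballLabel, ballRank_congr hd r h]

theorem ballLabel_lt_of_rel [Finite V] (hd : IsUltra d) (hr : IsConvexSTO d r) {x x' : V}
    {s t : ℝ} (hs : 0 < s) (hx : r x x') (ht : t ≤ d x x') :
    ballLabel d r (x, s) < ballLabel d r (x', t) :=
  Prod.Lex.toLex_lt_toLex.2 (Or.inl (ballRank_lt hd hr hs hx ht))

theorem ballLabel_lt_of_lt [Finite V] (hd : IsUltra d) (r : V → V → Prop) {x x' : V} {s t : ℝ}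
    (hts : t < s) (hx : d x x' < s) : ballLabel d r (x, s) < ballLabel d r (x', t) := by
  refine Prod.Lex.toLex_lt_toLex.2 ?_
  have h := ballRank_anti d r x' hts.le
  rw [← ballRank_congr hd r hx] at h
  rcases h.lt_or_eq with h | h
  · exact Or.inl h
  · exact Or.inr ⟨h, OrderDual.toDual_lt_toDual.2 hts⟩

theorem ballLabel_eq_iff [Finite V] (hd : IsUltra d) (hr : IsConvexSTO d r) {x x' : V} {s : ℝ}
    (hs : 0 < s) : ballLabel d r (x, s) = ballLabel d r (x', s) ↔ d x x' < s := by
  refine ⟨fun h => ?_, ballLabel_congr hd r⟩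
  by_contra! hx
  rcases hr.1.2.2 x x' with h' | rfl | h'
  · exact (ballLabel_lt_of_rel hd hr hs h' hx).ne h
  · rw [hd.self] at hx
    exact hx.not_gt hs
  · exact (ballLabel_lt_of_rel hd hr hs h' (by rwa [hd.symm])).ne' h

/-- Ordered isometric embeddings preserve the depth-first enumeration of balls. -/
theorem ballLabel_map [Finite V] [Finite W] (hd : IsUltra d) (hr : IsConvexSTO d r)
    (hd' : IsUltra d') (hr' : IsConvexSTO d' r') {f : V → W}
    (hf : ∀ a b, d' (f a) (f b) = d a b) (hfr : ∀ a b, r a b → r' (f a) (f b))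
    {x y : V} {s t : ℝ} (hs : 0 < s) (ht : 0 < t)
    (h : ballLabel d r (x, s) < ballLabel d r (y, t)) :
    ballLabel d' r' (f x, s) < ballLabel d' r' (f y, t) := by
  rcases lt_or_ge (d x y) s with hxs | hxs
  · rcases lt_trichotomy t s with hts | rfl | hts
    · exact ballLabel_lt_of_lt hd' r' hts (by rwa [hf])
    · exact absurd (ballLabel_congr hd r hxs) h.ne
    · exact absurd (ballLabel_lt_of_lt hd r hts (by rw [hd.symm]; exact hxs.trans hts)) h.not_gt
  · rcases lt_or_ge (d x y) t with hxt | hxt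
    · exact absurd (ballLabel_lt_of_lt hd r (hxs.trans_lt hxt) (by rwa [hd.symm])) h.not_gt
    · rcases hr.1.2.2 x y with h' | rfl | h'
      · exact ballLabel_lt_of_rel hd' hr' hs (hfr _ _ h') (by rwa [hf])
      · rw [hd.self] at hxs
        exact absurd hs hxs.not_gt
      · exact absurd (ballLabel_lt_of_rel hd hr ht h' (by rwa [hd.symm])) h.not_gt

/-- Every finite ultrametric space has a convex linear ordering. -/
theorem exists_isConvexSTO [Finite V] (hd : IsUltra d) : ∃ r : V → V → Prop, IsConvexSTO d r := by
  obtain ⟨e⟩ : Nonempty (V ≃ Fin (Nat.card V)) := ⟨Finite.equivFin V⟩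
  classical
  have hne : ∀ x s, 0 < s → ∃ n : ℕ, ∃ z, d x z < s ∧ (e z : ℕ) = n :=
    fun x s hs => ⟨e x, x, by rwa [hd.self], rfl⟩
  -- the least index of a point in the open ball of radius `s` around `x`
  let m : V → ℝ → ℕ := fun x s => sInf {n : ℕ | ∃ z, d x z < s ∧ (e z : ℕ) = n}
  have m_congr : ∀ {x y s}, d x y < s → m x s = m y s := fun {x y s} h => by
    simp only [m, hd.lt_congr h]
  have m_eq : ∀ {x y s}, 0 < s → m x s = m y s → d x y < s := fun {x y s} hs h => by
    obtain ⟨z, hz, hz'⟩ := Nat.sInf_mem (hne x s hs)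
    obtain ⟨w, hw, hw'⟩ := Nat.sInf_mem (hne y s hs)
    have : z = w := e.injective (Fin.ext (hz'.trans (h.trans hw'.symm)))
    subst this
    exact hd.lt_trans hz (by rwa [hd.symm])
  have tri : ∀ x y z, m x (d x y) < m y (d x y) → m y (d y z) < m z (d y z) →
      m x (d x z) < m z (d x z) ∧ d x y ≤ d x z ∧ d y z ≤ d x z := by
    intro x y z hxy hyz
    have h₁ := hd.ultra x y z
    have h₂ := hd.ultra x z y
    have h₃ := hd.ultra y x z
    rw [hd.symm z y] at h₂
    rw [hd.symm y x] at h₃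
    rcases lt_trichotomy (d x y) (d y z) with h | h | h
    · have hxz : d x z = d y z := by
        rw [max_eq_right h.le] at h₁
        rcases le_max_iff.1 h₃ with h' | h' <;> linarith
      rw [hxz, m_congr h]
      exact ⟨hyz, h.le, le_rfl⟩
    · have hxz : d x y ≤ d x z := by
        by_contra! h'
        have := m_congr h'
        rw [← h] at hyz
        omega
      have hxz' : d x z = d x y := le_antisymm (by rw [← h, max_self] at h₁; exact h₁) hxz
      rw [← h] at hyz
      rw [hxz', ← h]
      exact ⟨hxy.trans hyz, le_rfl, le_rfl⟩
    · have hxz : d x z = d x y := by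
        rw [max_eq_left h.le] at h₁
        rcases le_max_iff.1 h₂ with h' | h' <;> linarith
      rw [hxz, ← m_congr h]
      exact ⟨hxy, le_rfl, h.le⟩
  refine ⟨fun x y => m x (d x y) < m y (d x y), ⟨fun x => lt_irrefl _,
    fun x y z h h' => (tri x y z h h').1, fun x y => ?_⟩, fun x y z h h' => (tri x y z h h').2⟩
  by_cases hxy : x = y
  · exact Or.inr (Or.inl hxy)
  · rcases lt_trichotomy (m x (d x y)) (m y (d x y)) with h | h | h
    · exact Or.inl h
    · exact absurd (m_eq (hd.pos x y hxy) h) (lt_irrefl _)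
    · exact Or.inr (Or.inr (by simpa only [hd.symm y x] using h))

end BallRank

section Box

/-- The distance on `D → Fin N` given by the largest coordinate in which two points differ. -/
noncomputable def boxDist {D : Finset ℝ} {N : ℕ} (x y : D → Fin N) : ℝ :=
  sSup {s : ℝ | ∃ h : s ∈ D, x ⟨s, h⟩ ≠ y ⟨s, h⟩}

variable {D : Finset ℝ} {N : ℕ}

theorem boxDist_self (x : D → Fin N) : boxDist x x = 0 := by
  simp [boxDist]

theorem boxDist_eq {x y : D → Fin N} (s : D) (hs : x s ≠ y s)
    (h : ∀ t : D, s < t → x t = y t) : boxDist x y = s := by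
  refine IsGreatest.csSup_eq ⟨⟨s.2, hs⟩, ?_⟩
  rintro t ⟨ht, hne⟩
  by_contra! hlt
  exact hne (h ⟨t, ht⟩ hlt)

theorem exists_boxDist_eq {x y : D → Fin N} (hxy : x ≠ y) :
    ∃ s : D, x s ≠ y s ∧ (∀ t : D, s < t → x t = y t) ∧ boxDist x y = s := by
  classical
  have hne : (Finset.univ.filter fun s : D => x s ≠ y s).Nonempty := by
    obtain ⟨s, hs⟩ := Function.ne_iff.1 hxy
    exact ⟨s, by simpa using hs⟩
  have hmem := Finset.max'_mem _ hne
  set s := Finset.max' _ hne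
  have hs : x s ≠ y s := (Finset.mem_filter.1 hmem).2
  have h : ∀ t : D, s < t → x t = y t := fun t ht => by
    by_contra hne'
    exact ht.not_ge (Finset.le_max' _ t (by simpa using hne'))
  exact ⟨s, hs, h, boxDist_eq s hs h⟩

theorem boxDist_lt_iff {x y : D → Fin N} {s : ℝ} (hs : 0 < s) :
    boxDist x y < s ↔ ∀ t : D, s ≤ t → x t = y t := by
  by_cases hxy : x = y
  · subst hxy
    simp [boxDist_self, hs]
  · obtain ⟨u, hu, hlt, heq⟩ := exists_boxDist_eq hxy
    rw [heq]
    refine ⟨fun h t ht => hlt t (h.trans_le ht), fun h => ?_⟩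
    by_contra! hle
    exact hu (h u hle)

theorem boxDist_isUltra (hD : ∀ s ∈ D, 0 < s) :
    IsUltra (boxDist : (D → Fin N) → (D → Fin N) → ℝ) where
  self := boxDist_self
  symm x y := by simp only [boxDist, ne_comm]
  pos x y hxy := by
    obtain ⟨s, -, -, h⟩ := exists_boxDist_eq hxy
    rw [h]
    exact hD _ s.2
  ultra x y z := by
    by_cases hxz : x = z
    · subst hxz
      rw [boxDist_self]
      by_cases hxy : x = y
      · subst hxy
        simp [boxDist_self]
      · obtain ⟨s, -, -, h⟩ := exists_boxDist_eq hxy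
        exact le_max_of_le_left (h ▸ (hD _ s.2).le)
    · obtain ⟨s, hs, -, h⟩ := exists_boxDist_eq hxz
      by_contra! hlt
      rw [h, max_lt_iff, boxDist_lt_iff (hD _ s.2), boxDist_lt_iff (hD _ s.2)] at hlt
      exact hs ((hlt.1 s le_rfl).trans (hlt.2 s le_rfl))

/-- A map into `D → Fin N` whose coordinate at `s` separates exactly the points at distance at
least `s` is isometric. -/
theorem boxDist_map {V : Type*} {d : V → V → ℝ} (hd : IsUltra d)
    (hdD : ∀ x y, x ≠ y → d x y ∈ D) {F : V → D → Fin N}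
    (hF : ∀ x y (s : D), F x s = F y s ↔ d x y < s) (x y : V) :
    boxDist (F x) (F y) = d x y := by
  by_cases hxy : x = y
  · rw [hxy, boxDist_self, hd.self]
  · refine boxDist_eq (⟨d x y, hdD x y hxy⟩ : D) ?_ fun t ht => ?_
    · rw [Ne, hF]
      exact lt_irrefl _
    · rw [hF]
      exact ht

/-- The box `D → Fin N` as a member of the class of finite ultrametric spaces. -/
theorem exists_finUltra_box {S : Set ℝ} (hSpos : ∀ s ∈ S, 0 < s) (hDS : (D : Set ℝ) ⊆ S) (N : ℕ) :
    ∃ (Z : FinUltra S) (E : Fin Z.n ≃ (D → Fin N)), ∀ a b, Z.d a b = boxDist (E a) (E b) := by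
  have hu : IsUltra (boxDist : (D → Fin N) → (D → Fin N) → ℝ) :=
    boxDist_isUltra fun s hs => hSpos s (hDS hs)
  let E := (Fintype.equivFin (D → Fin N)).symm
  refine ⟨⟨_, fun a b => boxDist (E a) (E b), fun x => hu.self _, fun x y => hu.symm _ _,
    fun x y hxy => ?_, fun x y z => hu.ultra _ _ _⟩, E, fun a b => rfl⟩
  obtain ⟨s, -, -, h⟩ := exists_boxDist_eq (E.injective.ne hxy)
  rw [h]
  exact hDS s.2

/-- Every convex linear ordering of a box is turned into the lexicographic one by an isometry, which
replaces the coordinate of `y` at `s` by the number of its siblings preceding it. -/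
theorem exists_lexify (hD : ∀ s ∈ D, 0 < s) {r : (D → Fin N) → (D → Fin N) → Prop}
    (hr : IsConvexSTO boxDist r) :
    ∃ ρ : (D → Fin N) → D → Fin N, ∀ (y y' : D → Fin N) (s : D), boxDist y y' = s → r y y' →
      ρ y s < ρ y' s ∧ ∀ t : D, s < t → ρ y t = ρ y' t := by
  classical
  have hu : IsUltra (boxDist : (D → Fin N) → (D → Fin N) → ℝ) := boxDist_isUltra hD
  have hupd : ∀ (y : D → Fin N) (s : D) (a : Fin N), a ≠ y s →
      boxDist (Function.update y s a) y = s := fun y s a ha =>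
    boxDist_eq s (by rwa [Function.update_self])
      fun t ht => by rw [Function.update_of_ne ht.ne']
  have hupd' : ∀ (y y' : D → Fin N) (s t : D) (a : Fin N), boxDist y y' = s → s ≤ t →
      boxDist (Function.update y t a) (Function.update y' t a) < t := by
    intro y y' s t a hs hst
    rw [boxDist_lt_iff (hD _ t.2)]
    intro u hu
    rcases eq_or_lt_of_le (show t ≤ u from hu) with rfl | hlt
    · simp
    · rw [Function.update_of_ne hlt.ne', Function.update_of_ne hlt.ne']
      exact (boxDist_lt_iff (hD _ u.2)).1 (hs ▸ hst.trans_lt hlt) u le_rfl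
  let R : (D → Fin N) → D → Finset (Fin N) := fun y s =>
    Finset.univ.filter fun a => r (Function.update y s a) y
  have memR : ∀ {y s a}, a ∈ R y s ↔ r (Function.update y s a) y := by
    intro y s a
    simp [R]
  have notR : ∀ y s, y s ∉ R y s := fun y s h => by
    rw [memR, Function.update_eq_self] at h
    exact hr.1.1 _ h
  refine ⟨fun y s => ⟨(R y s).card, ?_⟩, fun y y' s hs hyy => ⟨?_, fun t ht => ?_⟩⟩
  · calc (R y s).card < (Finset.univ : Finset (Fin N)).card :=
        Finset.card_lt_card (Finset.ssubset_univ_iff.2 fun h => notR y s (h ▸ Finset.mem_univ _))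
      _ = N := by simp
  · refine Fin.mk_lt_mk.2 (Finset.card_lt_card
      ((Finset.ssubset_iff_of_subset fun a ha => ?_).2 ⟨y s, ?_, notR y s⟩))
    · have has : a ≠ y s := fun h => notR y s (h ▸ ha)
      rw [memR] at ha ⊢
      have h₁ := hr.1.2.1 _ _ _ ha hyy
      have has' : a ≠ y' s := by
        rintro rfl
        have h₂ : boxDist (Function.update y s (y' s)) y' < s := by
          have := hupd' y y' s s (y' s) hs le_rfl
          rwa [Function.update_eq_self] at this
        have := IsUltra.rel_left hr ha (h₂.trans_eq (hupd y s _ has).symm)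
        exact hr.1.1 _ (hr.1.2.1 _ _ _ this hyy)
      refine IsUltra.rel_left hr h₁ ((hupd' y y' s s a hs le_rfl).trans_le ?_)
      have h₂ := (hr.2 _ _ _ ha hyy).1
      rwa [hupd y s a has] at h₂
    · rw [memR]
      refine IsUltra.rel_left hr hyy (lt_of_lt_of_eq ?_ hs.symm)
      have := hupd' y y' s s (y s) hs le_rfl
      rwa [Function.update_eq_self] at this
  · have key : ∀ y y' : D → Fin N, boxDist y y' = s → R y t ⊆ R y' t := by
      intro y y' hs a ha
      have hat : a ≠ y t := fun h => notR y t (h ▸ ha)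
      rw [memR] at ha ⊢
      have h₁ := IsUltra.rel_left hr ha ((hupd' y y' s t a hs ht.le).trans_eq (hupd y t a hat).symm)
      have hyt : y t = y' t := (boxDist_lt_iff (hD _ t.2)).1 (hs ▸ ht) t le_rfl
      refine hu.rel_right hr h₁ ?_
      by_contra! h₃
      have h₄ : boxDist (Function.update y' t a) y < t := h₃.trans_lt (hs ▸ ht)
      have h₅ := (boxDist_lt_iff (hD _ t.2)).1 h₄ t le_rfl
      rw [Function.update_self] at h₅
      exact hat h₅
    exact Fin.ext (congrArg Finset.card
      (Finset.Subset.antisymm (key y y' hs) (key y' y (by rw [hu.symm, hs]))))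

end Box

section ConvexOrderType

variable {S : Set ℝ}

/-- A strict total order on a finite type has no nontrivial automorphism. -/
theorem IsSTO.equiv_ext {V : Type*} [Finite V] {r : V → V → Prop} (hr : IsSTO r) {g g' : V ≃ V}
    (h : ∀ a b, r (g a) (g b) ↔ r (g' a) (g' b)) : g = g' := by
  have : Std.Irrefl r := ⟨hr.1⟩
  have : IsTrans V r := ⟨hr.2.1⟩
  have : Std.Trichotomous r := ⟨fun a b h₁ h₂ => by
    rcases hr.2.2 a b with h | h | h
    exacts [absurd h h₁, h, absurd h h₂]⟩
  have : IsWellFounded V r := ⟨Finite.wellFounded_of_trans_of_irrefl r⟩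
  have : IsWellOrder V r := { }
  let i : r ≃r r := ⟨g'.symm.trans g, fun {a b} => by simpa using h (g'.symm a) (g'.symm b)⟩
  have hi : i.toInitialSeg = (RelIso.refl r).toInitialSeg := Subsingleton.elim _ _
  ext x
  have := DFunLike.congr_fun hi (g' x)
  simpa [i] using this

theorem IsSTO.rel_of_map {V W : Type*} {r : V → V → Prop} {r' : W → W → Prop} (hr : IsSTO r)
    (hr' : IsSTO r') {f : V → W} (hf : ∀ a b, r a b → r' (f a) (f b)) {a b : V}
    (h : r' (f a) (f b)) : r a b := by
  rcases hr.2.2 a b with h' | rfl | h'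
  · exact h'
  · exact absurd h (hr'.1 _)
  · exact absurd (hr'.2.1 _ _ _ h (hf _ _ h')) (hr'.1 _)

/-- Two convex linear orderings are equivalent when an isometry carries one to the other. -/
def orderTypeSetoid (X : FinUltra S) :
    Setoid {r : Fin X.n → Fin X.n → Prop // IsConvexSTO X.d r} where
  r r₁ r₂ := ∃ g : Fin X.n ≃ Fin X.n, (∀ a b, X.d (g a) (g b) = X.d a b) ∧
    ∀ a b, r₂.1 a b ↔ r₁.1 (g a) (g b)
  iseqv :=
    { refl := fun _ => ⟨Equiv.refl _, fun _ _ => rfl, fun _ _ => Iff.rfl⟩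
      symm := fun ⟨g, hg, h⟩ => ⟨g.symm, fun a b => by rw [← hg]; simp, fun a b => by rw [h]; simp⟩
      trans := fun ⟨g, hg, h⟩ ⟨g', hg', h'⟩ => ⟨g'.trans g, fun a b => by simp [hg, hg'],
        fun a b => by simp [h, h']⟩ }

/-- The isomorphism types of convex linear orderings of `X`. -/
abbrev ConvexOrderType (X : FinUltra S) : Type := Quotient (orderTypeSetoid X)

/-- A representative of an isomorphism type of convex linear orderings. -/
noncomputable def ConvexOrderType.rep {X : FinUltra S} (q : ConvexOrderType X) :
    Fin X.n → Fin X.n → Prop :=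
  (Quotient.out q).1

theorem ConvexOrderType.rep_convex {X : FinUltra S} (q : ConvexOrderType X) :
    IsConvexSTO X.d q.rep :=
  (Quotient.out q).2

theorem tau_eq_card_convexOrderType (X : FinUltra S) : tau S X = Nat.card (ConvexOrderType X) := by
  let G := {g : Fin X.n ≃ Fin X.n // ∀ a b, X.d (g a) (g b) = X.d a b}
  have : Nonempty G := ⟨Equiv.refl _, fun _ _ => rfl⟩
  let F : ConvexOrderType X × G → {r : Fin X.n → Fin X.n → Prop // IsConvexSTO X.d r} := fun p =>
    ⟨fun a b => p.1.rep (p.2.1 a) (p.2.1 b),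
      IsUltra.pullback_convex p.1.rep_convex p.2.1.injective p.2.2⟩
  have hF : Function.Bijective F := by
    constructor
    · rintro ⟨q, g, hg⟩ ⟨q', g', hg'⟩ h
      have hrel : ∀ a b, q.rep (g a) (g b) ↔ q'.rep (g' a) (g' b) := fun a b =>
        iff_of_eq (congrFun (congrFun (congrArg Subtype.val h) a) b)
      have hq : q = q' := by
        refine Quotient.out_equiv_out.1 ⟨g'.symm.trans g, fun a b => ?_, fun a b => ?_⟩
        · rw [Equiv.trans_apply, Equiv.trans_apply, hg, ← hg']
          simp
        · simpa [ConvexOrderType.rep] using (hrel (g'.symm a) (g'.symm b)).symm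
      subst hq
      have := q.rep_convex.1.equiv_ext hrel
      subst this
      rfl
    · intro r
      obtain ⟨g, hg, h⟩ := Quotient.mk_out (s := orderTypeSetoid X) r
      exact ⟨(Quotient.mk (orderTypeSetoid X) r, ⟨g, hg⟩),
        Subtype.ext (funext fun a => funext fun b => propext (h a b).symm)⟩
  rw [tau, ← Nat.card_congr (Equiv.ofBijective F hF), Nat.card_prod,
    Nat.mul_div_cancel _ Nat.card_pos]

theorem one_le_tau (hSpos : ∀ s ∈ S, 0 < s) (X : FinUltra S) : 1 ≤ tau S X := by
  obtain ⟨r, hr⟩ := exists_isConvexSTO (X.isUltra hSpos)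
  have : Nonempty (ConvexOrderType X) := ⟨Quotient.mk _ ⟨r, hr⟩⟩
  rw [tau_eq_card_convexOrderType]
  exact Nat.card_pos

theorem exists_isOrdCopy (hSpos : ∀ s ∈ S, 0 < s) {X Z : FinUltra S}
    {rZ : Fin Z.n → Fin Z.n → Prop} (hrZ : IsConvexSTO Z.d rZ) {A : Set (Fin Z.n)}
    (hA : IsCopy X Z A) : ∃ q : ConvexOrderType X, IsOrdCopy X Z q.rep rZ A := by
  obtain ⟨f, hfA, hf⟩ := hA
  let r : {r : Fin X.n → Fin X.n → Prop // IsConvexSTO X.d r} := ⟨fun a b => rZ (f a) (f b),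
    IsUltra.pullback_convex hrZ
      ((Z.isUltra hSpos).injective_of_isometry (X.isUltra hSpos) hf) hf⟩
  obtain ⟨g, hg, h⟩ := Quotient.mk_out (s := orderTypeSetoid X) r
  refine ⟨Quotient.mk _ r, f ∘ g.symm, by rw [g.symm.surjective.range_comp, hfA], fun a b => ?_,
    fun a b hab => ?_⟩
  · rw [Function.comp_apply, Function.comp_apply, hf, ← hg]
    simp
  · refine (h (g.symm a) (g.symm b)).2 ?_
    simpa [ConvexOrderType.rep] using hab

theorem IsOrdCopy.orderType_unique (hSpos : ∀ s ∈ S, 0 < s) {X Z : FinUltra S}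
    {rZ : Fin Z.n → Fin Z.n → Prop} (hrZ : IsConvexSTO Z.d rZ) {A : Set (Fin Z.n)}
    {q q' : ConvexOrderType X} (h : IsOrdCopy X Z q.rep rZ A) (h' : IsOrdCopy X Z q'.rep rZ A) :
    q = q' := by
  obtain ⟨f, hfA, hf, hfr⟩ := h
  obtain ⟨f', hfA', hf', hfr'⟩ := h'
  have hinj := (Z.isUltra hSpos).injective_of_isometry (X.isUltra hSpos) hf'
  have hex : ∀ a, ∃ b, f b = f' a := fun a => by
    have : f' a ∈ Set.range f := by rw [hfA, ← hfA']; exact ⟨a, rfl⟩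
    exact this
  choose g hg using hex
  have hgi : Function.Injective g := fun a b hab => hinj (by rw [← hg, ← hg, hab])
  refine Quotient.out_equiv_out.1
    ⟨Equiv.ofBijective g (Finite.injective_iff_bijective.1 hgi), fun a b => ?_, fun a b => ?_⟩
  · rw [Equiv.ofBijective_apply, Equiv.ofBijective_apply, ← hf, hg, hg, hf']
  · rw [Equiv.ofBijective_apply, Equiv.ofBijective_apply]
    constructor
    · intro hab
      refine q.rep_convex.1.rel_of_map hrZ.1 hfr ?_
      rw [hg, hg]
      exact hfr' a b hab
    · intro hab
      refine q'.rep_convex.1.rel_of_map hrZ.1 hfr' ?_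
      rw [← hg, ← hg]
      exact hfr _ _ hab

end ConvexOrderType

section RamseyDegree

variable {S : Set ℝ}

theorem FinUltra.exists_distances (X : FinUltra S) :
    ∃ D : Finset ℝ, (D : Set ℝ) ⊆ S ∧ ∀ x y, x ≠ y → X.d x y ∈ D := by
  classical
  refine ⟨(Finset.univ.filter fun p : Fin X.n × Fin X.n => p.1 ≠ p.2).image
    fun p => X.d p.1 p.2, ?_, fun x y hxy => ?_⟩
  · intro s hs
    obtain ⟨p, hp, rfl⟩ := Finset.mem_image.1 (Finset.mem_coe.1 hs)
    exact X.d_mem _ _ (Finset.mem_filter.1 hp).2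
  · exact Finset.mem_image.2 ⟨(x, y), by simpa using hxy, rfl⟩

/-- The ordering property: some space contains ordered copies of all convex orderings of `X`,
whichever convex linear ordering it is given. -/
theorem exists_ordering_property (hSpos : ∀ s ∈ S, 0 < s) (X : FinUltra S) :
    ∃ Y : FinUltra S, ∀ rY, IsConvexSTO Y.d rY → ∀ rX, IsConvexSTO X.d rX →
      ∃ A, IsOrdCopy X Y rX rY A := by
  obtain ⟨D, hDS, hD⟩ := X.exists_distances
  have hDpos : ∀ s ∈ D, 0 < s := fun s hs => hSpos s (hDS hs)
  obtain ⟨Y, E, hE⟩ := exists_finUltra_box hSpos hDS (Nat.card (Fin X.n))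
  refine ⟨Y, fun rY hrY rX hrX => ?_⟩
  have hX := X.isUltra hSpos
  have hr : IsConvexSTO boxDist fun a b => rY (E.symm a) (E.symm b) :=
    IsUltra.pullback_convex hrY E.symm.injective fun a b => by rw [hE]; simp
  have hbox := boxDist_isUltra (N := Nat.card (Fin X.n)) hDpos
  obtain ⟨ρ, hρ⟩ := exists_lexify hDpos hr
  have hρd : ∀ x y, boxDist (ρ x) (ρ y) = boxDist x y := by
    intro x y
    by_cases hxy : x = y
    · rw [hxy, boxDist_self, boxDist_self]
    · obtain ⟨s, -, -, hs⟩ := exists_boxDist_eq hxy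
      rw [hs]
      rcases hr.1.2.2 x y with h | h | h
      · obtain ⟨h₁, h₂⟩ := hρ x y s hs h
        exact boxDist_eq s h₁.ne h₂
      · exact absurd h hxy
      · obtain ⟨h₁, h₂⟩ := hρ y x s (by rw [hbox.symm, hs]) h
        exact boxDist_eq s h₁.ne' fun t ht => (h₂ t ht).symm
  have hρs : Function.Surjective ρ :=
    Finite.surjective_of_injective (hbox.injective_of_isometry hbox hρd)
  let c : Fin X.n → D → Fin (Nat.card (Fin X.n)) := fun x s =>
    ⟨ballRank X.d rX x s, ballRank_lt_card hX hrX x (hDpos _ s.2)⟩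
  have hclt : ∀ x y (s : D), rX x y → s ≤ X.d x y → c x s < c y s := fun x y s h hs =>
    Fin.mk_lt_mk.2 (ballRank_lt hX hrX (hDpos _ s.2) h hs)
  have hc : ∀ x y (s : D), c x s = c y s ↔ X.d x y < s := by
    intro x y s
    refine ⟨fun h => ?_, fun h => Fin.ext (ballRank_congr hX rX h)⟩
    by_contra! hs
    rcases hrX.1.2.2 x y with h' | h' | h'
    · exact (hclt x y s h' hs).ne h
    · rw [h', hX.self] at hs
      exact hs.not_gt (hDpos _ s.2)
    · exact (hclt y x s h' (by rwa [hX.symm])).ne' h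
  choose F hF using fun x => hρs (c x)
  have hFd : ∀ a b, boxDist (F a) (F b) = X.d a b := fun a b => by
    rw [← hρd, hF, hF, boxDist_map hX hD hc]
  refine ⟨_, fun x => E.symm (F x), rfl, fun a b => by rw [hE]; simpa using hFd a b,
    fun a b hab => ?_⟩
  have hne : a ≠ b := fun h => hrX.1.1 b (h ▸ hab)
  rcases hr.1.2.2 (F a) (F b) with h | h | h
  · exact h
  · exact absurd (hbox.injective_of_isometry hX hFd h) hne
  · have := (hρ (F b) (F a) ⟨X.d a b, hD a b hne⟩ (by rw [hFd, hX.symm]) h).1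
    rw [hF, hF] at this
    exact absurd this (hclt a b _ hab le_rfl).not_gt

theorem tau_le_of_isRamseyBound (hSpos : ∀ s ∈ S, 0 < s) {X : FinUltra S} {l : ℕ}
    (h : IsRamseyBound S X l) : tau S X ≤ l := by
  classical
  obtain ⟨Y, hY⟩ := exists_ordering_property hSpos X
  have hpos := one_le_tau hSpos X
  obtain ⟨Z, hZ⟩ := h Y (tau S X) hpos
  obtain ⟨rZ, hrZ⟩ := exists_isConvexSTO (Z.isUltra hSpos)
  let e : ConvexOrderType X ≃ Fin (tau S X) :=
    Finite.equivFinOfCardEq (tau_eq_card_convexOrderType X).symm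
  obtain ⟨B, ⟨f, rfl, hf⟩, hB⟩ := hZ fun A =>
    if h : ∃ q : ConvexOrderType X, IsOrdCopy X Z q.rep rZ A then e h.choose else ⟨0, hpos⟩
  have hinj := (Z.isUltra hSpos).injective_of_isometry (Y.isUltra hSpos) hf
  refine le_trans (le_of_eq ?_) hB
  refine ((Set.ncard_univ (Fin (tau S X))).trans (Nat.card_fin _)).symm.trans ?_
  congr 1
  refine (Set.eq_univ_of_forall fun c => ?_).symm
  obtain ⟨A, f', -, hf', hfr'⟩ := hY _ (IsUltra.pullback_convex hrZ hinj hf) (e.symm c).rep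
    (e.symm c).rep_convex
  have hcopy : IsOrdCopy X Z (e.symm c).rep rZ (Set.range (f ∘ f')) :=
    ⟨f ∘ f', rfl, fun a b => by rw [Function.comp_apply, Function.comp_apply, hf, hf'], hfr'⟩
  have hex : ∃ q : ConvexOrderType X, IsOrdCopy X Z q.rep rZ (Set.range (f ∘ f')) := ⟨_, hcopy⟩
  refine ⟨Set.range (f ∘ f'), ⟨f ∘ f', rfl, fun a b => ?_⟩, Set.range_comp_subset_range _ _, ?_⟩
  · rw [Function.comp_apply, Function.comp_apply, hf, hf']
  · rw [dif_pos hex, hex.choose_spec.orderType_unique hSpos hrZ hcopy, e.apply_symm_apply]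

/-- The Ramsey property of finite convexly ordered ultrametric spaces, for all ordered versions of
`X` at once. -/
theorem isRamseyBound_tau (hSpos : ∀ s ∈ S, 0 < s) (X : FinUltra S) :
    IsRamseyBound S X (tau S X) := by
  intro Y k _
  have hX := X.isUltra hSpos
  have hY := Y.isUltra hSpos
  obtain ⟨rY, hrY⟩ := exists_isConvexSTO hY
  obtain ⟨D, hDS, hD⟩ := Y.exists_distances
  have hDpos : ∀ s ∈ D, 0 < s := fun s hs => hSpos s (hDS hs)
  let lX : ConvexOrderType X → Fin X.n × D → ℕ ×ₗ ℝᵒᵈ := fun q p => ballLabel X.d q.rep (p.1, p.2)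
  let lY : Fin Y.n × D → ℕ ×ₗ ℝᵒᵈ := fun p => ballLabel Y.d rY (p.1, p.2)
  obtain ⟨N, hN⟩ := exists_strictMono_homogeneous_family
    (fun q : ConvexOrderType X => Set.range (lX q)) (Set.range lY) k
  obtain ⟨Z, E, hE⟩ := exists_finUltra_box hSpos hDS N
  refine ⟨Z, fun χ => ?_⟩
  obtain ⟨h, hmono, hh⟩ := hN fun q p =>
    χ (Set.range fun x => E.symm fun s => p ⟨lX q (x, s), Set.mem_range_self _⟩)
  choose c hc using hh
  let F : Fin Y.n → D → Fin N := fun y s => h ⟨lY (y, s), Set.mem_range_self _⟩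
  have hF : ∀ x y (s : D), F x s = F y s ↔ Y.d x y < s := fun x y s => by
    rw [hmono.injective.eq_iff, Subtype.mk.injEq]
    exact ballLabel_eq_iff hY hrY (hDpos _ s.2)
  have hFd : ∀ a b, Z.d (E.symm (F a)) (E.symm (F b)) = Y.d a b := fun a b => by
    rw [hE, E.apply_symm_apply, E.apply_symm_apply, boxDist_map hY hD hF]
  refine ⟨Set.range fun y => E.symm (F y), ⟨_, rfl, hFd⟩, ?_⟩
  rw [tau_eq_card_convexOrderType, ← Set.ncard_univ]
  refine (Set.ncard_le_ncard ?_ (Set.toFinite (c '' Set.univ))).trans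
    (Set.ncard_image_le (Set.toFinite _))
  rintro _ ⟨A, ⟨f₀, rfl, hf₀⟩, hAB, rfl⟩
  have hpre : ∀ x, ∃ y, E.symm (F y) = f₀ x := fun x => hAB ⟨x, rfl⟩
  choose f₁ hf₁ using hpre
  obtain ⟨q, f, hfA, hf, hfr⟩ := exists_isOrdCopy hSpos hrY (A := Set.range f₁)
    ⟨f₁, rfl, fun a b => by rw [← hFd, hf₁, hf₁, hf₀]⟩
  refine ⟨q, Set.mem_univ _, ?_⟩
  have hmap : ∀ p p' : Fin X.n × D, lX q p < lX q p' → lY (f p.1, p.2) < lY (f p'.1, p'.2) :=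
    fun p p' => ballLabel_map hX q.rep_convex hY hrY hf hfr (hDpos _ p.2.2) (hDpos _ p'.2.2)
  have hmap' : ∀ p p' : Fin X.n × D, lX q p = lX q p' → lY (f p.1, p.2) = lY (f p'.1, p'.2) := by
    rintro ⟨x, s⟩ ⟨x', s'⟩ hp
    have hs : s = s' := Subtype.ext
      (congrArg (fun z : ℕ ×ₗ ℝᵒᵈ => OrderDual.ofDual (ofLex z).2) hp)
    subst hs
    exact ballLabel_congr hY rY (by
      rw [hf]
      exact (ballLabel_eq_iff hX q.rep_convex (hDpos _ s.2)).1 hp)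
  choose pre hpre using fun a : Set.range (lX q) => a.2
  let g : Set.range (lX q) → Set.range lY := fun a =>
    ⟨lY (f (pre a).1, (pre a).2), Set.mem_range_self _⟩
  have hg : StrictMono g := fun a b hab => hmap _ _ (by rw [hpre, hpre]; exact hab)
  rw [← hc q g hg]
  congr 1
  have hgF : ∀ x, (fun s : D => (h ∘ g) ⟨lX q (x, s), Set.mem_range_self _⟩) = F (f x) := by
    intro x
    funext s
    exact congrArg h (Subtype.ext (hmap' _ (x, s) (hpre _)))
  simp only [hgF]
  have h₁ : f₀ = (fun y => E.symm (F y)) ∘ f₁ := funext fun x => (hf₁ x).symm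
  rw [h₁, Set.range_comp, ← hfA, ← Set.range_comp]
  rfl

end RamseyDegree

/-- Every finite ultrametric space with distances in `S` has a Ramsey degree in `U_S`,
equal to τ(X) = |cLO(X)|/|iso(X)| : τ(X) is the least `l ≥ 1` which is a Ramsey
bound for `X`. -/
theorem ramsey_degree_eq_tau
    (S : Set ℝ) (hSpos : ∀ s ∈ S, 0 < s) (X : FinUltra S) :
    IsLeast {l : ℕ | 1 ≤ l ∧ IsRamseyBound S X l} (tau S X) := by
  exact ⟨⟨one_le_tau hSpos X, isRamseyBound_tau hSpos X⟩,
    fun _ h => tau_le_of_isRamseyBound hSpos h.2⟩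
end

section
/- Fix n ≥ 1 and an integer k ≥ 1. Let S ⊆ T be finite subtrees of ℕ^{≤n}, both of height n. Then there exists a finite subtree U of ℕ^{≤n} of height n such that for every coloring of the copies of S inside U with k colors, there is a copy T̃ of T inside U such that all copies of S contained in T̃ receive the same color. -/
/-- The lexicographical ordering on `ℕ^{≤n}` (finite sequences of naturals): levels
ordered by height first, then lexicographically by the first coordinate of
disagreement. -/
def lexLt (s t : List ℕ) : Prop :=
  s.length < t.length ∨ (s.length = t.length ∧ List.Lex (· < ·) s t)

/-- `A` is a subtree of `ℕ^{≤n}` of height `n`: a set of sequences of length at most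
`n`, closed under initial segments, all of whose maximal elements have length `n`. -/
def IsSubtree (n : ℕ) (A : Set (List ℕ)) : Prop :=
  (∀ l ∈ A, l.length ≤ n) ∧
  (∀ l ∈ A, ∀ p : List ℕ, p <+: l → p ∈ A) ∧
  (∀ l ∈ A, (∀ m ∈ A, l <+: m → m = l) → l.length = n)

/-- `A` is a copy of `T` : there is a bijection from `T` onto `A` preserving (in both
directions) the initial-segment partial order and the lexicographical order. -/
def IsTreeCopy (T A : Set (List ℕ)) : Prop :=
  ∃ f : List ℕ → List ℕ, Set.BijOn f T A ∧
    (∀ s ∈ T, ∀ t ∈ T, (s <+: t ↔ f s <+: f t)) ∧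
    (∀ s ∈ T, ∀ t ∈ T, (lexLt s t ↔ lexLt (f s) (f t)))

/-- **Ramsey's theorem** for `m`-element sets of naturals, in its finite form. -/
theorem finite_ramsey (k m M : ℕ) : ∃ N : ℕ, ∀ X : Finset ℕ, N ≤ X.card →
    ∀ χ : Finset ℕ → Fin k, ∃ H ⊆ X, H.card = M ∧
      ∃ c, ∀ Y ⊆ H, Y.card = m → χ Y = c := by
  induction m generalizing M with
  | zero =>
    refine ⟨M, fun X hX χ => ?_⟩
    obtain ⟨H, hH, hc⟩ := Finset.exists_subset_card_eq hX
    refine ⟨H, hH, hc, χ ∅, fun Y _ hY => ?_⟩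
    rw [Finset.card_eq_zero.1 hY]
  | succ m ih =>
    have end_homogeneous : ∀ L : ℕ, ∃ N : ℕ, ∀ X : Finset ℕ, N ≤ X.card →
        ∀ χ : Finset ℕ → Fin k, ∃ H ⊆ X, H.card = L ∧
          ∃ c : ℕ → Fin k, ∀ x ∈ H, ∀ Y ⊆ H, (∀ y ∈ Y, x < y) → Y.card = m →
            χ (insert x Y) = c x := by
      intro L
      induction L with
      | zero =>
        exact ⟨0, fun X _ χ => ⟨∅, by simp, rfl, fun _ => χ ∅, by simp⟩⟩
      | succ L ihL =>
        obtain ⟨N₁, hN₁⟩ := ihL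
        obtain ⟨N₂, hN₂⟩ := ih N₁
        refine ⟨N₂ + 1, fun X hX χ => ?_⟩
        have hne : X.Nonempty := Finset.card_pos.1 (by omega)
        set a := X.min' hne with ha
        have haX : a ∈ X := X.min'_mem hne
        obtain ⟨X', hX', hcard, d, hd⟩ := hN₂ (X.erase a)
          (by rw [Finset.card_erase_of_mem haX]; omega) (fun Y => χ (insert a Y))
        obtain ⟨H, hH, hHc, c, hc⟩ := hN₁ X' hcard.ge χ
        have hHX : H ⊆ X.erase a := hH.trans hX'
        have haH : a ∉ H := fun h => by simpa using hHX h
        have hlt : ∀ y ∈ H, a < y := fun y hy =>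
          lt_of_le_of_ne (X.min'_le y (Finset.mem_of_mem_erase (hHX hy)))
            (fun h => haH (h ▸ hy))
        refine ⟨insert a H, Finset.insert_subset haX (hHX.trans (Finset.erase_subset _ _)),
          by rw [Finset.card_insert_of_notMem haH, hHc], Function.update c a d, ?_⟩
        intro x hx Y hY hxY hYc
        have haY : a ∉ Y := by
          intro h
          have h1 := hxY a h
          rcases Finset.mem_insert.1 hx with rfl | h2
          · exact lt_irrefl _ h1
          · exact lt_asymm h1 (hlt x h2)
        have hYH : Y ⊆ H := (Finset.subset_insert_iff_of_notMem haY).1 hY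
        rcases Finset.mem_insert.1 hx with rfl | h2
        · rw [Function.update_self]
          exact hd Y (hYH.trans hH) hYc
        · rw [Function.update_of_ne (hlt x h2).ne']
          exact hc x h2 Y hYH hxY hYc
    obtain ⟨N, hN⟩ := end_homogeneous (k * M)
    refine ⟨N, fun X hX χ => ?_⟩
    obtain ⟨H, hHX, hHc, c, hc⟩ := hN X hX χ
    have : Nonempty (Fin k) := ⟨χ ∅⟩
    obtain ⟨e, -, he⟩ := Finset.exists_le_card_fiber_of_mul_le_card_of_maps_to
      (s := H) (t := Finset.univ) (f := c) (n := M) (fun _ _ => Finset.mem_univ _)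
      Finset.univ_nonempty (by simp [hHc])
    obtain ⟨K, hK, hKc⟩ := Finset.exists_subset_card_eq he
    have hKH : K ⊆ H := hK.trans (Finset.filter_subset _ _)
    refine ⟨K, hKH.trans hHX, hKc, e, fun Y hY hYc => ?_⟩
    have hne : Y.Nonempty := Finset.card_pos.1 (by omega)
    have hmem := Y.min'_mem hne
    rw [← Finset.insert_erase hmem, hc _ (hKH (hY hmem)) (Y.erase (Y.min' hne))
      ((Finset.erase_subset _ _).trans (hY.trans hKH))
      (fun y hy => Y.min'_lt_of_mem_erase_min' hne hy)
      (by rw [Finset.card_erase_of_mem hmem]; omega)]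
    exact (Finset.mem_filter.1 (hK (hY hmem))).2

theorem StrictMonoOn.comp_orderEmbOfFin {α β : Type*} [LinearOrder α] [LinearOrder β]
    {P : Finset α} {g : α → β} (hg : StrictMonoOn g P) {m : ℕ} (hP : P.card = m) {Y : Finset β}
    (hY : Y.card = m) (hgY : ∀ x ∈ P, g x ∈ Y) :
    g ∘ P.orderEmbOfFin hP = Y.orderEmbOfFin hY :=
  Finset.orderEmbOfFin_unique hY (fun i => hgY _ (P.orderEmbOfFin_mem hP i))
    (fun _ _ hij => hg (P.orderEmbOfFin_mem hP _) (P.orderEmbOfFin_mem hP _)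
      ((P.orderEmbOfFin hP).strictMono hij))

theorem StrictMonoOn.eqOn_of_mapsTo_of_card {α β : Type*} [LinearOrder α] [LinearOrder β]
    {P : Finset α} {Y : Finset β} (hcard : Y.card = P.card) {g h : α → β}
    (hg : StrictMonoOn g P) (hh : StrictMonoOn h P)
    (hgY : ∀ x ∈ P, g x ∈ Y) (hhY : ∀ x ∈ P, h x ∈ Y) : Set.EqOn g h P := by
  intro x hx
  obtain ⟨i, rfl⟩ : x ∈ Set.range (P.orderEmbOfFin rfl) := by
    rwa [Finset.range_orderEmbOfFin]
  have h₁ := hg.comp_orderEmbOfFin rfl hcard hgY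
  have h₂ := hh.comp_orderEmbOfFin rfl hcard hhY
  exact congrFun (h₁.trans h₂.symm) i

theorem Finset.exists_strictMonoOn_mapsTo {α β : Type*} [LinearOrder α] [LinearOrder β]
    [Nonempty β] {P : Finset α} {Y : Finset β} (hcard : Y.card = P.card) :
    ∃ g : α → β, StrictMonoOn g P ∧ ∀ x ∈ P, g x ∈ Y := by
  classical
  let e := (P.orderIsoOfFin rfl).symm
  refine ⟨fun x => if hx : x ∈ P then Y.orderEmbOfFin hcard (e ⟨x, hx⟩)
    else Classical.arbitrary β, ?_, ?_⟩
  · intro x hx y hy hxy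
    have hx' : x ∈ P := hx
    have hy' : y ∈ P := hy
    simp only [hx', hy', dif_pos]
    exact (Y.orderEmbOfFin hcard).strictMono (e.strictMono hxy)
  · intro x hx
    simp only [hx, dif_pos]
    exact Y.orderEmbOfFin_mem hcard _

theorem List.exists_take_succ_lt_of_lt {s t : List ℕ} (hlt : s < t) (hpre : ¬ s <+: t) :
    ∃ i, i < s.length ∧ i < t.length ∧ s.take i = t.take i ∧
      s.take (i + 1) < t.take (i + 1) := by
  rcases List.lt_iff_exists.1 hlt with ⟨h, -⟩ | ⟨i, hs, ht, heq, hi⟩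
  · exact absurd (List.prefix_iff_eq_take.2 h) hpre
  · refine ⟨i, hs, ht, ?_, ?_⟩
    · refine List.ext_getElem (by simp; omega) fun j h₁ h₂ => ?_
      simp only [List.getElem_take]
      exact heq j (by simp at h₁; omega)
    · refine List.lt_iff_exists.2 (Or.inr ⟨i, by simp; omega, by simp; omega, ?_, ?_⟩)
      · intro j hj
        simpa using heq j hj
      · simpa using hi

theorem List.lt_of_prefix_of_prefix_of_lt {u v a b : List ℕ} (huv : u < v)
    (hlen : u.length = v.length) (hu : u <+: a) (hv : v <+: b) : a < b := by
  obtain ⟨x, rfl⟩ := hu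
  obtain ⟨y, rfl⟩ := hv
  rcases List.lt_iff_exists.1 huv with ⟨-, h⟩ | ⟨i, hs, ht, heq, hi⟩
  · omega
  · refine List.lt_iff_exists.2 (Or.inr ⟨i, by simp; omega, by simp; omega, ?_, ?_⟩)
    · intro j hj
      rw [List.getElem_append_left (by omega), List.getElem_append_left (by omega)]
      exact heq j hj
    · rwa [List.getElem_append_left hs, List.getElem_append_left ht]

theorem List.lt_of_prefix_of_ne {s t : List ℕ} (h : s <+: t) (hne : s ≠ t) : s < t :=
  List.lt_iff_exists.2 (Or.inl ⟨List.prefix_iff_eq_take.1 h,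
    lt_of_le_of_ne h.length_le fun hl => hne (h.eq_of_length hl)⟩)

theorem lexLt_iff_of_length_eq {s t : List ℕ} (h : s.length = t.length) :
    lexLt s t ↔ s < t := by
  simp only [lexLt, h, lt_irrefl, false_or, true_and]
  rfl

/-- The sequence of the `g`-labels of the nonempty initial segments of `t`. -/
def relabel (g : List ℕ → ℕ) (t : List ℕ) : List ℕ :=
  (List.range t.length).map fun i => g (t.take (i + 1))

@[simp]
theorem length_relabel (g : List ℕ → ℕ) (t : List ℕ) : (relabel g t).length = t.length := by
  simp [relabel]

@[simp]
theorem getElem_relabel (g : List ℕ → ℕ) (t : List ℕ) (i : ℕ) (h : i < (relabel g t).length) :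
    (relabel g t)[i] = g (t.take (i + 1)) := by
  simp [relabel]

theorem take_relabel (g : List ℕ → ℕ) (t : List ℕ) (j : ℕ) :
    (relabel g t).take j = relabel g (t.take j) := by
  refine List.ext_getElem (by simp) fun i h₁ h₂ => ?_
  have : i < j := by simp at h₁; omega
  simp [List.take_take, Nat.min_eq_left (Nat.succ_le_of_lt this)]

theorem relabel_congr {g h : List ℕ → ℕ} {t : List ℕ}
    (hgh : ∀ p, p <+: t → p ≠ [] → g p = h p) : relabel g t = relabel h t := by
  refine List.ext_getElem (by simp) fun i h₁ h₂ => ?_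
  rw [length_relabel] at h₁
  simp only [getElem_relabel]
  exact hgh _ (List.take_prefix _ _) (List.ne_nil_of_length_pos (by simp; omega))

theorem getLastD_relabel (g : List ℕ → ℕ) {t : List ℕ} (ht : t ≠ []) :
    (relabel g t).getLastD 0 = g t := by
  have hpos := List.length_pos_of_ne_nil ht
  have hne : relabel g t ≠ [] := List.ne_nil_of_length_pos (by simpa using hpos)
  rw [List.getLastD_eq_getLast?, List.getLast?_eq_some_getLast hne, Option.getD_some,
    List.getLast_eq_getElem, getElem_relabel]
  simp [Nat.sub_add_cancel hpos]

section TreeMaps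

variable {D : Set (List ℕ)} (hD : ∀ l ∈ D, ∀ p : List ℕ, p <+: l → p ∈ D)

include hD in
theorem strictMonoOn_relabel {g : List ℕ → ℕ} (hg : StrictMonoOn g (D \ {[]})) :
    StrictMonoOn (relabel g) D := by
  intro s hs t ht hst
  by_cases hpre : s <+: t
  · refine List.lt_of_prefix_of_ne ?_ fun h => ?_
    · rw [List.prefix_iff_eq_take, take_relabel, length_relabel,
        ← List.prefix_iff_eq_take.1 hpre]
    · have := congrArg List.length h
      simp only [length_relabel] at this
      exact hst.ne (hpre.eq_of_length this)
  · obtain ⟨i, his, hit, heq, hlt⟩ := List.exists_take_succ_lt_of_lt hst hpre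
    refine List.lt_iff_exists.2 (Or.inr ⟨i, by simpa, by simpa, ?_, ?_⟩)
    · intro j hj
      have := congrArg (List.take (j + 1)) heq
      rw [List.take_take, List.take_take, Nat.min_eq_left hj] at this
      simp [this]
    · simp only [getElem_relabel]
      exact hg ⟨hD s hs _ (List.take_prefix _ _), List.ne_nil_of_length_pos (by simp; omega)⟩
        ⟨hD t ht _ (List.take_prefix _ _), List.ne_nil_of_length_pos (by simp; omega)⟩ hlt

include hD in
theorem isTreeCopy_relabel {g : List ℕ → ℕ} (hg : StrictMonoOn g (D \ {[]})) :
    IsTreeCopy D (relabel g '' D) := by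
  have hmono := strictMonoOn_relabel hD hg
  refine ⟨relabel g, hmono.injOn.bijOn_image, fun s hs t ht => ?_, fun s hs t ht => ?_⟩
  · rw [List.prefix_iff_eq_take, List.prefix_iff_eq_take, take_relabel, length_relabel]
    exact (hmono.injOn.eq_iff hs (hD t ht _ (List.take_prefix _ _))).symm
  · by_cases h : s.length = t.length
    · rw [lexLt_iff_of_length_eq h, lexLt_iff_of_length_eq (by simpa), hmono.lt_iff_lt hs ht]
    · simp [lexLt, h]

include hD in
theorem strictMonoOn_of_preserves {f : List ℕ → List ℕ}
    (hlen : ∀ s ∈ D, (f s).length = s.length)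
    (hpre : ∀ s ∈ D, ∀ t ∈ D, s <+: t ↔ f s <+: f t)
    (hlex : ∀ s ∈ D, ∀ t ∈ D, lexLt s t ↔ lexLt (f s) (f t)) :
    StrictMonoOn f D := by
  intro s hs t ht hst
  by_cases hp : s <+: t
  · refine List.lt_of_prefix_of_ne ((hpre s hs t ht).1 hp) fun h => ?_
    have := congrArg List.length h
    rw [hlen s hs, hlen t ht] at this
    exact hst.ne (hp.eq_of_length this)
  · obtain ⟨i, his, hit, -, hlt⟩ := List.exists_take_succ_lt_of_lt hst hp
    have hs' := hD s hs _ (List.take_prefix (i + 1) _)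
    have ht' := hD t ht _ (List.take_prefix (i + 1) _)
    have hl : (s.take (i + 1)).length = (t.take (i + 1)).length := by simp; omega
    have hfl : (f (s.take (i + 1))).length = (f (t.take (i + 1))).length := by
      rw [hlen _ hs', hlen _ ht', hl]
    refine List.lt_of_prefix_of_prefix_of_lt ?_ hfl
      ((hpre _ hs' s hs).1 (List.take_prefix _ _)) ((hpre _ ht' t ht).1 (List.take_prefix _ _))
    rw [← lexLt_iff_of_length_eq hfl, ← hlex _ hs' _ ht', lexLt_iff_of_length_eq hl]
    exact hlt

include hD in
theorem eq_relabel_getLastD {f : List ℕ → List ℕ}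
    (hlen : ∀ s ∈ D, (f s).length = s.length)
    (hpre : ∀ s ∈ D, ∀ t ∈ D, s <+: t ↔ f s <+: f t) {s : List ℕ} (hs : s ∈ D) :
    f s = relabel (fun t => (f t).getLastD 0) s := by
  refine List.ext_getElem (by simp [hlen s hs]) fun i h₁ h₂ => ?_
  have hs' := hD s hs _ (List.take_prefix (i + 1) _)
  have hi : i < s.length := by rwa [hlen s hs] at h₁
  have hl : (f (s.take (i + 1))).length = i + 1 := by rw [hlen _ hs']; simp; omega
  have hne : f (s.take (i + 1)) ≠ [] := List.ne_nil_of_length_pos (by omega)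
  have hp := (hpre _ hs' s hs).1 (List.take_prefix _ _)
  rw [getElem_relabel, List.getLastD_eq_getLast?, List.getLast?_eq_some_getLast hne,
    Option.getD_some, List.getLast_eq_getElem, hp.getElem]
  simp [hl]

end TreeMaps

theorem length_lt_of_preserves {S : Set (List ℕ)} {f : List ℕ → List ℕ}
    (hpre : ∀ s ∈ S, ∀ t ∈ S, s <+: t ↔ f s <+: f t) (hinj : Set.InjOn f S)
    {s t : List ℕ} (hs : s ∈ S) (ht : t ∈ S) (hp : s <+: t) (hlt : s.length < t.length) :
    (f s).length < (f t).length := by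
  have hf := (hpre s hs t ht).1 hp
  refine lt_of_le_of_ne hf.length_le fun h => ?_
  rw [hinj hs ht (hf.eq_of_length h)] at hlt
  exact lt_irrefl _ hlt

theorem length_eq_of_preserves {n : ℕ} {S : Set (List ℕ)} (hS : IsSubtree n S)
    {f : List ℕ → List ℕ} (hfn : ∀ s ∈ S, (f s).length ≤ n)
    (hpre : ∀ s ∈ S, ∀ t ∈ S, s <+: t ↔ f s <+: f t) (hinj : Set.InjOn f S) :
    ∀ s ∈ S, (f s).length = s.length := by
  have lower : ∀ (d : ℕ) (s : List ℕ), s ∈ S → s.length = d → d ≤ (f s).length := by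
    intro d
    induction d with
    | zero => intros; omega
    | succ d ih =>
      intro s hs hd
      have hp : s.take d <+: s := List.take_prefix _ _
      have hs' := hS.2.1 s hs _ hp
      have hl : (s.take d).length = d := by simp; omega
      have := length_lt_of_preserves hpre hinj hs' hs hp (by omega)
      have := ih _ hs' hl
      omega
  have upper : ∀ (d : ℕ) (s : List ℕ), s ∈ S → s.length + d = n → (f s).length ≤ s.length := by
    intro d
    induction d with
    | zero =>
      intro s hs hd
      have := hfn s hs
      omega
    | succ d ih =>
      intro s hs hd
      obtain ⟨m, hm, hp, hne⟩ : ∃ m ∈ S, s <+: m ∧ m ≠ s := by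
        by_contra! h
        have := hS.2.2 s hs h
        omega
      have hsm : s.length < m.length :=
        lt_of_le_of_ne hp.length_le fun h => hne (hp.eq_of_length h).symm
      have hm' := hS.2.1 m hm _ (List.take_prefix (s.length + 1) m)
      have hl : (m.take (s.length + 1)).length = s.length + 1 := by simp; omega
      have := length_lt_of_preserves hpre hinj hs hm'
        (List.prefix_take_iff.2 ⟨hp, by omega⟩) (by omega)
      have := ih _ hm' (by omega)
      omega
  intro s hs
  have := hS.1 s hs
  exact le_antisymm (upper (n - s.length) s hs (by omega)) (lower _ s hs rfl)

/-- A copy of `S` inside a relabelled tree is itself a relabelling of `S`, by a labelling that is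
increasing for the lexicographic order in which prefixes come first. -/
theorem exists_relabel_of_isTreeCopy {n : ℕ} {S T A : Set (List ℕ)} (hS : IsSubtree n S)
    (hT : IsSubtree n T) {g : List ℕ → ℕ} (hg : StrictMonoOn g (T \ {[]}))
    (hA : IsTreeCopy S A) (hAT : A ⊆ relabel g '' T) :
    ∃ h : List ℕ → ℕ, StrictMonoOn h (S \ {[]}) ∧
      (∀ s ∈ S \ {[]}, h s ∈ g '' (T \ {[]})) ∧ A = relabel h '' S := by
  obtain ⟨f, hbij, hpre, hlex⟩ := hA
  have hmem : ∀ s ∈ S, ∃ t ∈ T, relabel g t = f s := fun s hs => hAT (hbij.mapsTo hs)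
  have hlen := length_eq_of_preserves hS (fun s hs => by
    obtain ⟨t, ht, h⟩ := hmem s hs
    rw [← h, length_relabel]
    exact hT.1 t ht) hpre hbij.injOn
  have key : ∀ s ∈ S \ {[]}, ∃ t ∈ T \ {[]}, relabel g t = f s ∧ (f s).getLastD 0 = g t := by
    rintro s ⟨hs, hne⟩
    obtain ⟨t, ht, h⟩ := hmem s hs
    have htne : t ≠ [] := by
      rintro rfl
      have := hlen s hs
      rw [← h, length_relabel, List.length_nil] at this
      exact hne (List.length_eq_zero_iff.1 this.symm)
    exact ⟨t, ⟨ht, htne⟩, h, by rw [← h, getLastD_relabel g htne]⟩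
  refine ⟨fun s => (f s).getLastD 0, ?_, ?_, ?_⟩
  · intro s hs s' hs' hss'
    obtain ⟨t, ht, h, hl⟩ := key s hs
    obtain ⟨t', ht', h', hl'⟩ := key s' hs'
    have hf := strictMonoOn_of_preserves hS.2.1 hlen hpre hlex hs.1 hs'.1 hss'
    rw [← h, ← h', (strictMonoOn_relabel hT.2.1 hg).lt_iff_lt ht.1 ht'.1] at hf
    simp only [hl, hl']
    exact hg ht ht' hf
  · intro s hs
    obtain ⟨t, ht, -, hl⟩ := key s hs
    exact ⟨t, ht, hl.symm⟩
  · rw [← hbij.image_eq]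
    exact Set.image_congr fun s hs => eq_relabel_getLastD hS.2.1 hlen hpre hs

theorem finite_setOf_length_le_of_lt (n N : ℕ) :
    {l : List ℕ | l.length ≤ n ∧ ∀ x ∈ l, x < N}.Finite := by
  refine ((List.finite_length_le (Fin N) n).image (List.map Fin.val)).subset ?_
  rintro l ⟨hl, hx⟩
  refine ⟨l.pmap (fun x h => ⟨x, h⟩) hx, by simpa using hl, ?_⟩
  simp [List.map_pmap]

theorem isSubtree_setOf_length_le_of_lt (n : ℕ) {N : ℕ} (hN : 0 < N) :
    IsSubtree n {l : List ℕ | l.length ≤ n ∧ ∀ x ∈ l, x < N} := by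
  refine ⟨fun l hl => hl.1, fun l hl p hp =>
    ⟨hp.length_le.trans hl.1, fun x hx => hl.2 x (hp.subset hx)⟩, fun l hl hmax => ?_⟩
  by_contra hne
  have := hmax (l ++ [0]) ⟨by simp; have := hl.1; omega, fun x hx => by
    rcases List.mem_append.1 hx with h | h
    · exact hl.2 x h
    · rwa [List.mem_singleton.1 h]⟩ (List.prefix_append _ _)
  simp at this

/-- Finite Ramsey theorem for subtrees of `ℕ^{≤n}` of height `n`: there is a finite
subtree `U` of `ℕ^{≤n}` of height `n` such that for every `k`-coloring of the copies
of `S` in `U` there is a copy of `T` inside `U` in which all copies of `S` get the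
same color. -/
theorem tree_ramsey_finite
    (n k : ℕ) (hn : 1 ≤ n) (hk : 1 ≤ k)
    (S T : Set (List ℕ)) (hST : S ⊆ T)
    (hSfin : S.Finite) (hTfin : T.Finite)
    (hS : IsSubtree n S) (hT : IsSubtree n T) :
    ∃ U : Set (List ℕ), U.Finite ∧ IsSubtree n U ∧
      ∀ χ : Set (List ℕ) → Fin k,
        ∃ B : Set (List ℕ), B ⊆ U ∧ IsTreeCopy T B ∧
          ∀ A₁ A₂ : Set (List ℕ),
            IsTreeCopy S A₁ → A₁ ⊆ B → IsTreeCopy S A₂ → A₂ ⊆ B → χ A₁ = χ A₂ := by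
  obtain ⟨P, hP⟩ := (hSfin.sdiff (t := {[]})).exists_finset_coe
  obtain ⟨Q, hQ⟩ := (hTfin.sdiff (t := {[]})).exists_finset_coe
  obtain ⟨N, hN⟩ := finite_ramsey k P.card Q.card
  refine ⟨{l | l.length ≤ n ∧ ∀ x ∈ l, x < N + 1}, finite_setOf_length_le_of_lt n (N + 1),
    isSubtree_setOf_length_le_of_lt n N.succ_pos, fun χ => ?_⟩
  have hex : ∀ Y : Finset ℕ, ∃ h : List ℕ → ℕ,
      Y.card = P.card → StrictMonoOn h P ∧ ∀ x ∈ P, h x ∈ Y := by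
    intro Y
    by_cases hY : Y.card = P.card
    · obtain ⟨h, hh⟩ := Finset.exists_strictMonoOn_mapsTo hY
      exact ⟨h, fun _ => hh⟩
    · exact ⟨fun _ => 0, fun h => absurd h hY⟩
  choose lab hlab using hex
  obtain ⟨H, hH, hHc, c, hc⟩ := hN (Finset.range (N + 1)) (by simp)
    (fun Y => χ (relabel (lab Y) '' S))
  obtain ⟨g, hg, hgH⟩ := Finset.exists_strictMonoOn_mapsTo hHc
  have hg' := hg
  rw [hQ] at hg'
  have hgmem : ∀ t ∈ T \ {[]}, g t ∈ H := fun t ht => hgH t (by rwa [← Finset.mem_coe, hQ])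
  refine ⟨relabel g '' T, ?_, isTreeCopy_relabel hT.2.1 hg', ?_⟩
  · rintro _ ⟨t, ht, rfl⟩
    refine ⟨by simpa using hT.1 t ht, fun x hx => ?_⟩
    obtain ⟨i, hi, rfl⟩ := List.getElem_of_mem hx
    rw [length_relabel] at hi
    rw [getElem_relabel]
    exact Finset.mem_range.1 (hH (hgmem _ ⟨hT.2.1 t ht _ (List.take_prefix _ _),
      List.ne_nil_of_length_pos (by simp; omega)⟩))
  · have mono : ∀ A, IsTreeCopy S A → A ⊆ relabel g '' T → χ A = c := by
      intro A hA hAB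
      obtain ⟨h, hh, hhg, rfl⟩ := exists_relabel_of_isTreeCopy hS hT hg' hA hAB
      rw [← hP] at hh hhg
      have hcard : (P.image h).card = P.card := Finset.card_image_of_injOn hh.injOn
      obtain ⟨hl₁, hl₂⟩ := hlab _ hcard
      have heq := hl₁.eqOn_of_mapsTo_of_card hcard hh hl₂
        (fun x hx => Finset.mem_image_of_mem h hx)
      rw [← hc (P.image h) ?_ hcard]
      · congr 1
        refine Set.image_congr fun s hs => relabel_congr fun p hp hne => (heq ?_).symm
        rw [hP]
        exact ⟨hS.2.1 s hs p hp, hne⟩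
      · intro y hy
        obtain ⟨x, hx, rfl⟩ := Finset.mem_image.1 hy
        obtain ⟨t, ht, htx⟩ := hhg x hx
        exact htx ▸ hgmem t ht
    intro A₁ A₂ h₁ hs₁ h₂ hs₂
    rw [mono A₁ h₁ hs₁, mono A₂ h₂ hs₂]
end

section
/- Let S be a countable set of positive reals. The topological group Aut(Q_S, <_lex) of bijective order-preserving self-isometries of (Q_S, <_lex), equipped with the topology of pointwise convergence on the discrete space Q_S, is extremely amenable: every continuous action of this group on a nonempty compact Hausdorff space has a fixed point. -/
/-- The Urysohn ultrametric space `Q_S` : finitely supported functions `S → ℚ`. -/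
def QS (S : Set ℝ) := {x : S → ℚ // {s : S | x s ≠ 0}.Finite}

/-- The distance on `Q_S` : `d x y = max {s ∈ S | x s ≠ y s}` for `x ≠ y`
(and `0` for `x = y`, the supremum of the empty set being `0`). -/
noncomputable def dQ (S : Set ℝ) (x y : S → ℚ) : ℝ :=
  sSup (Subtype.val '' {s : S | x s ≠ y s})

/-- The lexicographical ordering on `Q_S` : `x <lex y` iff `x s < y s` where `s` is the
largest element of `S` at which `x` and `y` differ. -/
def lexQ (S : Set ℝ) (x y : S → ℚ) : Prop :=
  ∃ s : S, x s < y s ∧ ∀ t : S, (s : ℝ) < (t : ℝ) → x t = y t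

/-- The group `Aut(Q_S, <lex)` of bijective order-preserving self-isometries of
`(Q_S, <lex)`. -/
def AutQ (S : Set ℝ) :=
  {g : QS S ≃ QS S //
    (∀ x y, dQ S (g x).1 (g y).1 = dQ S x.1 y.1) ∧
    (∀ x y, lexQ S (g x).1 (g y).1 ↔ lexQ S x.1 y.1)}

instance (S : Set ℝ) : Group (AutQ S) where
  mul g h := ⟨h.1.trans g.1,
    fun x y => by simp only [Equiv.trans_apply]; rw [g.2.1, h.2.1],
    fun x y => by simp only [Equiv.trans_apply]; exact (g.2.2 _ _).trans (h.2.2 _ _)⟩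
  one := ⟨Equiv.refl _, fun x y => rfl, fun x y => Iff.rfl⟩
  inv g := ⟨g.1.symm,
    fun x y => by have := g.2.1 (g.1.symm x) (g.1.symm y); simpa using this.symm,
    fun x y => by have := g.2.2 (g.1.symm x) (g.1.symm y); simpa using this.symm⟩
  mul_assoc a b c := Subtype.ext (Equiv.ext fun x => rfl)
  one_mul a := Subtype.ext (Equiv.ext fun x => rfl)
  mul_one a := Subtype.ext (Equiv.ext fun x => rfl)
  inv_mul_cancel g := Subtype.ext (Equiv.ext fun x => g.1.symm_apply_apply x)

/-- `Q_S` carries the discrete topology. -/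
instance (S : Set ℝ) : TopologicalSpace (QS S) := ⊥

/-- `Aut(Q_S, <lex)` carries the topology of pointwise convergence on the discrete
space `Q_S` (for the group and its inverses). -/
instance (S : Set ℝ) : TopologicalSpace (AutQ S) :=
  TopologicalSpace.induced
    (fun g : AutQ S => ((g.1 : QS S → QS S), (g.1.symm : QS S → QS S)))
    inferInstance

/-- Infinite Ramsey theorem: every finite colouring of the finite subsets of an infinite set of
natural numbers is constant on the `n`-element subsets of some infinite subset. -/
theorem exists_infinite_monochromatic {κ : Type*} [Finite κ] (n : ℕ) (c : Finset ℕ → κ)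
    (M : Set ℕ) (hM : M.Infinite) :
    ∃ H ⊆ M, H.Infinite ∧ ∃ k, ∀ s : Finset ℕ, (s : Set ℕ) ⊆ H → s.card = n → c s = k := by
  induction n generalizing c M with
  | zero => exact ⟨M, subset_rfl, hM, c ∅, fun s _ hs => by rw [Finset.card_eq_zero.1 hs]⟩
  | succ n ih =>
    have step : ∀ A : {A : Set ℕ // A.Infinite}, ∃ B : {A : Set ℕ // A.Infinite}, ∃ m ∈ A.1,
        B.1 ⊆ A.1 ∧ (∀ b ∈ B.1, m < b) ∧ ∃ k, ∀ s : Finset ℕ, (s : Set ℕ) ⊆ B.1 →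
          s.card = n → c (insert m s) = k := by
      intro A
      obtain ⟨m, hm⟩ := A.2.nonempty
      have hinf : (A.1 ∩ Set.Ioi m).Infinite := by
        rw [← Set.sdiff_compl, Set.compl_Ioi]
        exact A.2.sdiff (Set.finite_Iic m)
      obtain ⟨B, hB, hBi, k, hk⟩ := ih (fun s => c (insert m s)) _ hinf
      exact ⟨⟨B, hBi⟩, m, hm, fun b hb => (hB hb).1, fun b hb => (hB hb).2, k, hk⟩
    choose F m hmA hFA hmF k hk using step
    let A : ℕ → {A : Set ℕ // A.Infinite} := fun i => F^[i] ⟨M, hM⟩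
    have hA : ∀ i, A (i + 1) = F (A i) := fun i => Function.iterate_succ_apply' F i _
    have hanti : Antitone fun i => (A i).1 :=
      antitone_nat_of_succ_le fun i => by rw [hA]; exact hFA _
    have hmem : ∀ i j, i < j → m (A j) ∈ (F (A i)).1 := fun i j hij => by
      rw [← hA]; exact hanti (Nat.succ_le_of_lt hij) (hmA _)
    have hmono : StrictMono fun i => m (A i) := fun i j hij => hmF _ _ (hmem i j hij)
    obtain ⟨k₀, hk₀⟩ := Finite.exists_infinite_fiber fun i => k (A i)
    refine ⟨(fun i => m (A i)) '' ((fun i => k (A i)) ⁻¹' {k₀}), ?_,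
      (Set.infinite_coe_iff.1 hk₀).image hmono.injective.injOn, k₀, fun s hs hcard => ?_⟩
    · rintro _ ⟨i, -, rfl⟩
      exact hanti (Nat.zero_le i) (hmA _)
    · have hne : s.Nonempty := Finset.card_pos.1 (by omega)
      obtain ⟨i, hi, him⟩ := hs (s.min'_mem hne)
      have := hk (A i) (s.erase (m (A i))) ?_ ?_
      · rw [Finset.insert_erase (by simpa only [him] using s.min'_mem hne)] at this
        rw [this]; exact hi
      · intro b hb
        have hb := Finset.mem_erase.1 hb
        obtain ⟨j, -, rfl⟩ := hs hb.2
        refine hmem i j (hmono.lt_iff_lt.1 (lt_of_le_of_ne ?_ hb.1.symm))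
        simpa only [him] using s.min'_le _ hb.2
      · rw [Finset.card_erase_of_mem (by simpa only [him] using s.min'_mem hne), hcard]
        rfl

open Order in
/-- Every finite partial isomorphism of a countable dense linear order without endpoints extends
to an automorphism. -/
theorem Order.PartialIso.exists_orderIso {α : Type*} [LinearOrder α] [Countable α]
    [DenselyOrdered α] [NoMinOrder α] [NoMaxOrder α] [Nonempty α] (f : PartialIso α α) :
    ∃ φ : α ≃o α, ∀ p ∈ f.1, φ p.1 = p.2 := by
  cases nonempty_encodable α
  let cofs : α ⊕ α → Cofinal (PartialIso α α) := fun p =>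
    Sum.recOn p (PartialIso.definedAtLeft α) (PartialIso.definedAtRight α)
  let I : Ideal (PartialIso α α) := idealOfCofinals f cofs
  let F a := PartialIso.funOfIdeal a I (cofinal_meets_idealOfCofinals f cofs (Sum.inl a))
  let G b := PartialIso.invOfIdeal b I (cofinal_meets_idealOfCofinals f cofs (Sum.inr b))
  have key : ∀ g ∈ I, ∀ h ∈ I, ∀ p ∈ g.1, ∀ q ∈ h.1, cmp p.1 q.1 = cmp p.2 q.2 := by
    intro g hg h hh p hp q hq
    obtain ⟨m, -, gm, hm⟩ := I.directed _ hg _ hh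
    exact m.2 p (gm hp) q (hm hq)
  refine ⟨OrderIso.ofCmpEqCmp (fun a => (F a).1) (fun b => (G b).1) fun a b => ?_, ?_⟩
  · obtain ⟨g, hg, ha⟩ := (F a).2
    obtain ⟨h, hh, hb⟩ := (G b).2
    exact key g hg h hh _ ha _ hb
  · intro p hp
    obtain ⟨g, hg, ha⟩ := (F p.1).2
    have := key g hg f (mem_idealOfCofinals f cofs) _ ha p hp
    rw [cmp_self_eq_eq, eq_comm, cmp_eq_eq_iff] at this
    exact this

/-- Finite subsets of `ℚ` of the same size are related by an order automorphism of `ℚ`. -/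
theorem exists_orderIso_image_eq {A B : Finset ℚ} (h : B.card = A.card) :
    ∃ φ : ℚ ≃o ℚ, B.image φ = A := by
  obtain ⟨φ, hφ⟩ := Order.PartialIso.exists_orderIso (α := ℚ)
    ⟨Finset.univ.image fun i : Fin A.card => (B.orderEmbOfFin h i, A.orderEmbOfFin rfl i), by
      simp only [Finset.mem_image, Finset.mem_univ, true_and, forall_exists_index,
        forall_apply_eq_imp_iff]
      intro i j
      rw [(B.orderEmbOfFin h).strictMono.cmp_map_eq, (A.orderEmbOfFin rfl).strictMono.cmp_map_eq]⟩
  refine ⟨φ, Finset.eq_of_subset_of_card_le ?_ ?_⟩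
  · intro x hx
    obtain ⟨b, hb, rfl⟩ := Finset.mem_image.1 hx
    rw [← Finset.mem_coe, ← Finset.range_orderEmbOfFin B h] at hb
    obtain ⟨i, rfl⟩ := hb
    rw [hφ (_, A.orderEmbOfFin rfl i) (Finset.mem_image_of_mem _ (Finset.mem_univ i))]
    exact Finset.orderEmbOfFin_mem _ _ _
  · rw [Finset.card_image_of_injective _ φ.injective, h]

/-- An order automorphism preserving a finite set fixes it pointwise. -/
theorem OrderIso.apply_eq_of_mapsTo_finset {α : Type*} [LinearOrder α] (φ : α ≃o α)
    {A : Finset α} (h : ∀ a ∈ A, φ a ∈ A) : ∀ a ∈ A, φ a = a := by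
  intro a ha
  rw [← Finset.mem_coe, ← Finset.range_orderEmbOfFin A rfl] at ha
  obtain ⟨i, rfl⟩ := ha
  exact congrFun (Finset.orderEmbOfFin_unique rfl
    (f := fun i => φ (A.orderEmbOfFin rfl i)) (fun i => h _ (Finset.orderEmbOfFin_mem _ _ _))
    (φ.strictMono.comp (A.orderEmbOfFin rfl).strictMono)) i

/-- A subgroup `H` has the fixed point property on the `G`-space `X` if every nonempty closed
`H`-invariant subset of `X` contains a point fixed by `H`. -/
def HasFixedPoints {G : Type*} (X : Type*) [Group G] [TopologicalSpace X] [MulAction G X]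
    (H : Subgroup G) : Prop :=
  ∀ C : Set X, IsClosed C → C.Nonempty → (∀ h ∈ H, ∀ x ∈ C, h • x ∈ C) →
    ∃ x ∈ C, ∀ h ∈ H, h • x = x

namespace HasFixedPoints

variable {G X : Type*} [Group G] [TopologicalSpace X] [MulAction G X]

theorem bot : HasFixedPoints X (⊥ : Subgroup G) := by
  rintro C - ⟨x, hx⟩ -
  refine ⟨x, hx, fun h hh => ?_⟩
  rw [Subgroup.mem_bot.1 hh, one_smul]

variable [T2Space X] [ContinuousConstSMul G X]

theorem isClosed_setOf_fixed {C : Set X} (hC : IsClosed C) (H : Subgroup G) :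
    IsClosed {x ∈ C | ∀ h ∈ H, h • x = x} := by
  have : {x ∈ C | ∀ h ∈ H, h • x = x} = C ∩ ⋂ h ∈ H, {x | h • x = x} := by ext; simp
  rw [this]
  exact hC.inter (isClosed_biInter fun h _ => isClosed_eq (continuous_const_smul h) continuous_id)

theorem sup {K H : Subgroup G} (hK : HasFixedPoints X K) (hH : HasFixedPoints X H)
    (hn : H ≤ Subgroup.normalizer (K : Set G)) : HasFixedPoints X (K ⊔ H) := by
  intro C hC hne hinv
  obtain ⟨x, ⟨hxC, hxK⟩, hxH⟩ := hH {x ∈ C | ∀ h ∈ K, h • x = x} (isClosed_setOf_fixed hC K)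
    (hK C hC hne fun h hh => hinv h (Subgroup.mem_sup_left hh)) (by
      rintro h hh x ⟨hxC, hx⟩
      refine ⟨hinv h (Subgroup.mem_sup_right hh) x hxC, fun k hk => ?_⟩
      have := hx (h⁻¹ * k * h) ((Subgroup.mem_normalizer_iff''.1 (hn hh) k).1 hk)
      rwa [mul_smul, mul_smul, inv_smul_eq_iff] at this)
  have : K ⊔ H ≤ MulAction.stabilizer G x := sup_le hxK hxH
  exact ⟨x, hxC, this⟩

theorem iSup_of_directed [CompactSpace X] {ι : Type*} [Nonempty ι] {H : ι → Subgroup G}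
    (hd : Directed (· ≤ ·) H) (hH : ∀ i, HasFixedPoints X (H i)) :
    HasFixedPoints X (⨆ i, H i) := by
  intro C hC hne hinv
  have hcl := fun i => isClosed_setOf_fixed hC (H i)
  obtain ⟨x, hx⟩ := IsCompact.nonempty_iInter_of_directed_nonempty_isCompact_isClosed
    (fun i => {x ∈ C | ∀ h ∈ H i, h • x = x})
    (fun i j => (hd i j).imp fun k hk =>
      ⟨fun x hx => ⟨hx.1, fun h hh => hx.2 h (hk.1 hh)⟩,
        fun x hx => ⟨hx.1, fun h hh => hx.2 h (hk.2 hh)⟩⟩)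
    (fun i => hH i C hC hne fun h hh => hinv h (le_iSup H i hh))
    (fun i => (hcl i).isCompact) hcl
  rw [Set.mem_iInter] at hx
  have : ⨆ i, H i ≤ MulAction.stabilizer G x := iSup_le fun i => (hx i).2
  exact ⟨x, (hx (Classical.arbitrary ι)).1, this⟩

theorem iSup_of_finset [CompactSpace X] {ι : Type*} {H : ι → Subgroup G}
    (hH : ∀ F : Finset ι, HasFixedPoints X (⨆ i ∈ F, H i)) : HasFixedPoints X (⨆ i, H i) := by
  classical
  rw [iSup_eq_iSup_finset]
  refine iSup_of_directed (directed_of_isDirected_le fun F F' h => ?_) hH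
  exact biSup_mono fun i hi => h hi

end HasFixedPoints

theorem Subgroup.le_normalizer_of_conj_mem {G : Type*} [Group G] {H K : Subgroup G}
    (h : ∀ g ∈ H, ∀ k ∈ K, g * k * g⁻¹ ∈ K) : H ≤ Subgroup.normalizer (K : Set G) := by
  intro g hg
  refine Subgroup.mem_normalizer_iff.2 fun k => ⟨h g hg k, fun hk => ?_⟩
  simpa [mul_assoc] using h g⁻¹ (inv_mem hg) _ hk

theorem Subgroup.le_normalizer_iSup {G : Type*} [Group G] {ι : Sort*} {H : Subgroup G}
    {K : ι → Subgroup G} (h : ∀ i, ∀ g ∈ H, ∀ k ∈ K i, g * k * g⁻¹ ∈ ⨆ i, K i) :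
    H ≤ Subgroup.normalizer ((⨆ i, K i : Subgroup G) : Set G) := by
  refine Subgroup.le_normalizer_of_conj_mem fun g hg k hk => ?_
  have : ⨆ i, K i ≤ (⨆ i, K i).comap (MulAut.conj g).toMonoidHom :=
    iSup_le fun i k hk => h i g hg k hk
  exact this hk

theorem Subgroup.le_normalizer_iSup_of_le {G : Type*} [Group G] {ι : Sort*} {H : Subgroup G}
    {K : ι → Subgroup G} (h : ∀ i, H ≤ Subgroup.normalizer (K i : Set G)) :
    H ≤ Subgroup.normalizer ((⨆ i, K i : Subgroup G) : Set G) :=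
  Subgroup.le_normalizer_iSup fun i _ hg k hk =>
    Subgroup.mem_iSup_of_mem i ((Subgroup.mem_normalizer_iff.1 (h i hg) k).1 hk)

open Uniformity in
/-- Extreme amenability of `Aut(ℚ, <)`, for actions through a homomorphism. -/
theorem HasFixedPoints.range_of_rat {G X : Type*} [Group G] [UniformSpace X] [CompactSpace X]
    [T2Space X] [MulAction G X] [ContinuousConstSMul G X] (N : (ℚ ≃o ℚ) →* G)
    (hN : ∀ W ∈ 𝓤 X, ∃ A : Finset ℚ, ∀ φ : ℚ ≃o ℚ, (∀ a ∈ A, φ a = a) →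
      ∀ x : X, (N φ • x, x) ∈ W) :
    HasFixedPoints X N.range := by
  rintro C hC ⟨x₀, hx₀⟩ hinv
  have approx : ∀ W ∈ 𝓤 X, ∀ F : Finset (ℚ ≃o ℚ), ∃ x ∈ C, ∀ h ∈ F, (N h • x, x) ∈ W := by
    classical
    intro W hW F
    obtain ⟨V', hV', hV's, hVW⟩ := comp_symm_mem_uniformity_sets hW
    obtain ⟨V, hV, hVs, hVV⟩ := comp_symm_mem_uniformity_sets hV'
    obtain ⟨A, hA⟩ := hN V hV
    obtain ⟨t, htf, ht⟩ := (isCompact_univ (X := X)).totallyBounded V hV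
    have hcol : ∀ B : Finset ℕ, ∃ y : t, ∃ φ : ℚ ≃o ℚ, B.card = A.card →
        (B.image ((↑) : ℕ → ℚ)).image φ = A ∧ (N φ • x₀, y.1) ∈ V := by
      intro B
      have hy : ∀ x : X, ∃ y : t, (x, y.1) ∈ V := fun x => by
        simpa using ht (Set.mem_univ x)
      by_cases hB : B.card = A.card
      · obtain ⟨φ, hφ⟩ := exists_orderIso_image_eq (A := A) (B := B.image ((↑) : ℕ → ℚ))
          (by rw [Finset.card_image_of_injective _ Nat.cast_injective, hB])
        obtain ⟨y, hy⟩ := hy (N φ • x₀)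
        exact ⟨y, φ, fun _ => ⟨hφ, hy⟩⟩
      · obtain ⟨y, -⟩ := hy x₀
        exact ⟨y, 1, fun h => absurd h hB⟩
    choose col ψ hψ using hcol
    have := htf.to_subtype
    obtain ⟨H, -, hH, k, hk⟩ := exists_infinite_monochromatic A.card col Set.univ Set.infinite_univ
    let A' : Finset ℚ := (insert 1 F).biUnion fun h => A.image h.symm
    obtain ⟨B', hB'H, hB'⟩ := hH.exists_subset_card_eq A'.card
    obtain ⟨φ, hφ⟩ := exists_orderIso_image_eq (A := A') (B := B'.image ((↑) : ℕ → ℚ))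
      (by rw [Finset.card_image_of_injective _ Nat.cast_injective, hB'])
    have near : ∀ h ∈ insert 1 F, (N h • N φ • x₀, (k : X)) ∈ V' := by
      intro h hh
      let B : Finset ℕ := B'.filter fun b : ℕ => h (φ (b : ℚ)) ∈ A
      have hBA : (B.image ((↑) : ℕ → ℚ)).image (h * φ) = A := by
        ext a
        simp only [B, Finset.mem_image, Finset.mem_filter, RelIso.mul_apply]
        constructor
        · rintro ⟨_, ⟨b, hb, rfl⟩, rfl⟩
          exact hb.2
        · intro ha
          have : h.symm a ∈ (B'.image ((↑) : ℕ → ℚ)).image φ := by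
            rw [hφ]
            exact Finset.mem_biUnion.2 ⟨h, hh, Finset.mem_image_of_mem _ ha⟩
          simp only [Finset.mem_image] at this
          obtain ⟨_, ⟨b, hb, rfl⟩, hba⟩ := this
          have hab : h (φ b) = a := by rw [hba, OrderIso.apply_symm_apply]
          exact ⟨b, ⟨b, ⟨hb, hab ▸ ha⟩, rfl⟩, hab⟩
      have hBc : B.card = A.card := by
        rw [← hBA, Finset.card_image_of_injective _ (h * φ).injective,
          Finset.card_image_of_injective _ Nat.cast_injective]
      obtain ⟨h1, h2⟩ := hψ B hBc
      have hcolB : col B = k := hk B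
        (subset_trans (Finset.coe_subset.2 (Finset.filter_subset _ _)) hB'H) hBc
      rw [hcolB] at h2
      have hfix := OrderIso.apply_eq_of_mapsTo_finset (A := A) (h * φ * (ψ B)⁻¹) (by
        intro a ha
        rw [← h1] at ha
        obtain ⟨b, hb, rfl⟩ := Finset.mem_image.1 ha
        rw [← hBA, RelIso.mul_apply, RelIso.inv_apply_self]
        exact Finset.mem_image_of_mem _ hb)
      have h3 := hA _ hfix (N (ψ B) • x₀)
      rw [map_mul, map_mul, map_inv, mul_smul, inv_smul_smul, mul_smul] at h3
      exact hVV (SetRel.prodMk_mem_comp h3 h2)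
    refine ⟨N φ • x₀, hinv _ ⟨φ, rfl⟩ _ hx₀, fun h hh => ?_⟩
    have h1 := near h (Finset.mem_insert_of_mem hh)
    have h2 := near 1 (Finset.mem_insert_self _ _)
    rw [map_one, one_smul] at h2
    exact hVW (SetRel.prodMk_mem_comp h1 (hV's.symm _ _ h2))
  obtain ⟨x, hxC, hx⟩ := hC.isCompact.inter_iInter_nonempty
    (fun i : (ℚ ≃o ℚ) × {W : Set (X × X) // W ∈ 𝓤 X ∧ IsClosed W} =>
      {x | (N i.1 • x, x) ∈ i.2.1})
    (fun i => i.2.2.2.preimage ((continuous_const_smul _).prodMk continuous_id)) (by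
      classical
      intro u
      obtain ⟨x, hxC, hx⟩ := approx (⋂ i ∈ u, i.2.1)
        ((Filter.biInter_finset_mem u).2 fun i _ => i.2.2.1) (u.image Prod.fst)
      refine ⟨x, hxC, Set.mem_iInter₂.2 fun i hi => ?_⟩
      exact Set.mem_iInter₂.1 (hx i.1 (Finset.mem_image_of_mem _ hi)) i hi)
  refine ⟨x, hxC, ?_⟩
  rintro _ ⟨φ, rfl⟩
  exact eq_of_uniformity_basis uniformity_hasBasis_closed fun {W} hW =>
    Set.mem_iInter.1 hx (φ, ⟨W, hW⟩)

namespace QS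

variable {S : Set ℝ}

theorem ext {x y : QS S} (h : ∀ t, x.1 t = y.1 t) : x = y := Subtype.ext (funext h)

/-- `x` and `y` have the same coordinates above `s`. -/
def AgreeAbove (s : S) (x y : QS S) : Prop := ∀ t : S, s < t → x.1 t = y.1 t

theorem AgreeAbove.refl (s : S) (x : QS S) : AgreeAbove s x x := fun _ _ => rfl

theorem AgreeAbove.symm {s : S} {x y : QS S} (h : AgreeAbove s x y) : AgreeAbove s y x :=
  fun t ht => (h t ht).symm

theorem AgreeAbove.trans {s : S} {x y z : QS S} (h : AgreeAbove s x y) (h' : AgreeAbove s y z) :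
    AgreeAbove s x z :=
  fun t ht => (h t ht).trans (h' t ht)

theorem AgreeAbove.mono {s t : S} {x y : QS S} (h : AgreeAbove s x y) (hst : s ≤ t) :
    AgreeAbove t x y :=
  fun r hr => h r (hst.trans_lt hr)

/-- `s` is the largest coordinate at which `x` and `y` differ, and `x s < y s`. -/
def LexAt (s : S) (x y : QS S) : Prop := x.1 s < y.1 s ∧ AgreeAbove s x y

theorem LexAt.dQ_eq {s : S} {x y : QS S} (h : LexAt s x y) : dQ S x.1 y.1 = s := by
  refine IsGreatest.csSup_eq ⟨⟨s, h.1.ne, rfl⟩, ?_⟩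
  rintro _ ⟨t, ht, rfl⟩
  exact not_lt.1 fun hst => ht (h.2 t hst)

theorem dQ_comm (x y : QS S) : dQ S x.1 y.1 = dQ S y.1 x.1 := by
  simp only [dQ, ne_comm]

theorem lexAt_iff {s : S} {x y : QS S} :
    LexAt s x y ↔ lexQ S x.1 y.1 ∧ dQ S x.1 y.1 = s := by
  constructor
  · exact fun h => ⟨⟨s, h⟩, h.dQ_eq⟩
  · rintro ⟨⟨t, ht⟩, hd⟩
    have ht : LexAt t x y := ht
    rw [ht.dQ_eq] at hd
    rwa [← Subtype.ext hd]

theorem finite_ne (x y : QS S) : {t | x.1 t ≠ y.1 t}.Finite := by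
  refine (x.2.union y.2).subset fun t ht => ?_
  by_contra h
  simp only [Set.mem_union, Set.mem_ofPred_eq, not_or, not_not] at h
  exact ht (h.1.trans h.2.symm)

/-- The points `x` and `y` agree above `s` unless they first differ at a coordinate above `s`. -/
theorem agreeAbove_iff {s : S} {x y : QS S} :
    AgreeAbove s x y ↔ ∀ t, s < t → ¬ LexAt t x y ∧ ¬ LexAt t y x := by
  constructor
  · exact fun h t ht => ⟨fun h' => h'.1.ne (h t ht), fun h' => h'.1.ne' (h t ht)⟩
  · intro h
    by_contra hn
    simp only [AgreeAbove, not_forall] at hn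
    obtain ⟨r, hsr, hr⟩ := hn
    obtain ⟨t, ht, hmax⟩ := (finite_ne x y).exists_maximal ⟨r, hr⟩
    have hagree : AgreeAbove t x y := fun u hu => by
      by_contra hne
      exact hu.not_ge (hmax hne hu.le)
    have hst : s < t := by
      by_contra hts
      exact hr (hagree r ((not_lt.1 hts).trans_lt hsr))
    rcases lt_or_gt_of_ne (show x.1 t ≠ y.1 t from ht) with hlt | hlt
    · exact (h t hst).1 ⟨hlt, hagree⟩
    · exact (h t hst).2 ⟨hlt, hagree.symm⟩

theorem exists_lexAt_of_ne {x y : QS S} (h : x ≠ y) : ∃ s, LexAt s x y ∨ LexAt s y x := by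
  by_contra! hn
  refine h (ext fun t => ?_)
  have := (agreeAbove_iff (s := t)).2 fun r _ => hn r
  by_contra hne
  rcases lt_or_gt_of_ne hne with hlt | hlt
  · exact (hn t).1 ⟨hlt, this⟩
  · exact (hn t).2 ⟨hlt, this.symm⟩

/-- A permutation preserving each relation `LexAt s` is an automorphism of `(Q_S, <lex)`. -/
def mkAut (g : QS S ≃ QS S) (hg : ∀ s x y, LexAt s (g x) (g y) ↔ LexAt s x y) : AutQ S :=
  ⟨g, fun x y => by
    by_cases hxy : x = y
    · simp [hxy, dQ]
    · obtain ⟨s, hs | hs⟩ := exists_lexAt_of_ne hxy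
      · rw [hs.dQ_eq, ((hg s x y).2 hs).dQ_eq]
      · rw [dQ_comm, dQ_comm x, hs.dQ_eq, ((hg s y x).2 hs).dQ_eq],
    fun x y => exists_congr fun s => hg s x y⟩

theorem lexAt_aut_iff (g : AutQ S) (s : S) (x y : QS S) :
    LexAt s (g.1 x) (g.1 y) ↔ LexAt s x y := by
  rw [lexAt_iff, lexAt_iff, g.2.1, g.2.2]

theorem agreeAbove_aut_iff (g : AutQ S) (s : S) (x y : QS S) :
    AgreeAbove s (g.1 x) (g.1 y) ↔ AgreeAbove s x y := by
  simp only [agreeAbove_iff, lexAt_aut_iff]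

/-- Replace the coordinate `s` of `x` by `q`. -/
noncomputable def setCoord (x : QS S) (s : S) (q : ℚ) : QS S :=
  ⟨Function.update x.1 s q, (x.2.insert s).subset fun t ht => by
    by_cases hts : t = s
    · exact Or.inl hts
    · right
      simpa only [Set.mem_ofPred_eq, Function.update_of_ne hts] using ht⟩

open Classical in
/-- Apply `φ` to the coordinate `s` of all points which agree with `y` above `s`. -/
noncomputable def nodeFun (s : S) (y : QS S) (φ : ℚ ≃o ℚ) (x : QS S) : QS S :=
  if AgreeAbove s x y then x.setCoord s (φ (x.1 s)) else x

theorem nodeFun_of_agreeAbove {s : S} {y x : QS S} (h : AgreeAbove s x y) (φ : ℚ ≃o ℚ) :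
    nodeFun s y φ x = x.setCoord s (φ (x.1 s)) := if_pos h

theorem nodeFun_of_not {s : S} {y x : QS S} (h : ¬ AgreeAbove s x y) (φ : ℚ ≃o ℚ) :
    nodeFun s y φ x = x := if_neg h

theorem nodeFun_apply_self {s : S} {y x : QS S} (h : AgreeAbove s x y) (φ : ℚ ≃o ℚ) :
    (nodeFun s y φ x).1 s = φ (x.1 s) := by
  rw [nodeFun_of_agreeAbove h]
  exact Function.update_self ..

theorem nodeFun_apply_ne {s t : S} (h : t ≠ s) (y x : QS S) (φ : ℚ ≃o ℚ) :
    (nodeFun s y φ x).1 t = x.1 t := by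
  by_cases hx : AgreeAbove s x y
  · rw [nodeFun_of_agreeAbove hx]
    exact Function.update_of_ne h ..
  · rw [nodeFun_of_not hx]

theorem agreeAbove_nodeFun {s t : S} (h : s ≤ t) (y x : QS S) (φ : ℚ ≃o ℚ) :
    AgreeAbove t (nodeFun s y φ x) x :=
  fun _ hr => nodeFun_apply_ne (h.trans_lt hr).ne' ..

theorem agreeAbove_nodeFun_iff {s t : S} (h : s ≤ t) (y x z : QS S) (φ : ℚ ≃o ℚ) :
    AgreeAbove t (nodeFun s y φ x) z ↔ AgreeAbove t x z :=
  ⟨(agreeAbove_nodeFun h y x φ).symm.trans, (agreeAbove_nodeFun h y x φ).trans⟩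

theorem nodeFun_one (s : S) (y x : QS S) : nodeFun s y 1 x = x := by
  by_cases h : AgreeAbove s x y
  · refine ext fun t => ?_
    by_cases hts : t = s
    · subst hts
      rw [nodeFun_apply_self h, RelIso.one_apply]
    · rw [nodeFun_apply_ne hts]
  · exact nodeFun_of_not h _

theorem nodeFun_mul (s : S) (y x : QS S) (φ ψ : ℚ ≃o ℚ) :
    nodeFun s y (φ * ψ) x = nodeFun s y φ (nodeFun s y ψ x) := by
  by_cases h : AgreeAbove s x y
  · refine ext fun t => ?_
    by_cases hts : t = s
    · subst hts
      rw [nodeFun_apply_self h, nodeFun_apply_self ((agreeAbove_nodeFun_iff le_rfl ..).2 h),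
        nodeFun_apply_self h, RelIso.mul_apply]
    · rw [nodeFun_apply_ne hts, nodeFun_apply_ne hts, nodeFun_apply_ne hts]
  · rw [nodeFun_of_not h, nodeFun_of_not h, nodeFun_of_not h]

theorem nodeFun_congr {s : S} {y z : QS S} (h : AgreeAbove s y z) :
    nodeFun s y = nodeFun s z := by
  funext φ x
  by_cases hx : AgreeAbove s x y
  · rw [nodeFun_of_agreeAbove hx, nodeFun_of_agreeAbove (hx.trans h)]
  · rw [nodeFun_of_not hx, nodeFun_of_not fun hz => hx (hz.trans h.symm)]

theorem LexAt.nodeFun {r : S} {x x' : QS S} (h : LexAt r x x') (s : S) (y : QS S)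
    (φ : ℚ ≃o ℚ) : LexAt r (nodeFun s y φ x) (nodeFun s y φ x') := by
  have key : ∀ t, r ≤ t →
      (x.1 t = x'.1 t → (QS.nodeFun s y φ x).1 t = (QS.nodeFun s y φ x').1 t) ∧
      (x.1 t < x'.1 t → (QS.nodeFun s y φ x).1 t < (QS.nodeFun s y φ x').1 t) := by
    intro t hrt
    by_cases hts : t = s
    · subst hts
      have hx : AgreeAbove t x x' := h.2.mono hrt
      by_cases hy : AgreeAbove t x y
      · rw [nodeFun_apply_self hy, nodeFun_apply_self (hx.symm.trans hy)]
        exact ⟨congrArg φ, fun h => φ.strictMono h⟩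
      · rw [nodeFun_of_not hy, nodeFun_of_not fun h => hy (hx.trans h)]
        exact ⟨id, id⟩
    · rw [nodeFun_apply_ne hts, nodeFun_apply_ne hts]
      exact ⟨id, id⟩
  exact ⟨(key r le_rfl).2 h.1, fun t ht => (key t ht.le).1 (h.2 t ht)⟩

theorem nodeFun_inv_nodeFun (s : S) (y x : QS S) (φ : ℚ ≃o ℚ) :
    nodeFun s y φ⁻¹ (nodeFun s y φ x) = x := by
  rw [← nodeFun_mul, inv_mul_cancel, nodeFun_one]

theorem nodeFun_nodeFun_inv (s : S) (y x : QS S) (φ : ℚ ≃o ℚ) :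
    nodeFun s y φ (nodeFun s y φ⁻¹ x) = x := by
  rw [← nodeFun_mul, mul_inv_cancel, nodeFun_one]

/-- The action of `Aut(ℚ, <)` on the coordinate `s` of the points which agree with `y` above
`s`. -/
noncomputable def nodeHom (s : S) (y : QS S) : (ℚ ≃o ℚ) →* AutQ S where
  toFun φ := mkAut ⟨nodeFun s y φ, nodeFun s y φ⁻¹, fun x => nodeFun_inv_nodeFun s y x φ,
    fun x => nodeFun_nodeFun_inv s y x φ⟩ fun r x x' =>
      ⟨fun h => by simpa [nodeFun_inv_nodeFun] using h.nodeFun s y φ⁻¹, fun h => h.nodeFun s y φ⟩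
  map_one' := Subtype.ext (Equiv.ext fun x => nodeFun_one s y x)
  map_mul' φ ψ := Subtype.ext (Equiv.ext fun x => nodeFun_mul s y x φ ψ)

theorem nodeHom_apply (s : S) (y : QS S) (φ : ℚ ≃o ℚ) (x : QS S) :
    (nodeHom s y φ).1 x = nodeFun s y φ x := rfl

theorem mul_apply (g h : AutQ S) (x : QS S) : (g * h).1 x = g.1 (h.1 x) := rfl

theorem nodeHom_congr {s : S} {y z : QS S} (h : AgreeAbove s y z) : nodeHom s y = nodeHom s z :=
  MonoidHom.ext fun φ => Subtype.ext (Equiv.ext fun x => by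
    rw [nodeHom_apply, nodeHom_apply, nodeFun_congr h])

theorem nodeHom_commute {s : S} {y z : QS S} (h : ¬ AgreeAbove s y z) (φ ψ : ℚ ≃o ℚ) :
    nodeHom s y φ * nodeHom s z ψ = nodeHom s z ψ * nodeHom s y φ := by
  refine Subtype.ext (Equiv.ext fun x => ?_)
  simp only [mul_apply, nodeHom_apply]
  by_cases hy : AgreeAbove s x y
  · have hz : ¬ AgreeAbove s x z := fun hz => h (hy.symm.trans hz)
    rw [nodeFun_of_not hz, nodeFun_of_not fun h' => hz ((agreeAbove_nodeFun_iff le_rfl ..).1 h')]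
  · rw [nodeFun_of_not hy, nodeFun_of_not fun h' => hy ((agreeAbove_nodeFun_iff le_rfl ..).1 h')]

theorem nodeHom_mul_nodeHom {s t : S} (hst : s < t) (y z : QS S) (φ ψ : ℚ ≃o ℚ) :
    nodeHom t z φ * nodeHom s y ψ = nodeHom s (nodeFun t z φ y) ψ * nodeHom t z φ := by
  refine Subtype.ext (Equiv.ext fun x => ?_)
  simp only [mul_apply, nodeHom_apply]
  have hagree : AgreeAbove s (nodeFun t z φ x) (nodeFun t z φ y) ↔ AgreeAbove s x y :=
    agreeAbove_aut_iff (nodeHom t z φ) s x y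
  by_cases h : AgreeAbove s x y
  · refine ext fun r => ?_
    by_cases hrt : r = t
    · subst hrt
      rw [nodeFun_apply_ne hst.ne']
      by_cases hz : AgreeAbove r x z
      · rw [nodeFun_apply_self ((agreeAbove_nodeFun_iff hst.le ..).2 hz), nodeFun_apply_self hz,
          nodeFun_apply_ne hst.ne']
      · rw [nodeFun_of_not hz, nodeFun_of_not fun h' => hz ((agreeAbove_nodeFun_iff hst.le ..).1 h'),
          nodeFun_apply_ne hst.ne']
    · rw [nodeFun_apply_ne hrt]
      by_cases hrs : r = s
      · subst hrs
        rw [nodeFun_apply_self h, nodeFun_apply_self (hagree.2 h), nodeFun_apply_ne hrt]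
      · rw [nodeFun_apply_ne hrs, nodeFun_apply_ne hrs, nodeFun_apply_ne hrt]
  · rw [nodeFun_of_not h, nodeFun_of_not fun h' => h (hagree.1 h')]

/-- The automorphisms generated by those changing only the coordinate `s`, below finitely many
nodes. -/
noncomputable def level (s : S) : Subgroup (AutQ S) := ⨆ y, (nodeHom s y).range

theorem range_nodeHom_le_normalizer (s : S) (y z : QS S) :
    (nodeHom s z).range ≤ Subgroup.normalizer ((nodeHom s y).range : Set (AutQ S)) := by
  by_cases h : AgreeAbove s y z
  · rw [nodeHom_congr h]
    exact Subgroup.le_normalizer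
  · refine Subgroup.le_normalizer_of_conj_mem ?_
    rintro _ ⟨φ, rfl⟩ _ ⟨ψ, rfl⟩
    rw [← nodeHom_commute h, mul_inv_cancel_right]
    exact ⟨ψ, rfl⟩

theorem level_le_normalizer {s t : S} (hst : s < t) :
    level t ≤ Subgroup.normalizer (level s : Set (AutQ S)) := by
  refine iSup_le fun z => Subgroup.le_normalizer_iSup ?_
  rintro y _ ⟨φ, rfl⟩ _ ⟨ψ, rfl⟩
  rw [nodeHom_mul_nodeHom hst, mul_inv_cancel_right]
  exact Subgroup.mem_iSup_of_mem _ ⟨ψ, rfl⟩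

/-- Finite families in `Q_S` of the same lexicographic type are related by an element of the group
generated by the levels. -/
theorem exists_mem_iSup_level {ι : Type*} [Finite ι] (u v : ι → QS S)
    (h : ∀ s i j, LexAt s (u i) (u j) ↔ LexAt s (v i) (v j)) :
    ∃ w ∈ ⨆ s : S, level s, ∀ i, w.1 (u i) = v i := by
  have hfin : ∀ u : ι → QS S, {p : ι × S | (u p.1).1 p.2 ≠ (v p.1).1 p.2}.Finite := by
    intro u
    have : {p : ι × S | (u p.1).1 p.2 ≠ (v p.1).1 p.2} ⊆
        ⋃ i, Prod.mk i '' {t | (u i).1 t ≠ (v i).1 t} := by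
      rintro ⟨i, t⟩ hit
      exact Set.mem_iUnion.2 ⟨i, t, hit, rfl⟩
    exact (Set.finite_iUnion fun i => (finite_ne _ _).image _).subset this
  induction hn : {p : ι × S | (u p.1).1 p.2 ≠ (v p.1).1 p.2}.ncard
    using Nat.strong_induction_on generalizing u with
  | _ n ih =>
    rcases Set.eq_empty_or_nonempty {p : ι × S | (u p.1).1 p.2 ≠ (v p.1).1 p.2} with he | hne
    · refine ⟨1, one_mem _, fun i => ext fun t => ?_⟩
      by_contra hit
      exact Set.eq_empty_iff_forall_notMem.1 he (i, t) hit
    obtain ⟨⟨i₀, s⟩, hi₀, hmax⟩ := Set.exists_max_image _ Prod.snd (hfin u) hne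
    have habove : ∀ i, AgreeAbove s (u i) (v i) := fun i t ht => by
      by_contra hit
      exact ht.not_ge (hmax (i, t) hit)
    classical
    have := Fintype.ofFinite ι
    have hlt : ∀ i j, AgreeAbove s (u i) (u j) →
        ((u i).1 s < (u j).1 s ↔ (v i).1 s < (v j).1 s) := by
      intro i j hij
      have h1 : LexAt s (u i) (u j) ↔ (u i).1 s < (u j).1 s := and_iff_left hij
      have h2 : LexAt s (v i) (v j) ↔ (v i).1 s < (v j).1 s :=
        and_iff_left ((habove i).symm.trans (hij.trans (habove j)))
      rw [← h1, ← h2, h]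
    obtain ⟨φ, hφ⟩ := Order.PartialIso.exists_orderIso (α := ℚ)
      ⟨(Finset.univ.filter fun i => AgreeAbove s (u i) (u i₀)).image
        fun i => ((u i).1 s, (v i).1 s), by
        simp only [Finset.mem_image, Finset.mem_filter, Finset.mem_univ, true_and]
        rintro _ ⟨i, hi, rfl⟩ _ ⟨j, hj, rfl⟩
        have h1 := hlt i j (hi.trans hj.symm)
        have h2 := hlt j i (hj.trans hi.symm)
        rcases lt_trichotomy ((u i).1 s) ((u j).1 s) with h3 | h3 | h3
        · rw [cmp_eq_lt_iff _ _ |>.2 h3, cmp_eq_lt_iff _ _ |>.2 (h1.1 h3)]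
        · have : (v i).1 s = (v j).1 s := le_antisymm
            (not_lt.1 fun h4 => h3.not_gt (h2.2 h4)) (not_lt.1 fun h4 => h3.not_lt (h1.2 h4))
          rw [cmp_eq_eq_iff _ _ |>.2 h3, cmp_eq_eq_iff _ _ |>.2 this]
        · rw [cmp_eq_gt_iff _ _ |>.2 h3, cmp_eq_gt_iff _ _ |>.2 (h2.1 h3)]⟩
    have hφ' : ∀ i, AgreeAbove s (u i) (u i₀) → φ ((u i).1 s) = (v i).1 s := fun i hi =>
      hφ ((u i).1 s, (v i).1 s) (Finset.mem_image_of_mem _ (by simpa using hi))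
    set w₀ := nodeHom s (u i₀) φ with hw₀
    have hss : {p : ι × S | (w₀.1 (u p.1)).1 p.2 ≠ (v p.1).1 p.2} ⊂
        {p : ι × S | (u p.1).1 p.2 ≠ (v p.1).1 p.2} := by
      refine (Set.ssubset_iff_of_subset ?_).2 ⟨(i₀, s), hi₀, ?_⟩
      · rintro ⟨i, t⟩ hit
        simp only [Set.mem_ofPred_eq, hw₀, nodeHom_apply] at hit ⊢
        by_cases hts : t = s
        · subst hts
          by_cases hi : AgreeAbove t (u i) (u i₀)
          · rw [nodeFun_apply_self hi, hφ' i hi] at hit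
            exact absurd rfl hit
          · rwa [nodeFun_of_not hi] at hit
        · rwa [nodeFun_apply_ne hts] at hit
      · simp only [Set.mem_ofPred_eq, hw₀, nodeHom_apply, not_not]
        rw [nodeFun_apply_self (AgreeAbove.refl _ _), hφ' _ (AgreeAbove.refl _ _)]
    obtain ⟨w, hw, hwv⟩ := ih _ (hn ▸ Set.ncard_lt_ncard hss (hfin u)) (fun i => w₀.1 (u i))
      (fun r i j => by rw [lexAt_aut_iff, h]) rfl
    refine ⟨w * w₀, mul_mem hw ?_, fun i => hwv i⟩
    exact Subgroup.mem_iSup_of_mem s (Subgroup.mem_iSup_of_mem (u i₀) ⟨φ, rfl⟩)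

/-- Neighbourhoods in `Aut(Q_S, <lex)` contain all automorphisms agreeing on some finite set. -/
theorem exists_finset_of_mem_nhds {g : AutQ S} {V : Set (AutQ S)} (hV : V ∈ nhds g) :
    ∃ A : Finset (QS S), ∀ h : AutQ S, (∀ a ∈ A, h.1 a = g.1 a) → h ∈ V := by
  classical
  have : DiscreteTopology (QS S) := ⟨rfl⟩
  rw [nhds_induced, nhds_prod_eq, nhds_pi, nhds_pi] at hV
  obtain ⟨U, hU, hUV⟩ := Filter.mem_comap.1 hV
  obtain ⟨U₁, hU₁, U₂, hU₂, hU⟩ := Filter.mem_prod_iff.1 hU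
  obtain ⟨I₁, hI₁, t₁, ht₁, hs₁⟩ := Filter.mem_pi.1 hU₁
  obtain ⟨I₂, hI₂, t₂, ht₂, hs₂⟩ := Filter.mem_pi.1 hU₂
  refine ⟨hI₁.toFinset ∪ hI₂.toFinset.image g.1.symm, fun h hh => hUV (hU ⟨hs₁ ?_, hs₂ ?_⟩)⟩
  · intro a ha
    change h.1 a ∈ t₁ a
    rw [hh a (Finset.mem_union_left _ (hI₁.mem_toFinset.2 ha))]
    exact mem_of_mem_nhds (ht₁ a)
  · intro b hb
    change h.1.symm b ∈ t₂ b
    have := hh _ (Finset.mem_union_right _ (Finset.mem_image_of_mem _ (hI₂.mem_toFinset.2 hb)))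
    rw [Equiv.apply_symm_apply] at this
    rw [h.1.symm_apply_eq.2 this.symm]
    exact mem_of_mem_nhds (ht₂ b)

theorem dense_iSup_level : Dense ((⨆ s : S, level s : Subgroup (AutQ S)) : Set (AutQ S)) := by
  intro g
  rw [mem_closure_iff_nhds]
  intro V hV
  obtain ⟨A, hA⟩ := exists_finset_of_mem_nhds hV
  obtain ⟨w, hw, hwA⟩ := exists_mem_iSup_level (fun a : A => a.1) (fun a => g.1 a.1)
    (fun s i j => (lexAt_aut_iff g s _ _).symm)
  exact ⟨w, hA w fun a ha => hwA ⟨a, ha⟩, hw⟩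

open Uniformity in
theorem hasFixedPoints_range_nodeHom {X : Type*} [UniformSpace X] [CompactSpace X] [T2Space X]
    [MulAction (AutQ S) X] [ContinuousSMul (AutQ S) X] (s : S) (y : QS S) :
    HasFixedPoints X (nodeHom s y).range := by
  refine HasFixedPoints.range_of_rat _ fun W hW => ?_
  have hnhds : ∀ᶠ g in nhds (1 : AutQ S), ∀ x ∈ (Set.univ : Set X), (g • x, x) ∈ W := by
    refine isCompact_univ.eventually_forall_of_forall_eventually fun x _ => ?_
    have hc : Continuous fun p : AutQ S × X => (p.1 • p.2, p.2) :=
      continuous_smul.prodMk continuous_snd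
    have := hc.tendsto (1, x)
    rw [one_smul] at this
    exact this (nhds_le_uniformity x hW)
  obtain ⟨A, hA⟩ := exists_finset_of_mem_nhds hnhds
  classical
  refine ⟨A.image fun a => a.1 s, fun φ hφ x => hA _ (fun a ha => ?_) x trivial⟩
  change nodeFun s y φ a = a
  by_cases h : AgreeAbove s a y
  · refine ext fun t => ?_
    by_cases hts : t = s
    · subst hts
      rw [nodeFun_apply_self h, hφ _ (Finset.mem_image_of_mem _ ha)]
    · rw [nodeFun_apply_ne hts]
  · exact nodeFun_of_not h φ

theorem hasFixedPoints_level {X : Type*} [UniformSpace X] [CompactSpace X] [T2Space X]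
    [MulAction (AutQ S) X] [ContinuousSMul (AutQ S) X] (s : S) :
    HasFixedPoints X (level s) := by
  classical
  refine HasFixedPoints.iSup_of_finset fun F => ?_
  induction F using Finset.induction_on with
  | empty => simpa using HasFixedPoints.bot
  | insert z F _ ih =>
    rw [Finset.iSup_insert, sup_comm]
    refine ih.sup (hasFixedPoints_range_nodeHom s z) ?_
    exact Subgroup.le_normalizer_iSup_of_le fun y => Subgroup.le_normalizer_iSup_of_le fun _ =>
      range_nodeHom_le_normalizer s y z

end QS

/-- `Aut(Q_S, <lex)` is extremely amenable: every continuous action on a nonempty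
compact Hausdorff space has a fixed point. -/
theorem AutQ_extremely_amenable
    (S : Set ℝ) (hScount : S.Countable) (hSpos : ∀ s ∈ S, 0 < s)
    (X : Type*) [TopologicalSpace X] [CompactSpace X] [T2Space X] [Nonempty X]
    (a : AutQ S → X → X)
    (ha_one : ∀ x, a 1 x = x)
    (ha_mul : ∀ g h x, a (g * h) x = a g (a h x))
    (ha_cont : Continuous fun p : AutQ S × X => a p.1 p.2) :
    ∃ x : X, ∀ g : AutQ S, a g x = x := by
  obtain ⟨u, hu⟩ : ∃ u : UniformSpace X, u.toTopologicalSpace = ‹TopologicalSpace X› :=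
    ⟨uniformSpaceOfCompactR1, rfl⟩
  subst hu
  let _ : MulAction (AutQ S) X := { smul := a, one_smul := ha_one, mul_smul := ha_mul }
  have : ContinuousSMul (AutQ S) X := ⟨ha_cont⟩
  have hfix : HasFixedPoints X (⨆ s : S, QS.level s) := by
    classical
    refine HasFixedPoints.iSup_of_finset fun T => ?_
    induction T using Finset.induction_on_max with
    | empty => simpa using HasFixedPoints.bot
    | insert t T hT ih =>
      rw [Finset.iSup_insert, sup_comm]
      refine ih.sup (QS.hasFixedPoints_level t) ?_
      exact Subgroup.le_normalizer_iSup_of_le fun s => Subgroup.le_normalizer_iSup_of_le fun hs =>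
        QS.level_le_normalizer (hT s hs)
  obtain ⟨x, -, hx⟩ := hfix Set.univ isClosed_univ Set.univ_nonempty fun _ _ _ _ => trivial
  refine ⟨x, fun g => ?_⟩
  have hcl : IsClosed {g : AutQ S | a g x = x} :=
    isClosed_eq (ha_cont.comp (continuous_id.prodMk continuous_const)) continuous_const
  exact (hcl.closure_subset_iff.2 hx) (QS.dense_iSup_level g)
end
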